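/- arXiv:1910.08939 — 5 statements merged into one kernel-verified Lean document; each statement's English description precedes it below -/
import Mathlib

section
/- Under the stated assumptions on p, μ, v_±, u_± and s, there exists a smooth function ṽ : ℝ → ℝ solving the profile ODE ṽ'(ξ) = B(ṽ(ξ)) for all ξ ∈ ℝ, with v_+ < ṽ(ξ) < v_− and ṽ'(ξ) < 0 for all ξ, ṽ(ξ) → v_− as ξ → −∞ and ṽ(ξ) → v_+ as ξ → +∞. This solution is unique up to a shift: any other global solution of the same ODE with the same limits at ±∞ equals ξ ↦ ṽ(ξ + c) for some c ∈ ℝ. Moreover the traveling-wave velocity ũ := u_− + s(v_− − ṽ) satisfies ũ'(ξ) ≤ 0 for all ξ. -/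
open MeasureTheory Filter Topology Set

noncomputable section

/-- A function whose derivative on `(a, b)` is the reciprocal of a positive function vanishing at
most linearly at `b` is unbounded above on `(a, b)`. -/
lemma exists_mem_Ioo_le_of_hasDerivAt_inv {a b L : ℝ} {S h : ℝ → ℝ} (hab : a < b) (hL : 0 < L)
    (hS : ∀ v ∈ Ioo a b, HasDerivAt S (h v)⁻¹ v) (hpos : ∀ v ∈ Ioo a b, 0 < h v)
    (hle : ∀ v ∈ Ioo a b, h v ≤ L * (b - v)) (x : ℝ) : ∃ v ∈ Ioo a b, x ≤ S v := by
  obtain ⟨m, hm⟩ := nonempty_Ioo.2 hab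
  have hder : ∀ v ∈ Ioo a b,
      HasDerivAt (fun v => S v + Real.log (b - v) / L) ((h v)⁻¹ + -1 / (b - v) / L) v := by
    intro v hv
    have h1 : HasDerivAt (fun v => b - v) (-1) v := by simpa using (hasDerivAt_id v).const_sub b
    exact (hS v hv).add ((h1.log (sub_pos.2 hv.2).ne').div_const L)
  have hmono : MonotoneOn (fun v => S v + Real.log (b - v) / L) (Ioo a b) := by
    refine monotoneOn_of_hasDerivWithinAt_nonneg
      (f' := fun v => (h v)⁻¹ + -1 / (b - v) / L) (convex_Ioo a b)
      (fun v hv => (hder v hv).continuousAt.continuousWithinAt)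
      (fun v hv => (hder v (interior_subset hv)).hasDerivWithinAt) fun v hv => ?_
    have hv := interior_subset hv
    have hi := inv_anti₀ (hpos v hv) (hle v hv)
    have : -1 / (b - v) / L = -(L * (b - v))⁻¹ := by
      rw [mul_inv, div_div, neg_div, one_div, mul_comm (b - v), mul_inv]
    rw [this]
    linarith
  set K := max 0 (L * (x - S m))
  have hbm : 0 < b - m := sub_pos.2 hm.2
  have hexp : Real.exp (-K) ≤ 1 := Real.exp_le_one_iff.2 (neg_nonpos.2 (le_max_left _ _))
  have hmv : m ≤ b - (b - m) * Real.exp (-K) := by nlinarith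
  have hvb : b - (b - m) * Real.exp (-K) < b := by
    have := mul_pos hbm (Real.exp_pos (-K))
    linarith
  have hv : b - (b - m) * Real.exp (-K) ∈ Ioo a b := ⟨hm.1.trans_le hmv, hvb⟩
  refine ⟨_, hv, ?_⟩
  have hle' := hmono hm hv hmv
  simp only [sub_sub_cancel] at hle'
  rw [Real.log_mul hbm.ne' (Real.exp_pos _).ne', Real.log_exp, add_div, neg_div] at hle'
  have : x - S m ≤ K / L := by
    rw [le_div_iff₀ hL, mul_comm]
    exact le_max_right _ _
  linarith

/-- If `h` is continuous and positive on `(a, b)` and vanishes at most linearly at the end points,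
then `1 / h` has a primitive on `(a, b)` with a global monotone inverse onto `(a, b)`. -/
lemma exists_primitive_inv_inverse {a b L : ℝ} {h : ℝ → ℝ} (hab : a < b) (hL : 0 < L)
    (hcont : ContinuousOn h (Ioo a b)) (hpos : ∀ v ∈ Ioo a b, 0 < h v)
    (hlea : ∀ v ∈ Ioo a b, h v ≤ L * (v - a)) (hleb : ∀ v ∈ Ioo a b, h v ≤ L * (b - v)) :
    ∃ S g : ℝ → ℝ, (∀ v ∈ Ioo a b, HasDerivAt S (h v)⁻¹ v) ∧ (∀ x, g x ∈ Ioo a b) ∧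
      (∀ x, S (g x) = x) ∧ (∀ v ∈ Ioo a b, g (S v) = v) ∧ Monotone g := by
  obtain ⟨m, hm⟩ := nonempty_Ioo.2 hab
  have hinv : ContinuousOn (fun v => (h v)⁻¹) (Ioo a b) := hcont.inv₀ fun v hv => (hpos v hv).ne'
  set S : ℝ → ℝ := fun v => ∫ t in m..v, (h t)⁻¹
  have hS : ∀ v ∈ Ioo a b, HasDerivAt S (h v)⁻¹ v := fun v hv =>
    intervalIntegral.integral_hasDerivAt_right
      ((hinv.mono (ordConnected_Ioo.uIcc_subset hm hv)).intervalIntegrable)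
      (hinv.stronglyMeasurableAtFilter isOpen_Ioo v hv)
      (hinv.continuousAt (isOpen_Ioo.mem_nhds hv))
  have hSc : ContinuousOn S (Ioo a b) := fun v hv => (hS v hv).continuousAt.continuousWithinAt
  have hSm : StrictMonoOn S (Ioo a b) :=
    strictMonoOn_of_hasDerivWithinAt_pos (f' := fun v => (h v)⁻¹) (convex_Ioo a b) hSc
      (fun v hv => (hS v (interior_subset hv)).hasDerivWithinAt)
      fun v hv => inv_pos.2 (hpos v (interior_subset hv))
  have hneg : ∀ v ∈ Ioo (-b) (-a), -v ∈ Ioo a b := fun v hv =>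
    ⟨by linarith [hv.2], by linarith [hv.1]⟩
  have hsurj : ∀ x, ∃ v ∈ Ioo a b, S v = x := by
    intro x
    obtain ⟨v, hv, hxv⟩ := exists_mem_Ioo_le_of_hasDerivAt_inv hab hL hS hpos hleb x
    obtain ⟨w, hw, hxw⟩ := exists_mem_Ioo_le_of_hasDerivAt_inv (a := -b) (b := -a)
      (S := fun v => -S (-v)) (h := fun v => h (-v)) (neg_lt_neg hab) hL
      (fun v hv => by
        have h1 := ((hS (-v) (hneg v hv)).comp v (hasDerivAt_neg v)).neg
        rw [mul_neg_one, neg_neg] at h1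
        exact h1)
      (fun v hv => hpos _ (hneg v hv))
      (fun v hv => by
        have := hlea _ (hneg v hv)
        rwa [show -v - a = -a - v by ring] at this) (-x)
    obtain ⟨y, hy, hyx⟩ := isPreconnected_Ioo.intermediate_value (hneg w hw) hv hSc
      ⟨neg_le_neg_iff.1 hxw, hxv⟩
    exact ⟨y, hy, hyx⟩
  choose g hg hSg using hsurj
  refine ⟨S, g, hS, hg, hSg, fun v hv => hSm.injOn (hg _) hv (hSg _), fun x y hxy => ?_⟩
  rw [← hSm.le_iff_le (hg x) (hg y), hSg, hSg]
  exact hxy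

/-- A scalar vector field positive on `(a, b)` and vanishing at most linearly at `a` and `b` has an
integral curve joining `a` to `b`, and every integral curve meeting `(a, b)` is a shift of it. -/
lemma exists_heteroclinic {a b L : ℝ} {h : ℝ → ℝ} (hab : a < b) (hL : 0 < L)
    (hcont : ContinuousOn h (Ioo a b)) (hpos : ∀ v ∈ Ioo a b, 0 < h v)
    (hlea : ∀ v ∈ Ioo a b, h v ≤ L * (v - a)) (hleb : ∀ v ∈ Ioo a b, h v ≤ L * (b - v)) :
    ∃ g : ℝ → ℝ, (∀ x, HasDerivAt g (h (g x)) x) ∧ (∀ x, g x ∈ Ioo a b) ∧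
      Tendsto g atBot (𝓝 a) ∧ Tendsto g atTop (𝓝 b) ∧
      ∀ w : ℝ → ℝ, (∀ x, HasDerivAt w (h (w x)) x) → (∃ x, w x ∈ Ioo a b) →
        ∃ c, ∀ x, w x = g (x + c) := by
  obtain ⟨S, g, hS, hg, hSg, hgS, hmono⟩ := exists_primitive_inv_inverse hab hL hcont hpos hlea hleb
  have hrange : range g = Ioo a b :=
    Subset.antisymm (range_subset_iff.2 hg) fun v hv => ⟨S v, hgS v hv⟩
  have hgc : Continuous g := continuous_iff_continuousAt.2 fun x =>
    continuousAt_of_monotoneOn_of_image_mem_nhds (hmono.monotoneOn univ) univ_mem <| by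
      rw [image_univ, hrange]
      exact isOpen_Ioo.mem_nhds (hg x)
  refine ⟨g, fun x => ?_, hg, tendsto_atBot_isGLB hmono (hrange ▸ isGLB_Ioo hab),
    tendsto_atTop_isLUB hmono (hrange ▸ isLUB_Ioo hab), ?_⟩
  · simpa using HasDerivAt.of_local_left_inverse hgc.continuousAt (hS _ (hg x))
      (inv_pos.2 (hpos _ (hg x))).ne' (Eventually.of_forall hSg)
  rintro w hw ⟨x₀, hx₀⟩
  have hwc : Continuous w := continuous_iff_continuousAt.2 fun x => (hw x).continuousAt
  refine ⟨S (w x₀) - x₀, ?_⟩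
  have hclosed : IsClosed {x | w x = g (x + (S (w x₀) - x₀))} :=
    isClosed_eq hwc (hgc.comp (continuous_id.add continuous_const))
  have hopen : IsOpen {x | w x = g (x + (S (w x₀) - x₀))} := by
    refine Metric.isOpen_iff.2 fun y hy => ?_
    have hy : w y = g (y + (S (w x₀) - x₀)) := hy
    obtain ⟨ε, hε, hball⟩ := Metric.isOpen_iff.1 (isOpen_Ioo.preimage hwc) y
      (show w y ∈ Ioo a b from hy ▸ hg _)
    refine ⟨ε, hε, fun x hx => ?_⟩
    have hder : ∀ z ∈ Metric.ball y ε, HasDerivAt (fun z => S (w z) - z) 0 z := by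
      intro z hz
      have h1 := ((hS _ (hball hz)).comp z (hw z)).sub (hasDerivAt_id z)
      rw [inv_mul_cancel₀ (hpos _ (hball hz)).ne', sub_self] at h1
      exact h1
    have hconst := Metric.isOpen_ball.is_const_of_deriv_eq_zero
      (convex_ball y ε).isPreconnected
      (fun z hz => (hder z hz).differentiableAt.differentiableWithinAt)
      (fun z hz => (hder z hz).deriv) hx (Metric.mem_ball_self hε)
    have hSy : S (w y) = y + (S (w x₀) - x₀) := by rw [hy, hSg]
    change w x = _
    rw [← hgS _ (hball hx)]
    congr 1
    linarith
  have huniv := IsClopen.eq_univ ⟨hclosed, hopen⟩ ⟨x₀, by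
    change w x₀ = _
    rw [add_sub_cancel, hgS _ hx₀]⟩
  exact fun x => (huniv ▸ mem_univ x : x ∈ {x | w x = g (x + (S (w x₀) - x₀))})

/-- Integral curves of a vector field smooth on a set containing the curve are smooth. -/
lemma contDiff_of_hasDerivAt_comp {U : Set ℝ} {B g : ℝ → ℝ}
    (hB : ContDiffOn ℝ (⊤ : ℕ∞) B U) (hg : ∀ x, g x ∈ U)
    (hd : ∀ x, HasDerivAt g (B (g x)) x) : ContDiff ℝ (⊤ : ℕ∞) g := by
  have hdiff : Differentiable ℝ g := fun x => (hd x).differentiableAt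
  have hderiv : deriv g = B ∘ g := funext fun x => (hd x).deriv
  refine contDiff_infty.2 fun n => ?_
  induction n with
  | zero => exact contDiff_zero.2 hdiff.continuous
  | succ n ih =>
    rw [Nat.cast_succ, contDiff_succ_iff_deriv]
    refine ⟨hdiff, fun hn => absurd hn (by simp), ?_⟩
    rw [hderiv]
    exact (hB.of_le (by exact_mod_cast le_top)).comp_contDiff ih hg

/-- A function with nonnegative second derivative not vanishing on any subinterval is strictly
convex. -/
lemma strictConvexOn_Ioi_of_deriv2_nonneg {p : ℝ → ℝ} {c : ℝ}
    (hp : ContDiffOn ℝ (⊤ : ℕ∞) p (Ioi c))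
    (hnonneg : ∀ v ∈ Ioi c, 0 ≤ deriv (deriv p) v)
    (hne : ∀ a b, c < a → a < b → ∃ v ∈ Ioo a b, deriv (deriv p) v ≠ 0) :
    StrictConvexOn ℝ (Ioi c) p := by
  have hd : DifferentiableOn ℝ (deriv p) (Ioi c) :=
    (hp.deriv_of_isOpen (m := 1) isOpen_Ioi
      (WithTop.coe_le_coe.2 le_top)).differentiableOn one_ne_zero
  have hmono : MonotoneOn (deriv p) (Ioi c) :=
    monotoneOn_of_deriv_nonneg (convex_Ioi c) hd.continuousOn (hd.mono interior_subset)
      fun v hv => hnonneg v (interior_subset hv)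
  refine StrictMonoOn.strictConvexOn_of_deriv (convex_Ioi c) hp.continuousOn ?_
  rw [interior_Ioi]
  intro x hx y hy hxy
  refine (hmono hx hy hxy.le).lt_of_ne fun heq => ?_
  obtain ⟨v, hv, hv0⟩ := hne x y hx hxy
  refine hv0 ?_
  have hev : deriv p =ᶠ[𝓝 v] fun _ => deriv p x := by
    filter_upwards [isOpen_Ioo.mem_nhds hv] with z hz
    have hz' : z ∈ Ioi c := lt_trans hx hz.1
    exact le_antisymm (heq ▸ hmono hz' hy hz.2.le) (hmono hx hz' hz.1.le)
  rw [hev.deriv_eq, deriv_const]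

theorem existence_of_viscous_shock_wave
    (p : ℝ → ℝ)
    (hp_smooth : ContDiffOn ℝ (⊤ : ℕ∞) p (Set.Ioi 0))
    (hpd : ∀ v ∈ Set.Ioi (0:ℝ), deriv p v < 0)
    (hpdd : ∀ v ∈ Set.Ioi (0:ℝ), 0 ≤ deriv (deriv p) v)
    (hpdd_ne : ∀ a b : ℝ, 0 < a → a < b → ∃ v ∈ Set.Ioo a b, deriv (deriv p) v ≠ 0)
    (μ : ℝ → ℝ)
    (hmu_smooth : ContDiffOn ℝ (⊤ : ℕ∞) μ (Set.Ioi 0))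
    (hmu_pos : ∀ v ∈ Set.Ioi (0:ℝ), 0 < μ v)
    (vp vm s : ℝ)
    (hvp : 0 < vp) (hvpvm : vp < vm)
    (hs : s = -Real.sqrt (-((p vp - p vm) / (vp - vm))))
    (hsneg : s < 0)
    (up um : ℝ)
    (hu : up - um = -s * (vp - vm))
 :
    ∃ tv : ℝ → ℝ,
      ContDiff ℝ (⊤ : ℕ∞) tv ∧
      (∀ ξ : ℝ, deriv tv ξ
          = tv ξ / (-s * μ (tv ξ)) * (s ^ 2 * (tv ξ - vm) + p (tv ξ) - p vm)) ∧
      (∀ ξ : ℝ, tv ξ ∈ Set.Ioo vp vm) ∧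
      (∀ ξ : ℝ, deriv tv ξ < 0) ∧
      Filter.Tendsto tv Filter.atBot (nhds vm) ∧
      Filter.Tendsto tv Filter.atTop (nhds vp) ∧
      (∀ w : ℝ → ℝ,
        (∀ ξ : ℝ, HasDerivAt w
          (w ξ / (-s * μ (w ξ)) * (s ^ 2 * (w ξ - vm) + p (w ξ) - p vm)) ξ) →
        Filter.Tendsto w Filter.atBot (nhds vm) →
        Filter.Tendsto w Filter.atTop (nhds vp) →
        ∃ c : ℝ, ∀ ξ : ℝ, w ξ = tv (ξ + c)) ∧
      (∀ ξ : ℝ, deriv (fun y => um + s * (vm - tv y)) ξ ≤ 0) := by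
  have hconv : StrictConvexOn ℝ (Ioi 0) p :=
    strictConvexOn_Ioi_of_deriv2_nonneg hp_smooth hpdd hpdd_ne
  have hvm : 0 < vm := hvp.trans hvpvm
  have hsq : s ^ 2 * (vp - vm) = -(p vp - p vm) := by
    have hpos : 0 < -((p vp - p vm) / (vp - vm)) := Real.sqrt_pos.1 (by linarith)
    rw [hs, neg_sq, Real.sq_sqrt hpos.le, neg_mul, div_mul_cancel₀ _ (sub_neg.2 hvpvm).ne]
  set B : ℝ → ℝ := fun v => v / (-s * μ v) * (s ^ 2 * (v - vm) + p v - p vm) with hBdef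
  have hBsmooth : ContDiffOn ℝ (⊤ : ℕ∞) B (Ioi 0) := by
    refine ContDiffOn.mul (contDiffOn_id.div (contDiffOn_const.mul hmu_smooth) fun v hv =>
      (mul_pos (neg_pos.2 hsneg) (hmu_pos v hv)).ne') ?_
    exact ((contDiffOn_const.mul (contDiffOn_id.sub contDiffOn_const)).add hp_smooth).sub
      contDiffOn_const
  have hBneg : ∀ v ∈ Ioo vp vm, B v < 0 := by
    intro v hv
    have hv0 : 0 < v := hvp.trans hv.1
    refine mul_neg_of_pos_of_neg
      (div_pos hv0 (mul_pos (neg_pos.2 hsneg) (hmu_pos v hv0))) ?_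
    have hslope := hconv.slope_strict_mono_adjacent hvp hvm hv.1 hv.2
    rw [div_lt_div_iff₀ (sub_pos.2 hv.1) (sub_pos.2 hv.2)] at hslope
    have key : (s ^ 2 * (v - vm) + p v - p vm) * (vm - vp) < 0 := by
      have : s ^ 2 * (v - vm) * (vm - vp) = (p vp - p vm) * (v - vm) := by
        linear_combination (-(v - vm)) * hsq
      nlinarith
    exact neg_of_mul_neg_left key (sub_pos.2 hvpvm).le
  have hBvp : B vp = 0 := by
    simp only [hBdef, hsq]
    ring
  have hBvm : B vm = 0 := by simp [hBdef]
  have hsub : Icc vp vm ⊆ Ioi 0 := fun v hv => hvp.trans_le hv.1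
  obtain ⟨K, hK⟩ := (hBsmooth.mono hsub).exists_lipschitzOnWith (by simp) (convex_Icc vp vm)
    isCompact_Icc
  have hlip : ∀ v ∈ Ioo vp vm, ∀ e ∈ Icc vp vm, B e = 0 → -B v ≤ (K + 1) * |v - e| := by
    intro v hv e he hBe
    have h1 := hK.dist_le_mul v (Ioo_subset_Icc_self hv) e he
    rw [Real.dist_eq, Real.dist_eq, hBe, sub_zero] at h1
    linarith [neg_le_abs (B v), abs_nonneg (v - e)]
  obtain ⟨g, hgd, hg, hgbot, hgtop, hguniq⟩ := exists_heteroclinic (h := fun v => -B v) hvpvm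
    (L := K + 1) (by positivity)
    ((hBsmooth.mono (Ioo_subset_Icc_self.trans hsub)).continuousOn.neg)
    (fun v hv => neg_pos.2 (hBneg v hv))
    (fun v hv => by
      have := hlip v hv vp (left_mem_Icc.2 hvpvm.le) hBvp
      rwa [abs_of_pos (sub_pos.2 hv.1)] at this)
    (fun v hv => by
      have := hlip v hv vm (right_mem_Icc.2 hvpvm.le) hBvm
      rwa [abs_sub_comm, abs_of_pos (sub_pos.2 hv.2)] at this)
  have htd : ∀ ξ, HasDerivAt (fun ξ => g (-ξ)) (B (g (-ξ))) ξ := by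
    intro ξ
    have h1 := (hgd (-ξ)).comp ξ (hasDerivAt_neg ξ)
    rw [mul_neg_one, neg_neg] at h1
    exact h1
  have hneg : ∀ ξ, B (g (-ξ)) < 0 := fun ξ => hBneg _ (hg _)
  refine ⟨fun ξ => g (-ξ), contDiff_of_hasDerivAt_comp hBsmooth
    (fun ξ => hsub (Ioo_subset_Icc_self (hg (-ξ)))) htd, fun ξ => (htd ξ).deriv, fun ξ => hg _,
    fun ξ => (htd ξ).deriv.trans_lt (hneg ξ), hgtop.comp tendsto_neg_atBot_atTop,
    hgbot.comp tendsto_neg_atTop_atBot, fun w hw hwbot hwtop => ?_, fun ξ => ?_⟩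
  · have hwd : ∀ ξ, HasDerivAt (fun ξ => w (-ξ)) (-B (w (-ξ))) ξ := by
      intro ξ
      have h1 := (hw (-ξ)).comp ξ (hasDerivAt_neg ξ)
      rw [mul_neg_one] at h1
      exact h1
    have hwc : Continuous w := continuous_iff_continuousAt.2 fun ξ => (hw ξ).continuousAt
    obtain ⟨v, hv⟩ := nonempty_Ioo.2 hvpvm
    obtain ⟨ξ₀, hξ₀⟩ := mem_range_of_exists_le_of_exists_ge hwc
      ((hwtop.eventually_lt_const hv.1).exists.imp fun _ h => h.le)
      ((hwbot.eventually_const_lt hv.2).exists.imp fun _ h => h.le)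
    obtain ⟨c, hc⟩ := hguniq _ hwd ⟨-ξ₀, by rwa [neg_neg, hξ₀]⟩
    refine ⟨-c, fun ξ => ?_⟩
    simpa [add_comm] using hc (-ξ)
  · have h1 := (((htd ξ).const_sub vm).const_mul s).const_add um
    rw [h1.deriv]
    nlinarith [hneg ξ]
end
end

section
/- There exist constants δ₀ > 0 and C₀ > 1, depending only on p, μ, v_±, s and the profile ṽ, such that for every T > 0, every δ ≤ δ₀, and every classical solution (Φ,Ψ) of the integrated perturbation system on ℝ × [0,T] satisfying the a priori smallness assumption with parameter δ, one has for all t ∈ [0,T]: ‖(Φ,Ψ)(t)‖₃² + ∫₀ᵗ (‖Φ_ξ(τ)‖₃² + ‖Ψ_ξ(τ)‖₂²) dτ ≤ C₀ ‖(Φ₀,Ψ₀)‖₃². -/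
open MeasureTheory Filter Topology Set

noncomputable section

noncomputable def L2sq (w : ℝ → ℝ) : ℝ := ∫ ξ : ℝ, (w ξ) ^ 2

noncomputable def HkSq (k : ℕ) (w : ℝ → ℝ) : ℝ :=
  ∑ j ∈ Finset.range (k + 1), L2sq (iteratedDeriv j w)

noncomputable def pairHkSq (k : ℕ) (F G : ℝ → ℝ) : ℝ := HkSq k F + HkSq k G

/-- The nonlinear remainder `G = (g'(v) - g'(ṽ))Φ_ξξ + (g'(v) - g'(ṽ) - g''(ṽ)Φ_ξ)ṽ_ξ`
with `v = ṽ + Φ_ξ`. -/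
noncomputable def Gterm (g tv φ : ℝ → ℝ) (ξ : ℝ) : ℝ :=
  (deriv g (tv ξ + deriv φ ξ) - deriv g (tv ξ)) * iteratedDeriv 2 φ ξ +
    (deriv g (tv ξ + deriv φ ξ) - deriv g (tv ξ)
      - deriv (deriv g) (tv ξ) * deriv φ ξ) * deriv tv ξ

/-- The relative pressure `p(v|ṽ) = p(v) - p(ṽ) - p'(ṽ)(v - ṽ)` with `v = ṽ + Φ_ξ`. -/
noncomputable def prel (p tv φ : ℝ → ℝ) (ξ : ℝ) : ℝ :=
  p (tv ξ + deriv φ ξ) - p (tv ξ) - deriv p (tv ξ) * deriv φ ξ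

/-- A classical solution of the integrated perturbation system on `ℝ × [0,T]`:
`C⁴` in `ξ`, `C¹` in `t` with continuous mixed derivatives `∂_t ∂_ξ^j` (`j ≤ 3`),
satisfying both equations pointwise, with square-integrable `ξ`-derivatives up to order 4
(`L²`-norms continuous in `t`) and derivatives up to order 3 decaying at spatial infinity,
uniformly in `t`. -/
structure IsClassicalSolution (p g tv : ℝ → ℝ) (s T : ℝ) (Φ Ψ : ℝ → ℝ → ℝ) : Prop where
  regΦ : ∀ t ∈ Set.Icc (0:ℝ) T, ContDiff ℝ 4 (Φ t)
  regΨ : ∀ t ∈ Set.Icc (0:ℝ) T, ContDiff ℝ 4 (Ψ t)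
  tdiffΦ : ∀ j : ℕ, j ≤ 3 → ∀ t ∈ Set.Icc (0:ℝ) T, ∀ ξ : ℝ,
    DifferentiableAt ℝ (fun τ => iteratedDeriv j (Φ τ) ξ) t
  tdiffΨ : ∀ j : ℕ, j ≤ 3 → ∀ t ∈ Set.Icc (0:ℝ) T, ∀ ξ : ℝ,
    DifferentiableAt ℝ (fun τ => iteratedDeriv j (Ψ τ) ξ) t
  mixContΦ : ∀ j : ℕ, j ≤ 3 → ContinuousOn
    (fun q : ℝ × ℝ => deriv (fun τ => iteratedDeriv j (Φ τ) q.2) q.1)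
    (Set.Icc (0:ℝ) T ×ˢ (Set.univ : Set ℝ))
  mixContΨ : ∀ j : ℕ, j ≤ 3 → ContinuousOn
    (fun q : ℝ × ℝ => deriv (fun τ => iteratedDeriv j (Ψ τ) q.2) q.1)
    (Set.Icc (0:ℝ) T ×ˢ (Set.univ : Set ℝ))
  spContΦ : ∀ j : ℕ, j ≤ 4 → ContinuousOn
    (fun q : ℝ × ℝ => iteratedDeriv j (Φ q.1) q.2)
    (Set.Icc (0:ℝ) T ×ˢ (Set.univ : Set ℝ))
  spContΨ : ∀ j : ℕ, j ≤ 4 → ContinuousOn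
    (fun q : ℝ × ℝ => iteratedDeriv j (Ψ q.1) q.2)
    (Set.Icc (0:ℝ) T ×ˢ (Set.univ : Set ℝ))
  eq1 : ∀ t ∈ Set.Icc (0:ℝ) T, ∀ ξ : ℝ,
    deriv (fun τ => Φ τ ξ) t - s * deriv (Φ t) ξ - deriv (Ψ t) ξ
        - deriv g (tv ξ) * iteratedDeriv 2 (Φ t) ξ
        - deriv (deriv g) (tv ξ) * deriv tv ξ * deriv (Φ t) ξ
      = Gterm g tv (Φ t) ξ
  eq2 : ∀ t ∈ Set.Icc (0:ℝ) T, ∀ ξ : ℝ,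
    deriv (fun τ => Ψ τ ξ) t - s * deriv (Ψ t) ξ + deriv p (tv ξ) * deriv (Φ t) ξ
      = -prel p tv (Φ t) ξ
  sqIntΦ : ∀ j : ℕ, j ≤ 4 → ∀ t ∈ Set.Icc (0:ℝ) T,
    MeasureTheory.Integrable (fun ξ : ℝ => (iteratedDeriv j (Φ t) ξ) ^ 2)
  sqIntΨ : ∀ j : ℕ, j ≤ 4 → ∀ t ∈ Set.Icc (0:ℝ) T,
    MeasureTheory.Integrable (fun ξ : ℝ => (iteratedDeriv j (Ψ t) ξ) ^ 2)
  l2ContΦ : ∀ j : ℕ, j ≤ 4 →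
    ContinuousOn (fun t => L2sq (iteratedDeriv j (Φ t))) (Set.Icc (0:ℝ) T)
  l2ContΨ : ∀ j : ℕ, j ≤ 4 →
    ContinuousOn (fun t => L2sq (iteratedDeriv j (Ψ t))) (Set.Icc (0:ℝ) T)
  decayΦ : ∀ j : ℕ, j ≤ 3 → ∀ ε > (0:ℝ), ∃ R : ℝ, ∀ t ∈ Set.Icc (0:ℝ) T, ∀ ξ : ℝ,
    R ≤ |ξ| → |iteratedDeriv j (Φ t) ξ| < ε
  decayΨ : ∀ j : ℕ, j ≤ 3 → ∀ ε > (0:ℝ), ∃ R : ℝ, ∀ t ∈ Set.Icc (0:ℝ) T, ∀ ξ : ℝ,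
    R ≤ |ξ| → |iteratedDeriv j (Ψ t) ξ| < ε

theorem hasDerivAt_intervalIntegral_param {U : Set ℝ} (hU : IsOpen U) {x₀ : ℝ} (hx₀ : x₀ ∈ U)
    {a b : ℝ} {F F' : ℝ → ℝ → ℝ}
    (hF : ∀ x ∈ U, ∀ y ∈ Ioo (min a b) (max a b), HasDerivAt (fun x => F x y) (F' x y) x)
    (hF' : ContinuousOn (fun q : ℝ × ℝ => F' q.1 q.2) (U ×ˢ uIcc a b))
    (hFc : ∀ x ∈ U, ContinuousOn (F x) (uIcc a b)) :
    HasDerivAt (fun x => ∫ y in a..b, F x y) (∫ y in a..b, F' x₀ y) x₀ := by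
  obtain ⟨ε, hε, hball⟩ := Metric.isOpen_iff.1 hU x₀ hx₀
  have hsub : Metric.closedBall x₀ (ε / 2) ⊆ U :=
    (Metric.closedBall_subset_ball (half_lt_self hε)).trans hball
  have hK : IsCompact (Metric.closedBall x₀ (ε / 2) ×ˢ uIcc a b) :=
    (isCompact_closedBall _ _).prod isCompact_uIcc
  obtain ⟨C, hC⟩ := hK.exists_bound_of_continuousOn
    (hF'.mono (prod_mono hsub subset_rfl))
  have hslice : ContinuousOn (F' x₀) (uIcc a b) :=
    hF'.comp (f := fun y : ℝ => (x₀, y)) (by fun_prop) fun y hy => ⟨hx₀, hy⟩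
  refine (intervalIntegral.hasDerivAt_integral_of_dominated_loc_of_deriv_le
    (s := Metric.closedBall x₀ (ε / 2)) (bound := fun _ => C)
    (Metric.closedBall_mem_nhds _ (half_pos hε)) ?_ ?_ ?_ ?_ ?_ ?_).2
  · filter_upwards [hU.mem_nhds hx₀] with x hx
    exact ((hFc x hx).mono uIoc_subset_uIcc).aestronglyMeasurable measurableSet_uIoc
  · exact (hFc x₀ hx₀).intervalIntegrable
  · exact (hslice.mono uIoc_subset_uIcc).aestronglyMeasurable measurableSet_uIoc
  · exact Eventually.of_forall fun y hy x hx => hC (x, y) ⟨hx, uIoc_subset_uIcc hy⟩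
  · exact intervalIntegrable_const
  · filter_upwards [Measure.ae_ne volume (max a b)] with y hne hy x hx
    exact hF x (hsub hx) y ⟨hy.1, lt_of_le_of_ne hy.2 hne⟩

/-- Symmetry of mixed derivatives when one of them is only known to exist afterwards. -/
theorem hasDerivAt_mixed {T : ℝ} {u u₁ ut u₁t : ℝ → ℝ → ℝ}
    (hx : ∀ τ ∈ Ioo 0 T, ∀ ξ, HasDerivAt (u τ) (u₁ τ ξ) ξ)
    (hut : ∀ τ ∈ Ioo 0 T, ∀ ξ, HasDerivAt (fun τ => u τ ξ) (ut τ ξ) τ)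
    (hu₁t : ∀ τ ∈ Ioo 0 T, ∀ ξ, HasDerivAt (fun τ => u₁ τ ξ) (u₁t τ ξ) τ)
    (hc₁ : ContinuousOn (fun q : ℝ × ℝ => u₁ q.1 q.2) (Icc 0 T ×ˢ univ))
    (hc₁t : ContinuousOn (fun q : ℝ × ℝ => u₁t q.1 q.2) (Icc 0 T ×ˢ univ))
    {τ : ℝ} (hτ : τ ∈ Ioo 0 T) (ξ : ℝ) : HasDerivAt (ut τ) (u₁t τ ξ) ξ := by
  have hsl : ∀ {f : ℝ → ℝ → ℝ}, ContinuousOn (fun q : ℝ × ℝ => f q.1 q.2) (Icc 0 T ×ˢ univ) →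
      ∀ τ ∈ Ioo 0 T, Continuous (f τ) := fun hf τ hτ => by
    rw [← continuousOn_univ]
    exact hf.comp (f := fun y : ℝ => (τ, y)) (by fun_prop)
      fun y _ => ⟨Ioo_subset_Icc_self hτ, trivial⟩
  have key : ∀ x, ut τ x = ut τ 0 + ∫ y in (0 : ℝ)..x, u₁t τ y := fun x => by
    have h1 : HasDerivAt (fun τ => ∫ y in (0 : ℝ)..x, u₁ τ y) (∫ y in (0 : ℝ)..x, u₁t τ y) τ :=
      hasDerivAt_intervalIntegral_param isOpen_Ioo hτ (fun t ht y _ => hu₁t t ht y)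
        (hc₁t.mono (prod_mono Ioo_subset_Icc_self (subset_univ _)))
        fun t ht => (hsl hc₁ t ht).continuousOn
    have h2 : HasDerivAt (fun τ => ∫ y in (0 : ℝ)..x, u₁ τ y) (ut τ x - ut τ 0) τ := by
      refine ((hut τ hτ x).sub (hut τ hτ 0)).congr_of_eventuallyEq ?_
      filter_upwards [isOpen_Ioo.mem_nhds hτ] with t ht
      exact intervalIntegral.integral_eq_sub_of_hasDerivAt (fun y _ => hx t ht y)
        ((hsl hc₁ t ht).intervalIntegrable _ _)
    linarith [h1.unique h2]
  rw [funext key]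
  have hc := hsl hc₁t τ hτ
  exact (intervalIntegral.integral_hasDerivAt_right (hc.intervalIntegrable _ _)
    (hc.stronglyMeasurableAtFilter _ _) hc.continuousAt).const_add _

abbrev stripMeasure (t : ℝ) : Measure (ℝ × ℝ) := (volume.restrict (Ioo 0 t)).prod volume

theorem stripMeasure_eq (t : ℝ) :
    stripMeasure t = (volume : Measure (ℝ × ℝ)).restrict (Ioo 0 t ×ˢ univ) := by
  rw [Measure.volume_eq_prod, ← Measure.prod_restrict, Measure.restrict_univ]

theorem ae_stripMeasure {t : ℝ} {q : ℝ × ℝ → Prop}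
    (h : ∀ τ ∈ Ioo 0 t, ∀ ξ, q (τ, ξ)) : ∀ᵐ z ∂stripMeasure t, q z := by
  rw [stripMeasure_eq]
  exact (ae_restrict_iff' (measurableSet_Ioo.prod .univ)).2
    (Eventually.of_forall fun z hz => h z.1 hz.1 z.2)

theorem aestronglyMeasurable_strip {t : ℝ} {f : ℝ → ℝ → ℝ}
    (hf : ContinuousOn (fun q : ℝ × ℝ => f q.1 q.2) (Icc 0 t ×ˢ univ)) :
    AEStronglyMeasurable (fun q : ℝ × ℝ => f q.1 q.2) (stripMeasure t) := by
  rw [stripMeasure_eq]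
  exact (hf.mono (prod_mono Ioo_subset_Icc_self subset_rfl)).aestronglyMeasurable
    (measurableSet_Ioo.prod .univ)

theorem memLp_strip {t : ℝ} {f : ℝ → ℝ → ℝ}
    (hf : ContinuousOn (fun q : ℝ × ℝ => f q.1 q.2) (Icc 0 t ×ˢ univ))
    (hi : ∀ τ ∈ Icc 0 t, Integrable fun ξ => f τ ξ ^ 2)
    (hc : ContinuousOn (fun τ => ∫ ξ, f τ ξ ^ 2) (Icc 0 t)) :
    MemLp (fun q : ℝ × ℝ => f q.1 q.2) 2 (stripMeasure t) := by
  have hm := aestronglyMeasurable_strip hf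
  refine (memLp_two_iff_integrable_sq hm).2 ?_
  refine (integrable_prod_iff (hm.pow 2)).2 ⟨?_, ?_⟩
  · exact (ae_restrict_iff' measurableSet_Ioo).2
      (Eventually.of_forall fun τ hτ => hi τ (Ioo_subset_Icc_self hτ))
  · simp only [Pi.pow_apply, norm_pow, Real.norm_eq_abs, sq_abs]
    exact (hc.integrableOn_compact (μ := volume) isCompact_Icc).mono_set Ioo_subset_Icc_self

theorem intervalIntegral_eq_Ioo {t : ℝ} (ht : 0 ≤ t) (f : ℝ → ℝ) :
    ∫ τ in (0 : ℝ)..t, f τ = ∫ τ in Ioo 0 t, f τ := by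
  rw [intervalIntegral.integral_of_le ht, integral_Ioc_eq_integral_Ioo]

theorem continuousOn_timeSlice {t : ℝ} {f : ℝ → ℝ → ℝ}
    (hf : ContinuousOn (fun q : ℝ × ℝ => f q.1 q.2) (Icc 0 t ×ˢ univ)) (ξ : ℝ) :
    ContinuousOn (fun τ => f τ ξ) (Icc 0 t) :=
  hf.comp (f := fun τ : ℝ => (τ, ξ)) (by fun_prop) fun τ hτ => ⟨hτ, trivial⟩

/-- Evolution of a spatial integral, given the time derivative of the integrand. -/
theorem integral_sub_eq_of_hasDerivAt_time {t : ℝ} (ht : 0 ≤ t) {u U : ℝ → ℝ → ℝ}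
    (hd : ∀ τ ∈ Icc 0 t, ∀ ξ, HasDerivAt (fun τ => u τ ξ) (U τ ξ) τ)
    (hU : ContinuousOn (fun q : ℝ × ℝ => U q.1 q.2) (Icc 0 t ×ˢ univ))
    (hi : Integrable (fun q : ℝ × ℝ => U q.1 q.2) (stripMeasure t))
    (h0 : Integrable (u 0)) (h1 : Integrable (u t)) :
    (∫ ξ, u t ξ) - ∫ ξ, u 0 ξ = ∫ τ in Ioo 0 t, ∫ ξ, U τ ξ := by
  rw [← integral_sub h1 h0, integral_integral_swap hi]
  congr 1 with ξ
  rw [← intervalIntegral_eq_Ioo ht]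
  refine (intervalIntegral.integral_eq_sub_of_hasDerivAt (fun τ hτ => hd τ ?_ ξ) ?_).symm
  · rwa [uIcc_of_le ht] at hτ
  · refine ContinuousOn.intervalIntegrable ?_
    rw [uIcc_of_le ht]
    exact continuousOn_timeSlice hU ξ

/-- `½‖f‖²` evolves by `-∫∫ f_ξ h_t` when `f = h_ξ`, even if `f_t` is not square-integrable. -/
theorem half_integral_sq_sub_eq {t : ℝ} (ht : 0 ≤ t) {f fx ft ht' : ℝ → ℝ → ℝ}
    (hf : ContinuousOn (fun q : ℝ × ℝ => f q.1 q.2) (Icc 0 t ×ˢ univ))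
    (hfx : ContinuousOn (fun q : ℝ × ℝ => fx q.1 q.2) (Icc 0 t ×ˢ univ))
    (hft : ContinuousOn (fun q : ℝ × ℝ => ft q.1 q.2) (Icc 0 t ×ˢ univ))
    (hht : ContinuousOn (fun q : ℝ × ℝ => ht' q.1 q.2) (Icc 0 t ×ˢ univ))
    (dfx : ∀ τ ∈ Ioo 0 t, ∀ ξ, HasDerivAt (f τ) (fx τ ξ) ξ)
    (dft : ∀ τ ∈ Icc 0 t, ∀ ξ, HasDerivAt (fun τ => f τ ξ) (ft τ ξ) τ)
    (dht : ∀ τ ∈ Ioo 0 t, ∀ ξ, HasDerivAt (ht' τ) (ft τ ξ) ξ)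
    (hi : Integrable (fun q : ℝ × ℝ => f q.1 q.2 * ht' q.1 q.2) (stripMeasure t))
    (hix : Integrable (fun q : ℝ × ℝ => fx q.1 q.2 * ht' q.1 q.2) (stripMeasure t))
    (h0 : Integrable fun ξ => f 0 ξ ^ 2) (h1 : Integrable fun ξ => f t ξ ^ 2) :
    1 / 2 * (∫ ξ, f t ξ ^ 2) - 1 / 2 * (∫ ξ, f 0 ξ ^ 2)
      = ∫ τ in Ioo 0 t, ∫ ξ, -(fx τ ξ * ht' τ ξ) := by
  have hswap : ∀ {k : ℝ → ℝ → ℝ}, Integrable (fun q : ℝ × ℝ => k q.1 q.2) (stripMeasure t) →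
      Integrable fun ξ => ∫ τ in (0 : ℝ)..t, k τ ξ := fun hk => by
    simp only [intervalIntegral_eq_Ioo ht]
    exact hk.integral_prod_right
  have hJ : ∀ ξ, HasDerivAt (fun ξ => ∫ τ in (0 : ℝ)..t, f τ ξ * ht' τ ξ)
      ((∫ τ in (0 : ℝ)..t, fx τ ξ * ht' τ ξ) + (1 / 2 * f t ξ ^ 2 - 1 / 2 * f 0 ξ ^ 2)) ξ := by
    intro ξ
    have hA : ∀ {k l : ℝ → ℝ → ℝ}, ContinuousOn (fun q : ℝ × ℝ => k q.1 q.2) (Icc 0 t ×ˢ univ) →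
        ContinuousOn (fun q : ℝ × ℝ => l q.1 q.2) (Icc 0 t ×ˢ univ) →
        ContinuousOn (fun τ => k τ ξ * l τ ξ) (uIcc 0 t) := fun hk hl => by
      rw [uIcc_of_le ht]
      exact (continuousOn_timeSlice hk ξ).mul (continuousOn_timeSlice hl ξ)
    have hcc : ContinuousOn (fun q : ℝ × ℝ => fx q.1 q.2 * ht' q.1 q.2 + f q.1 q.2 * ft q.1 q.2)
        (Icc 0 t ×ˢ univ) := (hfx.mul hht).add (hf.mul hft)
    have h := hasDerivAt_intervalIntegral_param (a := 0) (b := t) (U := univ) isOpen_univ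
      (x₀ := ξ) trivial (F := fun ξ τ => f τ ξ * ht' τ ξ)
      (F' := fun ξ τ => fx τ ξ * ht' τ ξ + f τ ξ * ft τ ξ)
      (fun x _ y hy => by
        rw [min_eq_left ht, max_eq_right ht] at hy
        exact (dfx y hy x).mul (dht y hy x))
      (by
        rw [uIcc_of_le ht]
        exact hcc.comp (f := fun q : ℝ × ℝ => (q.2, q.1)) (by fun_prop)
          fun q hq => ⟨hq.2, trivial⟩)
      (fun x _ => by
        rw [uIcc_of_le ht]
        exact (continuousOn_timeSlice hf x).mul (continuousOn_timeSlice hht x))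
    rw [intervalIntegral.integral_add (hA hfx hht).intervalIntegrable
      (hA hf hft).intervalIntegrable] at h
    have h2 : ∫ τ in (0 : ℝ)..t, f τ ξ * ft τ ξ = 1 / 2 * f t ξ ^ 2 - 1 / 2 * f 0 ξ ^ 2 := by
      refine intervalIntegral.integral_eq_sub_of_hasDerivAt (f := fun τ => 1 / 2 * f τ ξ ^ 2)
        (fun τ hτ => ?_) (hA hf hft).intervalIntegrable
      rw [uIcc_of_le ht] at hτ
      refine (((dft τ hτ ξ).fun_pow 2).const_mul (1 / 2)).congr_deriv ?_
      push_cast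
      ring
    rwa [h2] at h
  have hi2 : Integrable fun ξ => 1 / 2 * f t ξ ^ 2 - 1 / 2 * f 0 ξ ^ 2 :=
    (h1.const_mul _).sub (h0.const_mul _)
  have hz := integral_eq_zero_of_hasDerivAt_of_integrable hJ ((hswap hix).add hi2) (hswap hi)
  rw [integral_add (hswap hix) hi2, integral_sub (h1.const_mul _) (h0.const_mul _),
    integral_const_mul, integral_const_mul] at hz
  simp only [intervalIntegral_eq_Ioo ht, integral_neg] at hz ⊢
  rw [integral_integral_swap hix]
  linarith

theorem energy_pointwise {c M : ℝ} (hc : 0 < c) (hM : 1 ≤ M) :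
    ∃ C ≥ 0, ∀ x y z q r P' w γ π S : ℝ, |q| ≤ M * S → |r| ≤ M * S → |P'| ≤ M * S → |z| ≤ S →
      c ≤ γ → γ ≤ M → 0 ≤ w → w ≤ M → |1 + w * π| ≤ c / (64 * M ^ 2) →
      -(x * y) - x * (γ * x + q) - w * y * (π * x + r) - c / (8 * M ^ 2) * y ^ 2
          - c / (8 * M ^ 2) * y * (γ * x + q) - c / (8 * M ^ 2) * z * P'
        ≤ -(c / 2) * x ^ 2 - c / (32 * M ^ 2) * y ^ 2 + C * S ^ 2 := by
  have hM0 : 0 < M := by linarith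
  obtain ⟨κ, hκ⟩ : ∃ κ, κ = c / (8 * M ^ 2) := ⟨_, rfl⟩
  have hκ0 : 0 < κ := by rw [hκ]; positivity
  have hκM : κ * M ^ 2 = c / 8 := by rw [hκ]; field_simp
  have hκc : κ ≤ c / 8 := by nlinarith [one_le_pow₀ (n := 2) hM]
  have e1 : c / (64 * M ^ 2) = κ / 8 := by rw [hκ]; field_simp; norm_num
  have e2 : c / (32 * M ^ 2) = κ / 4 := by rw [hκ]; field_simp; norm_num
  rw [← hκ, e1, e2]
  refine ⟨2 / c * M ^ 2 + 2 / κ * M ^ 4 + 2 * κ * M ^ 2 + κ * M, by positivity, ?_⟩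
  intro x y z q r P' w γ π S hq hr hP hz hγ hγM hw hwM hπ
  have hS : 0 ≤ S := (abs_nonneg z).trans hz
  have young : ∀ {A B : ℝ} (η : ℝ), 0 < η → |B| ≤ A → ∀ x : ℝ,
      -(x * B) ≤ η * x ^ 2 + 1 / (4 * η) * A ^ 2 := fun {A B} η hη hB x => by
    have h1 : B ^ 2 ≤ A ^ 2 := sq_le_sq' (abs_le.1 hB).1 (abs_le.1 hB).2
    have h2 : 0 ≤ 1 / (4 * η) * (2 * η * x + B) ^ 2 := by positivity
    have h3 : 1 / (4 * η) * (2 * η * x + B) ^ 2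
        = η * x ^ 2 + x * B + 1 / (4 * η) * B ^ 2 := by field_simp; ring
    have h4 : 1 / (4 * η) * B ^ 2 ≤ 1 / (4 * η) * A ^ 2 := by gcongr
    linarith
  have t1 : -(γ * x ^ 2) ≤ -(c * x ^ 2) := by nlinarith [sq_nonneg x]
  have t2 := young (c / 8) (by positivity) hq x
  have t3 : -(x * y * (1 + w * π)) ≤ κ / 16 * (x ^ 2 + y ^ 2) := by
    have h1 : |x * y| ≤ (x ^ 2 + y ^ 2) / 2 := by
      rw [abs_le]; constructor <;> nlinarith [sq_nonneg (x + y), sq_nonneg (x - y)]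
    have h2 := mul_le_mul h1 hπ (abs_nonneg _) (by positivity)
    rw [← abs_mul] at h2
    nlinarith [neg_le_abs (x * y * (1 + w * π))]
  have hwr : |w * r| ≤ M * (M * S) := by
    rw [abs_mul, abs_of_nonneg hw]
    exact mul_le_mul hwM hr (abs_nonneg _) hM0.le
  have t4 := young (κ / 8) (by positivity) hwr y
  have hγx : |γ * x| ≤ M * |x| := by
    rw [abs_mul, abs_of_nonneg (hc.le.trans hγ)]
    gcongr
  have t5 := mul_le_mul_of_nonneg_left (young (1 / 4) (by norm_num) hγx y) hκ0.le
  have t6 := mul_le_mul_of_nonneg_left (young (1 / 8) (by norm_num) hq y) hκ0.le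
  have t7 : -(z * P') ≤ S * (M * S) := by
    have := mul_le_mul hz hP (abs_nonneg _) hS
    rw [← abs_mul] at this
    linarith [neg_le_abs (z * P')]
  have t7' := mul_le_mul_of_nonneg_left t7 hκ0.le
  rw [mul_pow, sq_abs] at t5
  have f1 : 1 / (4 * (c / 8)) * (M * S) ^ 2 = 2 / c * M ^ 2 * S ^ 2 := by field_simp; ring
  have f2 : 1 / (4 * (κ / 8)) * (M * (M * S)) ^ 2 = 2 / κ * M ^ 4 * S ^ 2 := by
    field_simp; ring
  rw [f1] at t2
  rw [f2] at t4
  have f3 : κ * (1 / 4 * y ^ 2 + 1 / (4 * (1 / 4)) * (M ^ 2 * x ^ 2))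
      = κ / 4 * y ^ 2 + c / 8 * x ^ 2 := by rw [← hκM]; ring
  rw [f3] at t5
  nlinarith [sq_nonneg x, sq_nonneg y, mul_nonneg hκ0.le (sq_nonneg y),
    mul_le_mul_of_nonneg_right hκc (sq_nonneg x)]

theorem integral_le_of_le_deriv_add {e Y Y' b : ℝ → ℝ} (hY : ∀ x, HasDerivAt Y (Y' x) x)
    (iY : Integrable Y) (iY' : Integrable Y') (ie : Integrable e) (ib : Integrable b)
    (h : ∀ x, e x ≤ Y' x + b x) : ∫ x, e x ≤ ∫ x, b x := by
  have h1 := integral_mono ie (iY'.add ib) h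
  simp only [Pi.add_apply] at h1
  rwa [integral_add iY' ib, integral_eq_zero_of_hasDerivAt_of_integrable hY iY' iY, zero_add] at h1

theorem memLp_dominating {α : Type*} [MeasurableSpace α] {ν : Measure α} {a b : ℕ → α → ℝ}
    (K : ℝ) (ha : ∀ i ≤ 4, MemLp (a i) 2 ν) (hb : ∀ i ≤ 4, MemLp (b i) 2 ν) :
    MemLp (fun x => K * ∑ i ∈ Finset.range 5, (|a i x| + |b i x|)) 2 ν :=
  (memLp_finsetSum (Finset.range 5) (f := fun i x => |a i x| + |b i x|) fun i hi => by
    have hi4 : i ≤ 4 := by rw [Finset.mem_range] at hi; omega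
    exact (ha i hi4).abs.add (hb i hi4).abs).const_mul K

/-- The analytic content of a perturbation `(φ 0, ψ 0)` with spatial derivatives `φ j`, `ψ j`, time
derivatives `φt j`, `ψt j` and fluxes `Q j`, `P j`, as used by the energy estimates. -/
structure EnergyFrame (φ ψ φt ψt Q P : ℕ → ℝ → ℝ → ℝ) (γ π : ℝ → ℝ → ℝ) (w w' : ℝ → ℝ)
    (s c M T : ℝ) : Prop where
  dxφ : ∀ j ≤ 3, ∀ τ ∈ Ioo 0 T, ∀ ξ, HasDerivAt (φ j τ) (φ (j + 1) τ ξ) ξ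
  dxψ : ∀ j ≤ 3, ∀ τ ∈ Ioo 0 T, ∀ ξ, HasDerivAt (ψ j τ) (ψ (j + 1) τ ξ) ξ
  dxφt : ∀ j ≤ 2, ∀ τ ∈ Ioo 0 T, ∀ ξ, HasDerivAt (φt j τ) (φt (j + 1) τ ξ) ξ
  dxψt : ∀ j ≤ 2, ∀ τ ∈ Ioo 0 T, ∀ ξ, HasDerivAt (ψt j τ) (ψt (j + 1) τ ξ) ξ
  dtφ : ∀ j ≤ 3, ∀ τ ∈ Icc 0 T, ∀ ξ, HasDerivAt (fun τ => φ j τ ξ) (φt j τ ξ) τ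
  dtψ : ∀ j ≤ 3, ∀ τ ∈ Icc 0 T, ∀ ξ, HasDerivAt (fun τ => ψ j τ ξ) (ψt j τ ξ) τ
  cφ : ∀ j ≤ 4, ContinuousOn (fun q : ℝ × ℝ => φ j q.1 q.2) (Icc 0 T ×ˢ univ)
  cψ : ∀ j ≤ 4, ContinuousOn (fun q : ℝ × ℝ => ψ j q.1 q.2) (Icc 0 T ×ˢ univ)
  cφt : ∀ j ≤ 3, ContinuousOn (fun q : ℝ × ℝ => φt j q.1 q.2) (Icc 0 T ×ˢ univ)
  cψt : ∀ j ≤ 3, ContinuousOn (fun q : ℝ × ℝ => ψt j q.1 q.2) (Icc 0 T ×ˢ univ)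
  iφ : ∀ j ≤ 4, ∀ τ ∈ Icc 0 T, Integrable fun ξ => φ j τ ξ ^ 2
  iψ : ∀ j ≤ 4, ∀ τ ∈ Icc 0 T, Integrable fun ξ => ψ j τ ξ ^ 2
  lφ : ∀ j ≤ 4, ContinuousOn (fun τ => ∫ ξ, φ j τ ξ ^ 2) (Icc 0 T)
  lψ : ∀ j ≤ 4, ContinuousOn (fun τ => ∫ ξ, ψ j τ ξ ^ 2) (Icc 0 T)
  eqφ : ∀ j ≤ 2, ∀ τ ∈ Ioo 0 T, ∀ ξ,
    φt j τ ξ = s * φ (j + 1) τ ξ + ψ (j + 1) τ ξ + Q (j + 1) τ ξ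
  eqψ : ∀ j ≤ 3, ∀ τ ∈ Ioo 0 T, ∀ ξ, ψt j τ ξ = s * ψ (j + 1) τ ξ - P j τ ξ
  dxQ : ∀ τ ∈ Ioo 0 T, ∀ ξ, HasDerivAt (Q 0 τ) (Q 1 τ ξ) ξ
  Q_zero_abs : ∀ τ ∈ Ioo 0 T, ∀ ξ, |Q 0 τ ξ| ≤ M * |φ 1 τ ξ|
  Q_zero_mul : ∀ τ ∈ Ioo 0 T, ∀ ξ, c * φ 1 τ ξ ^ 2 ≤ φ 1 τ ξ * Q 0 τ ξ
  P_zero_abs : ∀ τ ∈ Ioo 0 T, ∀ ξ, |P 0 τ ξ| ≤ M * |φ 1 τ ξ|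
  P_zero_mul : ∀ τ ∈ Ioo 0 T, ∀ ξ,
    |φ 1 τ ξ * ψ 0 τ ξ + w ξ * ψ 0 τ ξ * P 0 τ ξ| ≤ c / 2 * φ 1 τ ξ ^ 2
  Q_succ : ∀ j ≤ 2, ∀ τ ∈ Ioo 0 T, ∀ ξ,
    |Q (j + 1) τ ξ - γ τ ξ * φ (j + 2) τ ξ| ≤ M * ∑ i ∈ Finset.Icc 1 (j + 1), |φ i τ ξ|
  P_succ : ∀ j ≤ 2, ∀ τ ∈ Ioo 0 T, ∀ ξ,
    |P (j + 1) τ ξ - π τ ξ * φ (j + 2) τ ξ| ≤ M * ∑ i ∈ Finset.Icc 1 (j + 1), |φ i τ ξ|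
  γ_mem : ∀ τ ∈ Ioo 0 T, ∀ ξ, γ τ ξ ∈ Icc c M
  π_abs : ∀ τ ∈ Ioo 0 T, ∀ ξ, |π τ ξ| ≤ M
  wπ : ∀ τ ∈ Ioo 0 T, ∀ ξ, |1 + w ξ * π τ ξ| ≤ c / (64 * M ^ 2)
  dw : ∀ ξ, HasDerivAt w (w' ξ) ξ
  cw' : Continuous w'
  w_mem : ∀ ξ, w ξ ∈ Icc c M
  w'_abs : ∀ ξ, |w' ξ| ≤ M
  sw' : ∀ ξ, 0 ≤ s * w' ξ

namespace EnergyFrame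

variable {φ ψ φt ψt Q P : ℕ → ℝ → ℝ → ℝ} {γ π : ℝ → ℝ → ℝ} {w w' : ℝ → ℝ} {s c M T : ℝ}

theorem mono (h : EnergyFrame φ ψ φt ψt Q P γ π w w' s c M T) {t : ℝ} (ht : t ≤ T) :
    EnergyFrame φ ψ φt ψt Q P γ π w w' s c M t := by
  have ho : Ioo 0 t ⊆ Ioo 0 T := Ioo_subset_Ioo_right ht
  have hi : Icc 0 t ⊆ Icc 0 T := Icc_subset_Icc_right ht
  have hp : Icc 0 t ×ˢ (univ : Set ℝ) ⊆ Icc 0 T ×ˢ univ := prod_mono hi subset_rfl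
  exact
  { dxφ := fun j hj τ hτ => h.dxφ j hj τ (ho hτ)
    dxψ := fun j hj τ hτ => h.dxψ j hj τ (ho hτ)
    dxφt := fun j hj τ hτ => h.dxφt j hj τ (ho hτ)
    dxψt := fun j hj τ hτ => h.dxψt j hj τ (ho hτ)
    dtφ := fun j hj τ hτ => h.dtφ j hj τ (hi hτ)
    dtψ := fun j hj τ hτ => h.dtψ j hj τ (hi hτ)
    cφ := fun j hj => (h.cφ j hj).mono hp
    cψ := fun j hj => (h.cψ j hj).mono hp
    cφt := fun j hj => (h.cφt j hj).mono hp
    cψt := fun j hj => (h.cψt j hj).mono hp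
    iφ := fun j hj τ hτ => h.iφ j hj τ (hi hτ)
    iψ := fun j hj τ hτ => h.iψ j hj τ (hi hτ)
    lφ := fun j hj => (h.lφ j hj).mono hi
    lψ := fun j hj => (h.lψ j hj).mono hi
    eqφ := fun j hj τ hτ => h.eqφ j hj τ (ho hτ)
    eqψ := fun j hj τ hτ => h.eqψ j hj τ (ho hτ)
    dxQ := fun τ hτ => h.dxQ τ (ho hτ)
    Q_zero_abs := fun τ hτ => h.Q_zero_abs τ (ho hτ)
    Q_zero_mul := fun τ hτ => h.Q_zero_mul τ (ho hτ)
    P_zero_abs := fun τ hτ => h.P_zero_abs τ (ho hτ)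
    P_zero_mul := fun τ hτ => h.P_zero_mul τ (ho hτ)
    Q_succ := fun j hj τ hτ => h.Q_succ j hj τ (ho hτ)
    P_succ := fun j hj τ hτ => h.P_succ j hj τ (ho hτ)
    γ_mem := fun τ hτ => h.γ_mem τ (ho hτ)
    π_abs := fun τ hτ => h.π_abs τ (ho hτ)
    wπ := fun τ hτ => h.wπ τ (ho hτ)
    dw := h.dw
    cw' := h.cw'
    w_mem := h.w_mem
    w'_abs := h.w'_abs
    sw' := h.sw' }

theorem abs_φ_le {i : ℕ} (hi : i ≤ 4) (τ ξ : ℝ) :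
    |φ i τ ξ| ≤ ∑ i ∈ Finset.range 5, (|φ i τ ξ| + |ψ i τ ξ|) :=
  (le_add_of_nonneg_right (abs_nonneg _)).trans <|
    Finset.single_le_sum (f := fun i => |φ i τ ξ| + |ψ i τ ξ|) (fun _ _ => by positivity)
      (Finset.mem_range.2 (by omega))

theorem abs_ψ_le {i : ℕ} (hi : i ≤ 4) (τ ξ : ℝ) :
    |ψ i τ ξ| ≤ ∑ i ∈ Finset.range 5, (|φ i τ ξ| + |ψ i τ ξ|) :=
  (le_add_of_nonneg_left (abs_nonneg _)).trans <|
    Finset.single_le_sum (f := fun i => |φ i τ ξ| + |ψ i τ ξ|) (fun _ _ => by positivity)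
      (Finset.mem_range.2 (by omega))

theorem sum_abs_φ_le {k : ℕ} (hk : k ≤ 4) (τ ξ : ℝ) :
    ∑ i ∈ Finset.Icc 1 k, |φ i τ ξ| ≤ ∑ i ∈ Finset.range 5, (|φ i τ ξ| + |ψ i τ ξ|) :=
  calc _ ≤ ∑ i ∈ Finset.range 5, |φ i τ ξ| :=
        Finset.sum_le_sum_of_subset_of_nonneg
          (fun i hi => by rw [Finset.mem_Icc] at hi; exact Finset.mem_range.2 (by omega))
          fun _ _ _ => abs_nonneg _
    _ ≤ _ := Finset.sum_le_sum fun _ _ => le_add_of_nonneg_right (abs_nonneg _)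

theorem abs_flux_le {j : ℕ} (hj : j ≤ 2) {τ ξ q g : ℝ} (hM : 0 ≤ M) (hg : |g| ≤ M)
    (hq : |q - g * φ (j + 2) τ ξ| ≤ M * ∑ i ∈ Finset.Icc 1 (j + 1), |φ i τ ξ|) :
    |q| ≤ 2 * M * ∑ i ∈ Finset.range 5, (|φ i τ ξ| + |ψ i τ ξ|) := by
  have h1 : |g * φ (j + 2) τ ξ| ≤ M * ∑ i ∈ Finset.range 5, (|φ i τ ξ| + |ψ i τ ξ|) := by
    rw [abs_mul]
    exact mul_le_mul hg (abs_φ_le (by omega) τ ξ) (abs_nonneg _) hM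
  have h2 := mul_le_mul_of_nonneg_left (sum_abs_φ_le (φ := φ) (ψ := ψ) (k := j + 1)
    (by omega) τ ξ) hM
  have h3 := abs_add_le (q - g * φ (j + 2) τ ξ) (g * φ (j + 2) τ ξ)
  rw [sub_add_cancel] at h3
  linarith

theorem abs_φt_le (h : EnergyFrame φ ψ φt ψt Q P γ π w w' s c M T) (hc : 0 < c) (hM : 0 ≤ M)
    {j : ℕ} (hj : j ≤ 2) {τ : ℝ} (hτ : τ ∈ Ioo 0 T) (ξ : ℝ) :
    |φt j τ ξ| ≤ (|s| + 1 + 2 * M) * ∑ i ∈ Finset.range 5, (|φ i τ ξ| + |ψ i τ ξ|) := by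
  have hγ := h.γ_mem τ hτ ξ
  have h1 := abs_flux_le (ψ := ψ) hj hM (by rw [abs_of_nonneg (hc.le.trans hγ.1)]; exact hγ.2)
    (h.Q_succ j hj τ hτ ξ)
  have h2 := mul_le_mul_of_nonneg_left
    (abs_φ_le (φ := φ) (ψ := ψ) (i := j + 1) (by omega) τ ξ) (abs_nonneg s)
  have h3 := abs_ψ_le (φ := φ) (ψ := ψ) (i := j + 1) (by omega) τ ξ
  rw [← abs_mul] at h2
  rw [h.eqφ j hj τ hτ ξ]
  have h4 := abs_add_three (s * φ (j + 1) τ ξ) (ψ (j + 1) τ ξ) (Q (j + 1) τ ξ)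
  linarith

theorem abs_ψt_le (h : EnergyFrame φ ψ φt ψt Q P γ π w w' s c M T) (hM : 0 ≤ M)
    {j : ℕ} (hj : j ≤ 3) {τ : ℝ} (hτ : τ ∈ Ioo 0 T) (ξ : ℝ) :
    |ψt j τ ξ| ≤ (|s| + 1 + 2 * M) * ∑ i ∈ Finset.range 5, (|φ i τ ξ| + |ψ i τ ξ|) := by
  have h0 := (abs_nonneg _).trans (abs_φ_le (φ := φ) (ψ := ψ) (i := 0) (by omega) τ ξ)
  have h1 : |P j τ ξ| ≤ 2 * M * ∑ i ∈ Finset.range 5, (|φ i τ ξ| + |ψ i τ ξ|) := by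
    rcases j with _ | j
    · have := mul_le_mul_of_nonneg_left
        (abs_φ_le (φ := φ) (ψ := ψ) (i := 1) (by omega) τ ξ) hM
      nlinarith [h.P_zero_abs τ hτ ξ, mul_nonneg hM h0]
    · exact abs_flux_le (by omega) hM (h.π_abs τ hτ ξ) (h.P_succ j (by omega) τ hτ ξ)
  have h2 := mul_le_mul_of_nonneg_left
    (abs_ψ_le (φ := φ) (ψ := ψ) (i := j + 1) (by omega) τ ξ) (abs_nonneg s)
  rw [← abs_mul] at h2
  rw [h.eqψ j hj τ hτ ξ]
  have h4 := abs_sub (s * ψ (j + 1) τ ξ) (P j τ ξ)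
  linarith

theorem slice_continuous {f : ℝ → ℝ → ℝ}
    (hf : ContinuousOn (fun q : ℝ × ℝ => f q.1 q.2) (Icc 0 T ×ˢ univ)) {τ : ℝ}
    (hτ : τ ∈ Icc 0 T) : Continuous (f τ) := by
  rw [← continuousOn_univ]
  exact hf.comp (f := fun y : ℝ => (τ, y)) (by fun_prop) fun y _ => ⟨hτ, trivial⟩

theorem memLp_φ (h : EnergyFrame φ ψ φt ψt Q P γ π w w' s c M T) {j : ℕ} (hj : j ≤ 4) {τ : ℝ}
    (hτ : τ ∈ Icc 0 T) : MemLp (φ j τ) 2 :=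
  (memLp_two_iff_integrable_sq (slice_continuous (h.cφ j hj) hτ).aestronglyMeasurable).2
    (h.iφ j hj τ hτ)

theorem memLp_ψ (h : EnergyFrame φ ψ φt ψt Q P γ π w w' s c M T) {j : ℕ} (hj : j ≤ 4) {τ : ℝ}
    (hτ : τ ∈ Icc 0 T) : MemLp (ψ j τ) 2 :=
  (memLp_two_iff_integrable_sq (slice_continuous (h.cψ j hj) hτ).aestronglyMeasurable).2
    (h.iψ j hj τ hτ)

theorem memLp_φt (h : EnergyFrame φ ψ φt ψt Q P γ π w w' s c M T) (hc : 0 < c) (hM : 0 ≤ M)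
    {j : ℕ} (hj : j ≤ 2) {τ : ℝ} (hτ : τ ∈ Ioo 0 T) : MemLp (φt j τ) 2 := by
  have hτ' := Ioo_subset_Icc_self hτ
  exact MemLp.mono' (memLp_dominating (|s| + 1 + 2 * M) (fun i hi => h.memLp_φ hi hτ')
    fun i hi => h.memLp_ψ hi hτ')
    (slice_continuous (h.cφt j (by omega)) hτ').aestronglyMeasurable
    (Eventually.of_forall fun ξ => h.abs_φt_le hc hM hj hτ ξ)

theorem memLp_ψt (h : EnergyFrame φ ψ φt ψt Q P γ π w w' s c M T) (hM : 0 ≤ M)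
    {j : ℕ} (hj : j ≤ 3) {τ : ℝ} (hτ : τ ∈ Ioo 0 T) : MemLp (ψt j τ) 2 := by
  have hτ' := Ioo_subset_Icc_self hτ
  exact MemLp.mono' (memLp_dominating (|s| + 1 + 2 * M) (fun i hi => h.memLp_φ hi hτ')
    fun i hi => h.memLp_ψ hi hτ')
    (slice_continuous (h.cψt j (by omega)) hτ').aestronglyMeasurable
    (Eventually.of_forall fun ξ => h.abs_ψt_le hM hj hτ ξ)

theorem strip_φ (h : EnergyFrame φ ψ φt ψt Q P γ π w w' s c M T) {j : ℕ} (hj : j ≤ 4) :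
    MemLp (fun q : ℝ × ℝ => φ j q.1 q.2) 2 (stripMeasure T) :=
  memLp_strip (h.cφ j hj) (h.iφ j hj) (h.lφ j hj)

theorem strip_ψ (h : EnergyFrame φ ψ φt ψt Q P γ π w w' s c M T) {j : ℕ} (hj : j ≤ 4) :
    MemLp (fun q : ℝ × ℝ => ψ j q.1 q.2) 2 (stripMeasure T) :=
  memLp_strip (h.cψ j hj) (h.iψ j hj) (h.lψ j hj)

theorem strip_dominating (h : EnergyFrame φ ψ φt ψt Q P γ π w w' s c M T) :
    MemLp (fun q : ℝ × ℝ => (|s| + 1 + 2 * M) *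
      ∑ i ∈ Finset.range 5, (|φ i q.1 q.2| + |ψ i q.1 q.2|)) 2 (stripMeasure T) :=
  memLp_dominating _ (fun _ hi => h.strip_φ hi) fun _ hi => h.strip_ψ hi

theorem strip_φt (h : EnergyFrame φ ψ φt ψt Q P γ π w w' s c M T) (hc : 0 < c) (hM : 0 ≤ M)
    {j : ℕ} (hj : j ≤ 2) : MemLp (fun q : ℝ × ℝ => φt j q.1 q.2) 2 (stripMeasure T) :=
  h.strip_dominating.mono' (aestronglyMeasurable_strip (h.cφt j (by omega)))
    (ae_stripMeasure fun _ hτ ξ => h.abs_φt_le hc hM hj hτ ξ)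

theorem strip_ψt (h : EnergyFrame φ ψ φt ψt Q P γ π w w' s c M T) (hM : 0 ≤ M)
    {j : ℕ} (hj : j ≤ 3) : MemLp (fun q : ℝ × ℝ => ψt j q.1 q.2) 2 (stripMeasure T) :=
  h.strip_dominating.mono' (aestronglyMeasurable_strip (h.cψt j (by omega)))
    (ae_stripMeasure fun _ hτ ξ => h.abs_ψt_le hM hj hτ ξ)

theorem w_continuous (h : EnergyFrame φ ψ φt ψt Q P γ π w w' s c M T) : Continuous w :=
  continuous_iff_continuousAt.2 fun ξ => (h.dw ξ).continuousAt

theorem abs_w_le (h : EnergyFrame φ ψ φt ψt Q P γ π w w' s c M T) (hc : 0 < c) (ξ : ℝ) :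
    |w ξ| ≤ M := by
  rw [abs_of_nonneg (hc.le.trans (h.w_mem ξ).1)]
  exact (h.w_mem ξ).2

theorem memLp_bdd_mul {v f : ℝ → ℝ} (hv : Continuous v) (hvM : ∀ ξ, |v ξ| ≤ M)
    (hf : MemLp f 2) : MemLp (fun ξ => v ξ * f ξ) 2 :=
  (hf.abs.const_mul M).mono' (hv.aestronglyMeasurable.mul hf.1) <| Eventually.of_forall fun ξ => by
    rw [Real.norm_eq_abs, abs_mul]
    exact mul_le_mul_of_nonneg_right (hvM ξ) (abs_nonneg _)

theorem strip_w_mul (h : EnergyFrame φ ψ φt ψt Q P γ π w w' s c M T) (hc : 0 < c)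
    {f : ℝ × ℝ → ℝ} (hf : MemLp f 2 (stripMeasure T)) :
    MemLp (fun q => w q.2 * f q) 2 (stripMeasure T) :=
  (hf.abs.const_mul M).mono'
    ((h.w_continuous.comp continuous_snd).aestronglyMeasurable.mul hf.1) <|
    Eventually.of_forall fun q => by
      rw [Real.norm_eq_abs, abs_mul]
      exact mul_le_mul_of_nonneg_right (h.abs_w_le hc q.2) (abs_nonneg _)

theorem _root_.MeasureTheory.MemLp.integrable_fun_mul {α : Type*} [MeasurableSpace α]
    {ν : Measure α} {f g : α → ℝ} (hf : MemLp f 2 ν) (hg : MemLp g 2 ν) :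
    Integrable (fun x => f x * g x) ν := hf.integrable_mul hg

theorem slice_zero_le (h : EnergyFrame φ ψ φt ψt Q P γ π w w' s c M T) (hc : 0 < c) (hM : 0 ≤ M)
    {τ : ℝ} (hτ : τ ∈ Ioo 0 T) :
    ∫ ξ, (φ 0 τ ξ * φt 0 τ ξ + w ξ * ψ 0 τ ξ * ψt 0 τ ξ) ≤ ∫ ξ, -(c / 2) * φ 1 τ ξ ^ 2 := by
  have hτ' := Ioo_subset_Icc_self hτ
  have mφ0 := h.memLp_φ (j := 0) (by omega) hτ'
  have mφ1 := h.memLp_φ (j := 1) (by omega) hτ'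
  have mψ0 := h.memLp_ψ (j := 0) (by omega) hτ'
  have mψ1 := h.memLp_ψ (j := 1) (by omega) hτ'
  have mφt := h.memLp_φt hc hM (j := 0) (by omega) hτ
  have mψt := h.memLp_ψt hM (j := 0) (by omega) hτ
  have mw := memLp_bdd_mul h.w_continuous (h.abs_w_le hc) mψ0
  have mw' := memLp_bdd_mul h.cw' h.w'_abs mψ0
  have mQ0 : MemLp (Q 0 τ) 2 := by
    refine (mφ1.abs.const_mul M).mono' ?_ (Eventually.of_forall fun ξ => h.Q_zero_abs τ hτ ξ)
    exact (continuous_iff_continuousAt.2 fun ξ => (h.dxQ τ hτ ξ).continuousAt).aestronglyMeasurable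
  have mQ1 : MemLp (Q 1 τ) 2 := by
    refine ((mφt.sub (mφ1.const_mul s)).sub mψ1).ae_eq (Eventually.of_forall fun ξ => ?_)
    simp only [Pi.sub_apply, h.eqφ 0 (by omega) τ hτ ξ, zero_add]
    ring
  have iφ1 := h.iφ 1 (by omega) τ hτ'
  refine integral_le_of_le_deriv_add
    (Y := fun ξ => s / 2 * (φ 0 τ ξ * φ 0 τ ξ) + φ 0 τ ξ * ψ 0 τ ξ + φ 0 τ ξ * Q 0 τ ξ
      + s / 2 * (w ξ * ψ 0 τ ξ * ψ 0 τ ξ))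
    (Y' := fun ξ => s * (φ 0 τ ξ * φ 1 τ ξ) + φ 1 τ ξ * ψ 0 τ ξ + φ 0 τ ξ * ψ 1 τ ξ
      + φ 1 τ ξ * Q 0 τ ξ + φ 0 τ ξ * Q 1 τ ξ + s / 2 * (w' ξ * ψ 0 τ ξ * ψ 0 τ ξ)
      + s * (w ξ * ψ 0 τ ξ * ψ 1 τ ξ)) (fun ξ => ?_) ?_ ?_ ?_ (iφ1.const_mul _) (fun ξ => ?_)
  · have d0 := h.dxφ 0 (by omega) τ hτ ξ
    have e0 := h.dxψ 0 (by omega) τ hτ ξ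
    refine ((((d0.fun_mul d0).const_mul (s / 2)).fun_add (d0.fun_mul e0)).fun_add
      (d0.fun_mul (h.dxQ τ hτ ξ))).fun_add
      ((((h.dw ξ).fun_mul e0).fun_mul e0).const_mul (s / 2)) |>.congr_deriv ?_
    ring
  · exact ((((mφ0.integrable_fun_mul mφ0).const_mul _).add (mφ0.integrable_fun_mul mψ0)).add
      (mφ0.integrable_fun_mul mQ0)).add ((mw.integrable_fun_mul mψ0).const_mul _)
  · exact (((((((mφ0.integrable_fun_mul mφ1).const_mul _).add (mφ1.integrable_fun_mul mψ0)).add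
      (mφ0.integrable_fun_mul mψ1)).add (mφ1.integrable_fun_mul mQ0)).add
      (mφ0.integrable_fun_mul mQ1)).add ((mw'.integrable_fun_mul mψ0).const_mul _)).add
      ((mw.integrable_fun_mul mψ1).const_mul _)
  · exact (mφ0.integrable_fun_mul mφt).add (mw.integrable_fun_mul mψt)
  · have h1 := h.Q_zero_mul τ hτ ξ
    have h2 := (abs_le.1 (h.P_zero_mul τ hτ ξ)).1
    have h3 := mul_nonneg (h.sw' ξ) (sq_nonneg (ψ 0 τ ξ))
    simp only [h.eqφ 0 (by omega) τ hτ ξ, h.eqψ 0 (by omega) τ hτ ξ, zero_add]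
    linarith

theorem slice_succ_le (hc : 0 < c) (hM : 1 ≤ M) : ∃ C ≥ 0, ∀ {φ ψ φt ψt Q P : ℕ → ℝ → ℝ → ℝ}
    {γ π : ℝ → ℝ → ℝ} {w w' : ℝ → ℝ} {T : ℝ}, EnergyFrame φ ψ φt ψt Q P γ π w w' s c M T →
    ∀ k ≤ 2, ∀ τ ∈ Ioo 0 T,
    ∫ ξ, (w ξ * ψ (k + 1) τ ξ * ψt (k + 1) τ ξ
        - c / (8 * M ^ 2) * (ψ (k + 1) τ ξ * φt k τ ξ + ψt (k + 1) τ ξ * φ k τ ξ)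
        + -(φ (k + 2) τ ξ * φt k τ ξ))
      ≤ ∫ ξ, (-(c / 2) * φ (k + 2) τ ξ ^ 2 - c / (32 * M ^ 2) * ψ (k + 1) τ ξ ^ 2
        + C * ∑ i ∈ Finset.Icc 1 (k + 1), φ i τ ξ ^ 2) := by
  obtain ⟨C, hC, hpt⟩ := energy_pointwise hc hM
  refine ⟨3 * C, by positivity, fun {φ ψ φt ψt Q P γ π w w' T} h k hk τ hτ => ?_⟩
  have hM0 : 0 ≤ M := by linarith
  have hτ' := Ioo_subset_Icc_self hτ
  have mφ0 := h.memLp_φ (j := k) (by omega) hτ'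
  have mφ1 := h.memLp_φ (j := k + 1) (by omega) hτ'
  have mφ2 := h.memLp_φ (j := k + 2) (by omega) hτ'
  have mψ1 := h.memLp_ψ (j := k + 1) (by omega) hτ'
  have mψ2 := h.memLp_ψ (j := k + 2) (by omega) hτ'
  have mφt := h.memLp_φt hc hM0 hk hτ
  have mψt := h.memLp_ψt hM0 (j := k) (by omega) hτ
  have mψt1 := h.memLp_ψt hM0 (j := k + 1) (by omega) hτ
  have mw := memLp_bdd_mul h.w_continuous (h.abs_w_le hc) mψ1
  have mw' := memLp_bdd_mul h.cw' h.w'_abs mψ1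
  set κ := c / (8 * M ^ 2)
  refine integral_le_of_le_deriv_add
    (Y := fun ξ => s / 2 * (w ξ * ψ (k + 1) τ ξ * ψ (k + 1) τ ξ)
      - s / 2 * (φ (k + 1) τ ξ * φ (k + 1) τ ξ) - κ * (φ k τ ξ * ψt k τ ξ))
    (Y' := fun ξ => s / 2 * (w' ξ * ψ (k + 1) τ ξ * ψ (k + 1) τ ξ)
      + s * (w ξ * ψ (k + 1) τ ξ * ψ (k + 2) τ ξ) - s * (φ (k + 1) τ ξ * φ (k + 2) τ ξ)
      - κ * (φ (k + 1) τ ξ * ψt k τ ξ + φ k τ ξ * ψt (k + 1) τ ξ))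
    (fun ξ => ?_) ?_ ?_ ?_ ?_ (fun ξ => ?_)
  · have d0 := h.dxφ k (by omega) τ hτ ξ
    have d1 := h.dxφ (k + 1) (by omega) τ hτ ξ
    have e1 := h.dxψ (k + 1) (by omega) τ hτ ξ
    refine (((((h.dw ξ).fun_mul e1).fun_mul e1).const_mul (s / 2)).fun_sub
      ((d1.fun_mul d1).const_mul (s / 2))).fun_sub
      ((d0.fun_mul (h.dxψt k (by omega) τ hτ ξ)).const_mul κ) |>.congr_deriv ?_
    ring
  · exact (((mw.integrable_fun_mul mψ1).const_mul _).sub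
      ((mφ1.integrable_fun_mul mφ1).const_mul _)).sub ((mφ0.integrable_fun_mul mψt).const_mul _)
  · exact ((((mw'.integrable_fun_mul mψ1).const_mul _).add
      ((mw.integrable_fun_mul mψ2).const_mul _)).sub
      ((mφ1.integrable_fun_mul mφ2).const_mul _)).sub
      (((mφ1.integrable_fun_mul mψt).add (mφ0.integrable_fun_mul mψt1)).const_mul _)
  · exact ((mw.integrable_fun_mul mψt1).sub (((mψ1.integrable_fun_mul mφt).add
      (mψt1.integrable_fun_mul mφ0)).const_mul _)).add (mφ2.integrable_fun_mul mφt).neg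
  · refine (((h.iφ _ (by omega) τ hτ').const_mul _).sub
      ((h.iψ _ (by omega) τ hτ').const_mul _)).add
      ((integrable_finsetSum _ fun i hi => ?_).const_mul _)
    rw [Finset.mem_Icc] at hi
    exact h.iφ i (by omega) τ hτ'
  · have hγ := h.γ_mem τ hτ ξ
    have hw := h.w_mem ξ
    have hz : |φ (k + 1) τ ξ| ≤ ∑ i ∈ Finset.Icc 1 (k + 1), |φ i τ ξ| :=
      Finset.single_le_sum (f := fun i => |φ i τ ξ|) (fun _ _ => abs_nonneg _)
        (Finset.mem_Icc.2 (by omega))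
    have hP : |P k τ ξ| ≤ M * ∑ i ∈ Finset.Icc 1 (k + 1), |φ i τ ξ| := by
      rcases k with _ | k
      · simpa using h.P_zero_abs τ hτ ξ
      · have h1 := h.P_succ k (by omega) τ hτ ξ
        have h2 : |π τ ξ * φ (k + 2) τ ξ| ≤ M * |φ (k + 2) τ ξ| := by
          rw [abs_mul]
          exact mul_le_mul_of_nonneg_right (h.π_abs τ hτ ξ) (abs_nonneg _)
        have h3 := abs_add_le (P (k + 1) τ ξ - π τ ξ * φ (k + 2) τ ξ) (π τ ξ * φ (k + 2) τ ξ)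
        rw [sub_add_cancel] at h3
        rw [Finset.sum_Icc_succ_top (by omega)]
        linarith
    have key := hpt (φ (k + 2) τ ξ) (ψ (k + 1) τ ξ) (φ (k + 1) τ ξ) _ _ (P k τ ξ) (w ξ)
      (γ τ ξ) (π τ ξ) _ (h.Q_succ k hk τ hτ ξ) (h.P_succ k hk τ hτ ξ) hP hz hγ.1 hγ.2
      (hc.le.trans hw.1) hw.2 (h.wπ τ hτ ξ)
    rw [add_sub_cancel, add_sub_cancel] at key
    have hcs : C * (∑ i ∈ Finset.Icc 1 (k + 1), |φ i τ ξ|) ^ 2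
        ≤ 3 * C * ∑ i ∈ Finset.Icc 1 (k + 1), φ i τ ξ ^ 2 := by
      have h1 := sq_sum_le_card_mul_sum_sq (s := Finset.Icc 1 (k + 1)) (f := fun i => |φ i τ ξ|)
      simp only [sq_abs, Nat.card_Icc, Nat.add_sub_cancel] at h1
      have h2 : ((k + 1 : ℕ) : ℝ) ≤ 3 := by exact_mod_cast (by omega : k + 1 ≤ 3)
      have h3 := mul_le_mul_of_nonneg_right h2
        (Finset.sum_nonneg (s := Finset.Icc 1 (k + 1)) fun i _ => sq_nonneg (φ i τ ξ))
      nlinarith [mul_le_mul_of_nonneg_left (h1.trans h3) hC]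
    have h3 := mul_nonneg (h.sw' ξ) (sq_nonneg (ψ (k + 1) τ ξ))
    simp only [h.eqφ k hk τ hτ ξ, h.eqψ (k + 1) (by omega) τ hτ ξ, h.eqψ k (by omega) τ hτ ξ]
    linarith

theorem time_φ (h : EnergyFrame φ ψ φt ψt Q P γ π w w' s c M T) {j : ℕ} (hj : j ≤ 4) :
    Integrable (fun τ => ∫ ξ, φ j τ ξ ^ 2) (volume.restrict (Ioo 0 T)) :=
  ((h.lφ j hj).integrableOn_compact (μ := volume) isCompact_Icc).mono_set Ioo_subset_Icc_self

theorem time_ψ (h : EnergyFrame φ ψ φt ψt Q P γ π w w' s c M T) {j : ℕ} (hj : j ≤ 4) :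
    Integrable (fun τ => ∫ ξ, ψ j τ ξ ^ 2) (volume.restrict (Ioo 0 T)) :=
  ((h.lψ j hj).integrableOn_compact (μ := volume) isCompact_Icc).mono_set Ioo_subset_Icc_self

theorem integrable_w_sq (h : EnergyFrame φ ψ φt ψt Q P γ π w w' s c M T) (hc : 0 < c)
    {j : ℕ} (hj : j ≤ 4) {τ : ℝ} (hτ : τ ∈ Icc 0 T) :
    Integrable fun ξ => w ξ * ψ j τ ξ ^ 2 := by
  have := (memLp_bdd_mul h.w_continuous (h.abs_w_le hc) (h.memLp_ψ hj hτ)).integrable_fun_mul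
    (h.memLp_ψ hj hτ)
  exact this.congr (Eventually.of_forall fun ξ => by ring)

theorem le_integral_w_sq (h : EnergyFrame φ ψ φt ψt Q P γ π w w' s c M T) (hc : 0 < c)
    {j : ℕ} (hj : j ≤ 4) {τ : ℝ} (hτ : τ ∈ Icc 0 T) :
    c * ∫ ξ, ψ j τ ξ ^ 2 ≤ ∫ ξ, w ξ * ψ j τ ξ ^ 2 := by
  rw [← integral_const_mul]
  exact integral_mono ((h.iψ j hj τ hτ).const_mul c) (h.integrable_w_sq hc hj hτ)
    fun ξ => mul_le_mul_of_nonneg_right (h.w_mem ξ).1 (sq_nonneg _)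

theorem integral_w_sq_le (h : EnergyFrame φ ψ φt ψt Q P γ π w w' s c M T) (hc : 0 < c)
    {j : ℕ} (hj : j ≤ 4) {τ : ℝ} (hτ : τ ∈ Icc 0 T) :
    ∫ ξ, w ξ * ψ j τ ξ ^ 2 ≤ M * ∫ ξ, ψ j τ ξ ^ 2 := by
  rw [← integral_const_mul]
  exact integral_mono (h.integrable_w_sq hc hj hτ) ((h.iψ j hj τ hτ).const_mul M)
    fun ξ => mul_le_mul_of_nonneg_right (h.w_mem ξ).2 (sq_nonneg _)

theorem abs_integral_mul_le {f g : ℝ → ℝ} (hf : MemLp f 2) (hg : MemLp g 2) {η : ℝ}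
    (hη : 0 < η) : |∫ x, f x * g x| ≤ η * (∫ x, f x ^ 2) + 1 / (4 * η) * ∫ x, g x ^ 2 := by
  have hf2 := hf.integrable_sq
  have hg2 := hg.integrable_sq
  rw [← integral_const_mul, ← integral_const_mul,
    ← integral_add (hf2.const_mul η) (hg2.const_mul _)]
  refine (abs_integral_le_integral_abs).trans (integral_mono (hf.integrable_fun_mul hg).abs
    ((hf2.const_mul η).add (hg2.const_mul _)) fun x => ?_)
  have e1 : η * f x ^ 2 + 1 / (4 * η) * g x ^ 2 - f x * g x
      = 1 / (4 * η) * (2 * η * f x - g x) ^ 2 := by field_simp; ring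
  have e2 : η * f x ^ 2 + 1 / (4 * η) * g x ^ 2 + f x * g x
      = 1 / (4 * η) * (2 * η * f x + g x) ^ 2 := by field_simp; ring
  have p1 : 0 ≤ 1 / (4 * η) * (2 * η * f x - g x) ^ 2 := by positivity
  have p2 : 0 ≤ 1 / (4 * η) * (2 * η * f x + g x) ^ 2 := by positivity
  exact abs_le.2 ⟨by linarith, by linarith⟩

theorem level_zero (h : EnergyFrame φ ψ φt ψt Q P γ π w w' s c M T) (hc : 0 < c) (hM : 1 ≤ M)
    (hT : 0 ≤ T) :
    (∫ ξ, φ 0 T ξ ^ 2) + c * (∫ ξ, ψ 0 T ξ ^ 2) + c * (∫ τ in Ioo 0 T, ∫ ξ, φ 1 τ ξ ^ 2)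
      ≤ (∫ ξ, φ 0 0 ξ ^ 2) + M * ∫ ξ, ψ 0 0 ξ ^ 2 := by
  have hM0 : 0 ≤ M := by linarith
  have h0 : (0 : ℝ) ∈ Icc 0 T := left_mem_Icc.2 hT
  have h1 : T ∈ Icc 0 T := right_mem_Icc.2 hT
  have hiu : ∀ τ ∈ Icc 0 T, Integrable fun ξ =>
      1 / 2 * φ 0 τ ξ ^ 2 + 1 / 2 * (w ξ * ψ 0 τ ξ ^ 2) := fun τ hτ =>
    ((h.iφ 0 (by omega) τ hτ).const_mul _).add ((h.integrable_w_sq hc (by omega) hτ).const_mul _)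
  have hint : ∀ τ ∈ Icc 0 T, ∫ ξ, (1 / 2 * φ 0 τ ξ ^ 2 + 1 / 2 * (w ξ * ψ 0 τ ξ ^ 2))
      = 1 / 2 * (∫ ξ, φ 0 τ ξ ^ 2) + 1 / 2 * ∫ ξ, w ξ * ψ 0 τ ξ ^ 2 := fun τ hτ => by
    rw [integral_add ((h.iφ 0 (by omega) τ hτ).const_mul _)
      ((h.integrable_w_sq hc (by omega) hτ).const_mul _), integral_const_mul, integral_const_mul]
  have hcw : ContinuousOn (fun q : ℝ × ℝ => w q.2) (Icc 0 T ×ˢ univ) :=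
    (h.w_continuous.comp continuous_snd).continuousOn
  have hiU : Integrable (fun q : ℝ × ℝ => φ 0 q.1 q.2 * φt 0 q.1 q.2
      + w q.2 * ψ 0 q.1 q.2 * ψt 0 q.1 q.2) (stripMeasure T) :=
    ((h.strip_φ (by omega)).integrable_fun_mul (h.strip_φt hc hM0 (by omega))).add
      ((h.strip_w_mul hc (h.strip_ψ (by omega))).integrable_fun_mul (h.strip_ψt hM0 (by omega)))
  have hev := integral_sub_eq_of_hasDerivAt_time hT
    (u := fun τ ξ => 1 / 2 * φ 0 τ ξ ^ 2 + 1 / 2 * (w ξ * ψ 0 τ ξ ^ 2))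
    (U := fun τ ξ => φ 0 τ ξ * φt 0 τ ξ + w ξ * ψ 0 τ ξ * ψt 0 τ ξ)
    (fun τ hτ ξ => by
      refine (((h.dtφ 0 (by omega) τ hτ ξ).fun_pow 2).const_mul (1 / 2)).fun_add
        ((((h.dtψ 0 (by omega) τ hτ ξ).fun_pow 2).const_mul (w ξ)).const_mul (1 / 2))
        |>.congr_deriv ?_
      push_cast
      ring)
    (((h.cφ 0 (by omega)).mul (h.cφt 0 (by omega))).add
      ((hcw.mul (h.cψ 0 (by omega))).mul (h.cψt 0 (by omega))))
    hiU (hiu 0 h0) (hiu T h1)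
  rw [hint 0 h0, hint T h1] at hev
  have hmono : ∫ τ in Ioo 0 T, ∫ ξ, (φ 0 τ ξ * φt 0 τ ξ + w ξ * ψ 0 τ ξ * ψt 0 τ ξ)
      ≤ ∫ τ in Ioo 0 T, -(c / 2) * ∫ ξ, φ 1 τ ξ ^ 2 :=
    setIntegral_mono_on hiU.integral_prod_left ((h.time_φ (by omega)).const_mul _)
      measurableSet_Ioo fun τ hτ => by
        rw [← integral_const_mul]
        exact h.slice_zero_le hc hM0 hτ
  rw [integral_const_mul] at hmono
  linarith [h.le_integral_w_sq hc (j := 0) (by omega) h1,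
    h.integral_w_sq_le hc (j := 0) (by omega) h0]

theorem level_succ (hc : 0 < c) (hM : 1 ≤ M) : ∃ C ≥ 0, ∀ {φ ψ φt ψt Q P : ℕ → ℝ → ℝ → ℝ}
    {γ π : ℝ → ℝ → ℝ} {w w' : ℝ → ℝ} {T : ℝ}, EnergyFrame φ ψ φt ψt Q P γ π w w' s c M T →
    0 ≤ T → ∀ k ≤ 2,
    1 / 2 * (∫ ξ, φ (k + 1) T ξ ^ 2) + c / 4 * (∫ ξ, ψ (k + 1) T ξ ^ 2)
      + c / 2 * (∫ τ in Ioo 0 T, ∫ ξ, φ (k + 2) τ ξ ^ 2)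
      + c / (32 * M ^ 2) * (∫ τ in Ioo 0 T, ∫ ξ, ψ (k + 1) τ ξ ^ 2)
      ≤ C * ((∫ ξ, φ (k + 1) 0 ξ ^ 2) + (∫ ξ, ψ (k + 1) 0 ξ ^ 2) + (∫ ξ, φ k 0 ξ ^ 2)
        + (∫ ξ, φ k T ξ ^ 2)
        + ∑ i ∈ Finset.Icc 1 (k + 1), ∫ τ in Ioo 0 T, ∫ ξ, φ i τ ξ ^ 2) := by
  obtain ⟨C, hC, hsl⟩ := slice_succ_le (s := s) hc hM
  have hM0 : 0 < M := by linarith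
  obtain ⟨κ, hκ⟩ : ∃ κ, κ = c / (8 * M ^ 2) := ⟨_, rfl⟩
  have hκ0 : 0 < κ := by rw [hκ]; positivity
  simp only [← hκ] at hsl
  refine ⟨C + 1 + M + c + κ ^ 2 * (1 / c), by positivity,
    fun {φ ψ φt ψt Q P γ π w w' T} h hT k hk => ?_⟩
  have h0 : (0 : ℝ) ∈ Icc 0 T := left_mem_Icc.2 hT
  have h1 : T ∈ Icc 0 T := right_mem_Icc.2 hT
  have hcross : ∀ τ ∈ Icc 0 T, Integrable fun ξ => ψ (k + 1) τ ξ * φ k τ ξ := fun τ hτ =>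
    (h.memLp_ψ (by omega) hτ).integrable_fun_mul (h.memLp_φ (by omega) hτ)
  have hiu : ∀ τ ∈ Icc 0 T, Integrable fun ξ =>
      1 / 2 * (w ξ * ψ (k + 1) τ ξ ^ 2) - κ * (ψ (k + 1) τ ξ * φ k τ ξ) := fun τ hτ =>
    ((h.integrable_w_sq hc (by omega) hτ).const_mul _).sub ((hcross τ hτ).const_mul _)
  have hint : ∀ τ ∈ Icc 0 T,
      ∫ ξ, (1 / 2 * (w ξ * ψ (k + 1) τ ξ ^ 2) - κ * (ψ (k + 1) τ ξ * φ k τ ξ))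
      = 1 / 2 * (∫ ξ, w ξ * ψ (k + 1) τ ξ ^ 2) - κ * ∫ ξ, ψ (k + 1) τ ξ * φ k τ ξ :=
    fun τ hτ => by
      rw [integral_sub ((h.integrable_w_sq hc (by omega) hτ).const_mul _)
        ((hcross τ hτ).const_mul _), integral_const_mul, integral_const_mul]
  have hcw : ContinuousOn (fun q : ℝ × ℝ => w q.2) (Icc 0 T ×ˢ univ) :=
    (h.w_continuous.comp continuous_snd).continuousOn
  have hiU : Integrable (fun q : ℝ × ℝ => w q.2 * ψ (k + 1) q.1 q.2 * ψt (k + 1) q.1 q.2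
      - κ * (ψ (k + 1) q.1 q.2 * φt k q.1 q.2 + ψt (k + 1) q.1 q.2 * φ k q.1 q.2))
      (stripMeasure T) :=
    ((h.strip_w_mul hc (h.strip_ψ (by omega))).integrable_fun_mul
      (h.strip_ψt hM0.le (by omega))).sub
      ((((h.strip_ψ (by omega)).integrable_fun_mul (h.strip_φt hc hM0.le hk)).add
      ((h.strip_ψt hM0.le (by omega)).integrable_fun_mul (h.strip_φ (by omega)))).const_mul _)
  have hev := integral_sub_eq_of_hasDerivAt_time hT
    (u := fun τ ξ => 1 / 2 * (w ξ * ψ (k + 1) τ ξ ^ 2) - κ * (ψ (k + 1) τ ξ * φ k τ ξ))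
    (U := fun τ ξ => w ξ * ψ (k + 1) τ ξ * ψt (k + 1) τ ξ
      - κ * (ψ (k + 1) τ ξ * φt k τ ξ + ψt (k + 1) τ ξ * φ k τ ξ))
    (fun τ hτ ξ => by
      have d := h.dtψ (k + 1) (by omega) τ hτ ξ
      refine (((d.fun_pow 2).const_mul (w ξ)).const_mul (1 / 2)).fun_sub
        ((d.fun_mul (h.dtφ k (by omega) τ hτ ξ)).const_mul κ) |>.congr_deriv ?_
      push_cast
      ring)
    (((hcw.mul (h.cψ (k + 1) (by omega))).mul (h.cψt (k + 1) (by omega))).sub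
      (continuousOn_const.mul (((h.cψ (k + 1) (by omega)).mul (h.cφt k (by omega))).add
        ((h.cψt (k + 1) (by omega)).mul (h.cφ k (by omega))))))
    hiU (hiu 0 h0) (hiu T h1)
  rw [hint 0 h0, hint T h1] at hev
  have hix := (h.strip_φ (j := k + 2) (by omega)).integrable_fun_mul (h.strip_φt hc hM0.le hk)
  have hhalf := half_integral_sq_sub_eq hT (h.cφ (k + 1) (by omega)) (h.cφ (k + 2) (by omega))
    (h.cφt (k + 1) (by omega)) (h.cφt k (by omega)) (h.dxφ (k + 1) (by omega))
    (h.dtφ (k + 1) (by omega)) (h.dxφt k hk)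
    ((h.strip_φ (by omega)).integrable_fun_mul (h.strip_φt hc hM0.le hk)) hix
    (h.iφ _ (by omega) 0 h0) (h.iφ _ (by omega) T h1)
  have hiS : Integrable (fun τ => ∑ i ∈ Finset.Icc 1 (k + 1), ∫ ξ, φ i τ ξ ^ 2)
      (volume.restrict (Ioo 0 T)) := integrable_finsetSum _ fun i hi => by
    rw [Finset.mem_Icc] at hi
    exact h.time_φ (by omega)
  have hφ2 := h.time_φ (j := k + 2) (by omega)
  have hψ1 := h.time_ψ (j := k + 1) (by omega)
  have hdiff : Integrable (fun τ => -(c / 2) * (∫ ξ, φ (k + 2) τ ξ ^ 2)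
      - c / (32 * M ^ 2) * (∫ ξ, ψ (k + 1) τ ξ ^ 2)) (volume.restrict (Ioo 0 T)) :=
    (hφ2.const_mul _).sub (hψ1.const_mul _)
  have hmono : (∫ τ in Ioo 0 T, ∫ ξ, (w ξ * ψ (k + 1) τ ξ * ψt (k + 1) τ ξ
        - κ * (ψ (k + 1) τ ξ * φt k τ ξ + ψt (k + 1) τ ξ * φ k τ ξ)))
      + (∫ τ in Ioo 0 T, ∫ ξ, -(φ (k + 2) τ ξ * φt k τ ξ))
      ≤ ∫ τ in Ioo 0 T, (-(c / 2) * (∫ ξ, φ (k + 2) τ ξ ^ 2)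
        - c / (32 * M ^ 2) * (∫ ξ, ψ (k + 1) τ ξ ^ 2)
        + C * ∑ i ∈ Finset.Icc 1 (k + 1), ∫ ξ, φ i τ ξ ^ 2) := by
    have hixn : Integrable (fun τ => ∫ ξ, -(φ (k + 2) τ ξ * φt k τ ξ))
      (volume.restrict (Ioo 0 T)) := hix.neg.integral_prod_left
    have hiU' : Integrable (fun τ => ∫ ξ, (w ξ * ψ (k + 1) τ ξ * ψt (k + 1) τ ξ
        - κ * (ψ (k + 1) τ ξ * φt k τ ξ + ψt (k + 1) τ ξ * φ k τ ξ)))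
      (volume.restrict (Ioo 0 T)) := hiU.integral_prod_left
    rw [← integral_add hiU' hixn]
    refine setIntegral_mono_on (hiU'.add hixn) (hdiff.add (hiS.const_mul C)) measurableSet_Ioo
      fun τ hτ => ?_
    have hτ' := Ioo_subset_Icc_self hτ
    have mψ1 := h.memLp_ψ (j := k + 1) (by omega) hτ'
    have mψt := h.memLp_ψt hM0.le (j := k + 1) (by omega) hτ
    have mφt := h.memLp_φt hc hM0.le hk hτ
    have m1 : Integrable fun ξ => w ξ * ψ (k + 1) τ ξ * ψt (k + 1) τ ξ
        - κ * (ψ (k + 1) τ ξ * φt k τ ξ + ψt (k + 1) τ ξ * φ k τ ξ) :=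
      ((memLp_bdd_mul h.w_continuous (h.abs_w_le hc) mψ1).integrable_fun_mul mψt).sub
        (((mψ1.integrable_fun_mul mφt).add (mψt.integrable_fun_mul
          (h.memLp_φ (by omega) hτ'))).const_mul _)
    have m2 : Integrable fun ξ => -(φ (k + 2) τ ξ * φt k τ ξ) :=
      ((h.memLp_φ (by omega) hτ').integrable_fun_mul mφt).neg
    rw [← integral_add m1 m2]
    have hi2 := h.iφ (k + 2) (by omega) τ hτ'
    have hi1 := h.iψ (k + 1) (by omega) τ hτ'
    have his : ∀ i ∈ Finset.Icc 1 (k + 1), Integrable fun ξ => φ i τ ξ ^ 2 := fun i hi => by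
      rw [Finset.mem_Icc] at hi
      exact h.iφ i (by omega) τ hτ'
    have := hsl h k hk τ hτ
    have hd : Integrable fun ξ => -(c / 2) * φ (k + 2) τ ξ ^ 2
        - c / (32 * M ^ 2) * ψ (k + 1) τ ξ ^ 2 := (hi2.const_mul _).sub (hi1.const_mul _)
    rw [integral_add hd ((integrable_finsetSum _ his).const_mul C),
      integral_sub (hi2.const_mul _) (hi1.const_mul _), integral_const_mul, integral_const_mul,
      integral_const_mul, integral_finsetSum _ his] at this
    exact this
  rw [integral_add hdiff (hiS.const_mul C),
    integral_sub (hφ2.const_mul _) (hψ1.const_mul _), integral_const_mul, integral_const_mul,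
    integral_const_mul, integral_finsetSum _ fun i hi => by
      rw [Finset.mem_Icc] at hi
      exact h.time_φ (by omega)] at hmono
  have hx1 := abs_integral_mul_le (h.memLp_ψ (j := k + 1) (by omega) h1)
    (h.memLp_φ (j := k) (by omega) h1) (η := c / (4 * κ)) (by positivity)
  have hx0 := abs_integral_mul_le (h.memLp_ψ (j := k + 1) (by omega) h0)
    (h.memLp_φ (j := k) (by omega) h0) (η := c / (4 * κ)) (by positivity)
  have hx1' := mul_le_mul_of_nonneg_left ((le_abs_self _).trans hx1) hκ0.le
  have hx0' := mul_le_mul_of_nonneg_left ((neg_le_abs _).trans hx0) hκ0.le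
  have heq : ∀ A B : ℝ, κ * (c / (4 * κ) * A + 1 / (4 * (c / (4 * κ))) * B)
      = c / 4 * A + κ ^ 2 * (1 / c) * B := fun A B => by field_simp
  rw [heq] at hx1' hx0'
  have hw1 := h.le_integral_w_sq hc (j := k + 1) (by omega) h1
  have hw0 := h.integral_w_sq_le hc (j := k + 1) (by omega) h0
  have n1 : 0 ≤ ∫ ξ, φ (k + 1) 0 ξ ^ 2 := integral_nonneg fun _ => sq_nonneg _
  have n2 : 0 ≤ ∫ ξ, ψ (k + 1) 0 ξ ^ 2 := integral_nonneg fun _ => sq_nonneg _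
  have n3 : 0 ≤ ∫ ξ, φ k 0 ξ ^ 2 := integral_nonneg fun _ => sq_nonneg _
  have n4 : 0 ≤ ∫ ξ, φ k T ξ ^ 2 := integral_nonneg fun _ => sq_nonneg _
  have n5 : 0 ≤ ∑ i ∈ Finset.Icc 1 (k + 1), ∫ τ in Ioo 0 T, ∫ ξ, φ i τ ξ ^ 2 :=
    Finset.sum_nonneg fun i _ => integral_nonneg fun _ => integral_nonneg fun _ => sq_nonneg _
  have hκc : 0 ≤ κ ^ 2 * (1 / c) := by positivity
  generalize κ ^ 2 * (1 / c) = K at *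
  have q1 : 1 / 2 * (∫ ξ, φ (k + 1) 0 ξ ^ 2) ≤ (C + 1 + M + c + K) * ∫ ξ, φ (k + 1) 0 ξ ^ 2 :=
    mul_le_mul_of_nonneg_right (by linarith) n1
  have q2 : (1 / 2 * M + c / 4) * (∫ ξ, ψ (k + 1) 0 ξ ^ 2)
      ≤ (C + 1 + M + c + K) * ∫ ξ, ψ (k + 1) 0 ξ ^ 2 :=
    mul_le_mul_of_nonneg_right (by linarith) n2
  have q3 : K * (∫ ξ, φ k 0 ξ ^ 2) ≤ (C + 1 + M + c + K) * ∫ ξ, φ k 0 ξ ^ 2 :=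
    mul_le_mul_of_nonneg_right (by linarith) n3
  have q4 : K * (∫ ξ, φ k T ξ ^ 2) ≤ (C + 1 + M + c + K) * ∫ ξ, φ k T ξ ^ 2 :=
    mul_le_mul_of_nonneg_right (by linarith) n4
  have q5 := mul_le_mul_of_nonneg_right (by linarith : C ≤ C + 1 + M + c + K) n5
  linarith

theorem energy_recursion {c d C M : ℝ} (hc : 0 < c) (hd : 0 < d) (hC : 0 ≤ C) (hM : 1 ≤ M) (k : ℕ) :
    ∃ K ≥ 0, ∀ (A B X Y A₀ B₀ : ℕ → ℝ) (S : ℝ), (∀ j, 0 ≤ A j) → (∀ j, 0 ≤ B j) →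
      (∀ j, 0 ≤ X j) → (∀ j, 0 ≤ Y j) → 0 ≤ S → (∀ j ≤ k, A₀ j ≤ S) → (∀ j ≤ k, B₀ j ≤ S) →
      A 0 + c * B 0 + c * X 1 ≤ A₀ 0 + M * B₀ 0 →
      (∀ j < k, 1 / 2 * A (j + 1) + c / 4 * B (j + 1) + c / 2 * X (j + 2) + d * Y (j + 1)
        ≤ C * (A₀ (j + 1) + B₀ (j + 1) + A₀ j + A j + ∑ i ∈ Finset.Icc 1 (j + 1), X i)) →
      ∀ j ≤ k, A j ≤ K * S ∧ B j ≤ K * S ∧ X (j + 1) ≤ K * S ∧ (1 ≤ j → Y j ≤ K * S) := by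
  have scale : ∀ {a x L : ℝ}, 0 < a → a * x ≤ L → x ≤ 1 / a * L := fun {a x L} ha h => by
    rw [one_div, ← div_eq_inv_mul, le_div_iff₀ ha]
    linarith
  induction k with
  | zero =>
    refine ⟨(1 + 1 / c) * (1 + M), by positivity,
      fun A B X Y A₀ B₀ S hA hB hX hY hS hA₀ hB₀ h0 _ => ?_⟩
    have h1 : A 0 + c * B 0 + c * X 1 ≤ (1 + M) * S := by
      nlinarith [hA₀ 0 le_rfl, mul_le_mul_of_nonneg_left (hB₀ 0 le_rfl) (by linarith : 0 ≤ M)]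
    have hcB := mul_nonneg hc.le (hB 0)
    have hcX := mul_nonneg hc.le (hX 1)
    have hL : 0 ≤ (1 + M) * S := mul_nonneg (by linarith) hS
    have hL' : 0 ≤ 1 / c * ((1 + M) * S) := mul_nonneg (by positivity) hL
    have b := scale hc (show c * B 0 ≤ (1 + M) * S by linarith [hA 0])
    have x := scale hc (show c * X 1 ≤ (1 + M) * S by linarith [hA 0])
    intro j hj
    obtain rfl : j = 0 := by omega
    have e : (1 + 1 / c) * (1 + M) * S = (1 + M) * S + 1 / c * ((1 + M) * S) := by ring
    rw [e]
    exact ⟨by linarith [hA 0], by linarith, by linarith, by omega⟩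
  | succ k ih =>
    obtain ⟨K, hK, ih⟩ := ih
    refine ⟨K + (2 + 1 / (c / 4) + 1 / (c / 2) + 1 / d) * (C * (3 + K + (k + 1) * K)),
      by positivity, fun A B X Y A₀ B₀ S hA hB hX hY hS hA₀ hB₀ h0 hstep => ?_⟩
    have ih' := ih A B X Y A₀ B₀ S hA hB hX hY hS (fun j hj => hA₀ j (by omega))
      (fun j hj => hB₀ j (by omega)) h0 (fun j hj => hstep j (by omega))
    have hsum : ∑ i ∈ Finset.Icc 1 (k + 1), X i ≤ (k + 1) * (K * S) := by
      refine (Finset.sum_le_card_nsmul _ _ (K * S) fun i hi => ?_).trans (by simp)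
      rw [Finset.mem_Icc] at hi
      obtain ⟨i, rfl⟩ := Nat.exists_eq_add_of_le' hi.1
      exact (ih' i (by omega)).2.2.1
    have h1 := hstep k (by omega)
    have h2 : A₀ (k + 1) + B₀ (k + 1) + A₀ k + A k + ∑ i ∈ Finset.Icc 1 (k + 1), X i
        ≤ (3 + K + (k + 1) * K) * S := by
      linarith [hA₀ (k + 1) le_rfl, hB₀ (k + 1) le_rfl, hA₀ k (by omega), (ih' k le_rfl).1]
    have h3 := mul_le_mul_of_nonneg_left h2 hC
    have hL : 0 ≤ C * ((3 + K + (k + 1) * K) * S) := by positivity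
    have e : (K + (2 + 1 / (c / 4) + 1 / (c / 2) + 1 / d) * (C * (3 + K + (k + 1) * K))) * S
        = K * S + (2 * (C * ((3 + K + (k + 1) * K) * S))
          + 1 / (c / 4) * (C * ((3 + K + (k + 1) * K) * S))
          + 1 / (c / 2) * (C * ((3 + K + (k + 1) * K) * S))
          + 1 / d * (C * ((3 + K + (k + 1) * K) * S))) := by ring
    rw [e]
    generalize C * ((3 + K + (k + 1) * K) * S) = L at *
    have l1 : 0 ≤ 1 / (c / 4) * L := by positivity
    have l2 : 0 ≤ 1 / (c / 2) * L := by positivity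
    have l3 : 0 ≤ 1 / d * L := by positivity
    have hKS : 0 ≤ K * S := by positivity
    intro j hj
    rcases Nat.lt_or_ge k j with hkj | hjk
    · obtain rfl : j = k + 1 := by omega
      have n2 := mul_nonneg (by positivity : 0 ≤ c / 4) (hB (k + 1))
      have n3 := mul_nonneg (by positivity : 0 ≤ c / 2) (hX (k + 2))
      have n4 := mul_nonneg hd.le (hY (k + 1))
      have n1 := hA (k + 1)
      have b := scale (by positivity) (show c / 4 * B (k + 1) ≤ L by linarith)
      have x := scale (by positivity) (show c / 2 * X (k + 2) ≤ L by linarith)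
      have y := scale hd (show d * Y (k + 1) ≤ L by linarith)
      exact ⟨by linarith, by linarith, by linarith, fun _ => by linarith⟩
    · obtain ⟨a, b, x, y⟩ := ih' j hjk
      exact ⟨by linarith, by linarith, by linarith, fun hj => by linarith [y hj]⟩

theorem energy_le (hc : 0 < c) (hM : 1 ≤ M) : ∃ K ≥ 0, ∀ {φ ψ φt ψt Q P : ℕ → ℝ → ℝ → ℝ}
    {γ π : ℝ → ℝ → ℝ} {w w' : ℝ → ℝ} {T : ℝ}, EnergyFrame φ ψ φt ψt Q P γ π w w' s c M T →
    ∀ t ∈ Icc 0 T,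
    (∑ j ∈ Finset.range 4, ∫ ξ, φ j t ξ ^ 2) + (∑ j ∈ Finset.range 4, ∫ ξ, ψ j t ξ ^ 2)
      + ((∑ j ∈ Finset.range 4, ∫ τ in Ioo 0 t, ∫ ξ, φ (j + 1) τ ξ ^ 2)
        + ∑ j ∈ Finset.range 3, ∫ τ in Ioo 0 t, ∫ ξ, ψ (j + 1) τ ξ ^ 2)
      ≤ K * ((∑ j ∈ Finset.range 4, ∫ ξ, φ j 0 ξ ^ 2)
        + ∑ j ∈ Finset.range 4, ∫ ξ, ψ j 0 ξ ^ 2) := by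
  obtain ⟨C, hC, hsucc⟩ := level_succ (s := s) hc hM
  obtain ⟨K, hK, hrec⟩ := energy_recursion (d := c / (32 * M ^ 2)) hc (by positivity) hC hM 3
  refine ⟨15 * K, by positivity, fun {φ ψ φt ψt Q P γ π w w' T} h₀ t ht => ?_⟩
  have h := h₀.mono ht.2
  have nn : ∀ f : ℕ → ℝ → ℝ → ℝ, ∀ j τ, 0 ≤ ∫ ξ, f j τ ξ ^ 2 := fun f j τ =>
    integral_nonneg fun _ => sq_nonneg _
  have hφs : 0 ≤ ∑ j ∈ Finset.range 4, ∫ ξ, φ j 0 ξ ^ 2 := Finset.sum_nonneg fun j _ => nn φ j 0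
  have hψs : 0 ≤ ∑ j ∈ Finset.range 4, ∫ ξ, ψ j 0 ξ ^ 2 := Finset.sum_nonneg fun j _ => nn ψ j 0
  have key := hrec (fun j => ∫ ξ, φ j t ξ ^ 2) (fun j => ∫ ξ, ψ j t ξ ^ 2)
    (fun j => ∫ τ in Ioo 0 t, ∫ ξ, φ j τ ξ ^ 2) (fun j => ∫ τ in Ioo 0 t, ∫ ξ, ψ j τ ξ ^ 2)
    (fun j => ∫ ξ, φ j 0 ξ ^ 2) (fun j => ∫ ξ, ψ j 0 ξ ^ 2)
    ((∑ j ∈ Finset.range 4, ∫ ξ, φ j 0 ξ ^ 2) + ∑ j ∈ Finset.range 4, ∫ ξ, ψ j 0 ξ ^ 2)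
    (fun j => nn φ j t) (fun j => nn ψ j t) (fun j => integral_nonneg fun τ => nn φ j τ)
    (fun j => integral_nonneg fun τ => nn ψ j τ) (by positivity)
    (fun j hj => (Finset.single_le_sum (f := fun j => ∫ ξ, φ j 0 ξ ^ 2) (fun j _ => nn φ j 0)
      (Finset.mem_range.2 (by omega))).trans (le_add_of_nonneg_right hψs))
    (fun j hj => (Finset.single_le_sum (f := fun j => ∫ ξ, ψ j 0 ξ ^ 2) (fun j _ => nn ψ j 0)
      (Finset.mem_range.2 (by omega))).trans (le_add_of_nonneg_left hφs))
    (h.level_zero hc hM ht.1) (fun j hj => hsucc h ht.1 j (by omega))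
  generalize (∑ j ∈ Finset.range 4, ∫ ξ, φ j 0 ξ ^ 2)
    + ∑ j ∈ Finset.range 4, ∫ ξ, ψ j 0 ξ ^ 2 = S at *
  obtain ⟨a0, b0, x0, -⟩ := key 0 (by norm_num)
  obtain ⟨a1, b1, x1, y1⟩ := key 1 (by norm_num)
  obtain ⟨a2, b2, x2, y2⟩ := key 2 (by norm_num)
  obtain ⟨a3, b3, x3, y3⟩ := key 3 (by norm_num)
  have y1 := y1 (by norm_num)
  have y2 := y2 (by norm_num)
  have y3 := y3 (by norm_num)
  simp only [Finset.sum_range_succ, Finset.sum_range_zero, zero_add, Nat.reduceAdd] at *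
  linarith

end EnergyFrame

theorem commutator_bounds {M D₁ D₂ D₃ E₂ E₃ V₁ V₂ V₃ x y z : ℝ} (hM : 1 ≤ M)
    (hD₁ : |D₁| ≤ M * |x|) (hD₂ : |D₂| ≤ M * |x|) (hD₃ : |D₃| ≤ M * |x|) (hE₂ : |E₂| ≤ M)
    (hE₃ : |E₃| ≤ M) (hV₁ : |V₁| ≤ M) (hV₂ : |V₂| ≤ M) (hV₃ : |V₃| ≤ M) (hy : |y| ≤ 1) :
    |D₁ * V₁| ≤ 10 * M ^ 4 * |x| ∧
    |D₂ * V₁ ^ 2 + E₂ * (2 * V₁ * y + y ^ 2) + D₁ * V₂| ≤ 10 * M ^ 4 * (|x| + |y|) ∧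
    |D₃ * V₁ ^ 3 + E₃ * (3 * V₁ ^ 2 * y + 3 * V₁ * y ^ 2 + y ^ 3)
      + 3 * (D₂ * (V₁ * V₂) + E₂ * (V₁ * z + y * V₂ + y * z)) + D₁ * V₃|
      ≤ 10 * M ^ 4 * (|x| + |y| + |z|) := by
  have hM0 : 0 ≤ M := by linarith
  have m2 : M ^ 2 ≤ M ^ 4 := pow_le_pow_right₀ hM (by norm_num)
  have m3 : M ^ 3 ≤ M ^ 4 := pow_le_pow_right₀ hM (by norm_num)
  have m1 : M ≤ M ^ 4 := by simpa using pow_le_pow_right₀ hM (show 1 ≤ 4 by norm_num)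
  have x0 := abs_nonneg x
  have y0 := abs_nonneg y
  have z0 := abs_nonneg z
  have mul : ∀ {a b A B : ℝ}, |a| ≤ A → |b| ≤ B → |a * b| ≤ A * B := fun {a b A B} ha hb => by
    rw [abs_mul]
    exact mul_le_mul ha hb (abs_nonneg _) ((abs_nonneg _).trans ha)
  have add : ∀ {a b A B : ℝ}, |a| ≤ A → |b| ≤ B → |a + b| ≤ A + B := fun ha hb =>
    (abs_add_le _ _).trans (add_le_add ha hb)
  have pow : ∀ {a A : ℝ} (n : ℕ), |a| ≤ A → |a ^ n| ≤ A ^ n := fun {a A} n ha => by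
    rw [abs_pow]
    exact pow_le_pow_left₀ (abs_nonneg _) ha n
  have three : |(3 : ℝ)| ≤ 3 := by norm_num
  have two : |(2 : ℝ)| ≤ 2 := by norm_num
  have hy2 : |y ^ 2| ≤ |y| := by rw [abs_pow]; nlinarith
  have hy3 : |y ^ 3| ≤ |y| := by
    rw [abs_pow]
    exact pow_le_of_le_one y0 hy (by norm_num)
  have hyz : |y * z| ≤ |z| := by rw [abs_mul]; nlinarith
  have mx := mul_le_mul_of_nonneg_right m1 x0
  have m2x := mul_le_mul_of_nonneg_right m2 x0
  have m3x := mul_le_mul_of_nonneg_right m3 x0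
  have my := mul_le_mul_of_nonneg_right m1 y0
  have m2y := mul_le_mul_of_nonneg_right m2 y0
  have m3y := mul_le_mul_of_nonneg_right m3 y0
  have mz := mul_le_mul_of_nonneg_right m1 z0
  have m2z := mul_le_mul_of_nonneg_right m2 z0
  have px : 0 ≤ M ^ 4 * |x| := by positivity
  have py : 0 ≤ M ^ 4 * |y| := by positivity
  have pz : 0 ≤ M ^ 4 * |z| := by positivity
  refine ⟨(mul hD₁ hV₁).trans (by linarith), ?_, ?_⟩
  · refine (add (add (mul hD₂ (pow 2 hV₁)) (mul hE₂ (add (mul (mul two hV₁) le_rfl) hy2)))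
      (mul hD₁ hV₂)).trans ?_
    linarith
  · refine (add (add (add (mul hD₃ (pow 3 hV₁)) (mul hE₃ (add (add
      (mul (mul three (pow 2 hV₁)) le_rfl) (mul (mul three hV₁) hy2)) hy3)))
      (mul three (add (mul hD₂ (mul hV₁ hV₂)) (mul hE₂ (add (add (mul hV₁ le_rfl)
      (mul le_rfl hV₂)) hyz))))) (mul hD₁ hV₃)).trans ?_
    linarith

/-- Derivatives up to order three of `H 0 (V 0 + F 1) - H 0 (V 0)`, where `H`, `V`, `F` are towers
of successive derivatives. -/
theorem composition_commutator {H V F : ℕ → ℝ → ℝ} {M a b : ℝ} (hM : 1 ≤ M)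
    (hH : ∀ j ≤ 3, ∀ x ∈ Icc a b, HasDerivAt (H j) (H (j + 1) x) x)
    (bH : ∀ j ≤ 4, ∀ x ∈ Icc a b, |H j x| ≤ M)
    (hV : ∀ j ≤ 2, ∀ ξ, HasDerivAt (V j) (V (j + 1) ξ) ξ)
    (bV : ∀ j ≤ 3, ∀ ξ, |V j ξ| ≤ M)
    (hF : ∀ j ≤ 3, ∀ ξ, HasDerivAt (F j) (F (j + 1) ξ) ξ)
    (bF : ∀ ξ, |F 2 ξ| ≤ 1) (mV : ∀ ξ, V 0 ξ ∈ Icc a b) (mF : ∀ ξ, V 0 ξ + F 1 ξ ∈ Icc a b) :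
    (∀ j ≤ 2, ∀ ξ, HasDerivAt (iteratedDeriv j fun ξ => H 0 (V 0 ξ + F 1 ξ) - H 0 (V 0 ξ))
      (iteratedDeriv (j + 1) (fun ξ => H 0 (V 0 ξ + F 1 ξ) - H 0 (V 0 ξ)) ξ) ξ) ∧
    (∀ ξ, iteratedDeriv 1 (fun ξ => H 0 (V 0 ξ + F 1 ξ) - H 0 (V 0 ξ)) ξ
      = H 1 (V 0 ξ + F 1 ξ) * (V 1 ξ + F 2 ξ) - H 1 (V 0 ξ) * V 1 ξ) ∧
    ∀ j ≤ 2, ∀ ξ, |iteratedDeriv (j + 1) (fun ξ => H 0 (V 0 ξ + F 1 ξ) - H 0 (V 0 ξ)) ξ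
        - H 1 (V 0 ξ + F 1 ξ) * F (j + 2) ξ|
      ≤ 10 * M ^ 4 * ∑ i ∈ Finset.Icc 1 (j + 1), |F i ξ| := by
  have lip : ∀ j ≤ 3, ∀ ξ, |H j (V 0 ξ + F 1 ξ) - H j (V 0 ξ)| ≤ M * |F 1 ξ| := fun j hj ξ => by
    have := (convex_Icc a b).norm_image_sub_le_of_norm_hasDerivWithin_le
      (fun x hx => (hH j hj x hx).hasDerivWithinAt) (fun x hx => bH (j + 1) (by omega) x hx)
      (mV ξ) (mF ξ)
    simpa using this
  have dE : ∀ j ≤ 2, ∀ ξ, HasDerivAt (fun ξ => H j (V 0 ξ + F 1 ξ))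
      (H (j + 1) (V 0 ξ + F 1 ξ) * (V 1 ξ + F 2 ξ)) ξ := fun j hj ξ =>
    (hH j (by omega) _ (mF ξ)).comp ξ ((hV 0 (by omega) ξ).fun_add (hF 1 (by omega) ξ))
  have dB : ∀ j ≤ 2, ∀ ξ, HasDerivAt (fun ξ => H j (V 0 ξ)) (H (j + 1) (V 0 ξ) * V 1 ξ) ξ :=
    fun j hj ξ => (hH j (by omega) _ (mV ξ)).comp ξ (hV 0 (by omega) ξ)
  have d0 : ∀ ξ, HasDerivAt (fun ξ => H 0 (V 0 ξ + F 1 ξ) - H 0 (V 0 ξ))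
      (H 1 (V 0 ξ + F 1 ξ) * (V 1 ξ + F 2 ξ) - H 1 (V 0 ξ) * V 1 ξ) ξ := fun ξ =>
    (dE 0 (by omega) ξ).fun_sub (dB 0 (by omega) ξ)
  have hv1 : ∀ ξ, HasDerivAt (fun ξ => V 1 ξ + F 2 ξ) (V 2 ξ + F 3 ξ) ξ := fun ξ =>
    (hV 1 (by omega) ξ).fun_add (hF 2 (by omega) ξ)
  have hv2 : ∀ ξ, HasDerivAt (fun ξ => V 2 ξ + F 3 ξ) (V 3 ξ + F 4 ξ) ξ := fun ξ =>
    (hV 2 (by omega) ξ).fun_add (hF 3 (by omega) ξ)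
  have d1 : ∀ ξ, HasDerivAt (fun ξ => H 1 (V 0 ξ + F 1 ξ) * (V 1 ξ + F 2 ξ) - H 1 (V 0 ξ) * V 1 ξ)
      (H 2 (V 0 ξ + F 1 ξ) * (V 1 ξ + F 2 ξ) ^ 2 + H 1 (V 0 ξ + F 1 ξ) * (V 2 ξ + F 3 ξ)
        - H 2 (V 0 ξ) * V 1 ξ ^ 2 - H 1 (V 0 ξ) * V 2 ξ) ξ := fun ξ =>
    (((dE 1 (by omega) ξ).fun_mul (hv1 ξ)).fun_sub
      ((dB 1 (by omega) ξ).fun_mul (hV 1 (by omega) ξ))).congr_deriv (by ring)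
  have d2 : ∀ ξ, HasDerivAt (fun ξ => H 2 (V 0 ξ + F 1 ξ) * (V 1 ξ + F 2 ξ) ^ 2
        + H 1 (V 0 ξ + F 1 ξ) * (V 2 ξ + F 3 ξ) - H 2 (V 0 ξ) * V 1 ξ ^ 2 - H 1 (V 0 ξ) * V 2 ξ)
      (H 3 (V 0 ξ + F 1 ξ) * (V 1 ξ + F 2 ξ) ^ 3
        + 3 * (H 2 (V 0 ξ + F 1 ξ) * ((V 1 ξ + F 2 ξ) * (V 2 ξ + F 3 ξ)))
        + H 1 (V 0 ξ + F 1 ξ) * (V 3 ξ + F 4 ξ) - H 3 (V 0 ξ) * V 1 ξ ^ 3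
        - 3 * (H 2 (V 0 ξ) * (V 1 ξ * V 2 ξ)) - H 1 (V 0 ξ) * V 3 ξ) ξ := fun ξ =>
    (((((dE 2 (by omega) ξ).fun_mul ((hv1 ξ).fun_pow 2)).fun_add
      ((dE 1 (by omega) ξ).fun_mul (hv2 ξ))).fun_sub
      ((dB 2 (by omega) ξ).fun_mul ((hV 1 (by omega) ξ).fun_pow 2))).fun_sub
      ((dB 1 (by omega) ξ).fun_mul (hV 2 (by omega) ξ))).congr_deriv (by push_cast; ring)
  have i1 := funext fun ξ => (d0 ξ).deriv
  have i2 := funext fun ξ => (d1 ξ).deriv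
  have i3 := funext fun ξ => (d2 ξ).deriv
  have I1 : iteratedDeriv 1 (fun ξ => H 0 (V 0 ξ + F 1 ξ) - H 0 (V 0 ξ)) = _ :=
    iteratedDeriv_one.trans i1
  have I2 : iteratedDeriv 2 (fun ξ => H 0 (V 0 ξ + F 1 ξ) - H 0 (V 0 ξ)) = _ :=
    iteratedDeriv_succ.trans ((congrArg deriv I1).trans i2)
  have I3 : iteratedDeriv 3 (fun ξ => H 0 (V 0 ξ + F 1 ξ) - H 0 (V 0 ξ)) = _ :=
    iteratedDeriv_succ.trans ((congrArg deriv I2).trans i3)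
  refine ⟨fun j hj ξ => ?_, fun ξ => by rw [I1], fun j hj ξ => ?_⟩
  · interval_cases j
    · rw [iteratedDeriv_zero, I1]; exact d0 ξ
    · rw [I1, I2]; exact d1 ξ
    · rw [I2, I3]; exact d2 ξ
  · obtain ⟨b1, b2, b3⟩ := commutator_bounds (z := F 3 ξ) hM (lip 1 (by omega) ξ)
      (lip 2 (by omega) ξ) (lip 3 (by omega) ξ) (bH 2 (by omega) _ (mF ξ))
      (bH 3 (by omega) _ (mF ξ)) (bV 1 (by omega) ξ) (bV 2 (by omega) ξ) (bV 3 (by omega) ξ) (bF ξ)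
    interval_cases j
    · rw [I1]
      simp only [zero_add, Finset.Icc_self, Finset.sum_singleton]
      convert b1 using 2
      ring
    · rw [I2, Finset.sum_Icc_succ_top (by omega), Finset.Icc_self, Finset.sum_singleton]
      convert b2 using 2
      ring
    · rw [I3, Finset.sum_Icc_succ_top (by omega), Finset.sum_Icc_succ_top (by omega),
        Finset.Icc_self, Finset.sum_singleton]
      convert b3 using 2
      ring

theorem sq_le_integral_sq_add {f f' : ℝ → ℝ} (hf : ∀ x, HasDerivAt f (f' x) x)
    (hf' : Continuous f') (i : Integrable fun x => f x ^ 2) (i' : Integrable fun x => f' x ^ 2)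
    (x : ℝ) : f x ^ 2 ≤ (∫ x, f x ^ 2) + ∫ x, f' x ^ 2 := by
  have hc : Continuous f := continuous_iff_continuousAt.2 fun x => (hf x).continuousAt
  have m := (memLp_two_iff_integrable_sq hc.aestronglyMeasurable).2 i
  have m' := (memLp_two_iff_integrable_sq hf'.aestronglyMeasurable).2 i'
  have hd : ∀ x, HasDerivAt (fun x => f x ^ 2) (2 * (f x * f' x)) x := fun x =>
    ((hf x).fun_pow 2).congr_deriv (by push_cast; ring)
  have id : Integrable fun x => 2 * (f x * f' x) := (m.integrable_mul m').const_mul 2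
  have lim := tendsto_zero_of_hasDerivAt_of_integrableOn_Iic (a := x)
    (fun x _ => hd x) id.integrableOn i.integrableOn
  have key := integral_Iic_of_hasDerivAt_of_tendsto' (a := x) (fun x _ => hd x) id.integrableOn lim
  rw [sub_zero] at key
  rw [← key, ← integral_add i i']
  have hs : Integrable fun x => f x ^ 2 + f' x ^ 2 := i.add i'
  refine (setIntegral_mono id.integrableOn hs.integrableOn fun x => ?_).trans
    (setIntegral_le_integral hs (Eventually.of_forall fun x => by positivity))
  show 2 * (f x * f' x) ≤ f x ^ 2 + f' x ^ 2
  nlinarith [sq_nonneg (f x - f' x)]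

theorem exists_sub_eq_deriv_mul {h h' : ℝ → ℝ} {a b x y : ℝ}
    (hh : ∀ z ∈ Icc a b, HasDerivAt h (h' z) z) (hx : x ∈ Icc a b) (hy : y ∈ Icc a b) :
    ∃ θ ∈ Icc a b, |θ - x| ≤ |y - x| ∧ h y - h x = h' θ * (y - x) := by
  have key : ∀ u ∈ Icc a b, ∀ v ∈ Icc a b, u < v → ∃ θ ∈ Ioo u v, h v - h u = h' θ * (v - u) :=
    fun u hu v hv huv => by
      have hsub : Icc u v ⊆ Icc a b := Icc_subset_Icc hu.1 hv.2
      obtain ⟨θ, hθ, e⟩ := exists_hasDerivAt_eq_slope h h' huv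
        (fun z hz => (hh z (hsub hz)).continuousAt.continuousWithinAt)
        (fun z hz => hh z (hsub (Ioo_subset_Icc_self hz)))
      refine ⟨θ, hθ, ?_⟩
      rw [e, div_mul_cancel₀ _ (sub_pos.2 huv).ne']
  rcases lt_trichotomy x y with hxy | rfl | hxy
  · obtain ⟨θ, hθ, e⟩ := key x hx y hy hxy
    refine ⟨θ, ⟨hx.1.trans hθ.1.le, hθ.2.le.trans hy.2⟩, ?_, e⟩
    rw [abs_of_pos (sub_pos.2 hθ.1), abs_of_pos (sub_pos.2 hxy)]
    linarith [hθ.2]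
  · exact ⟨x, hx, by simp, by simp⟩
  · obtain ⟨θ, hθ, e⟩ := key y hy x hx hxy
    refine ⟨θ, ⟨hy.1.trans hθ.1.le, hθ.2.le.trans hx.2⟩, ?_, by linarith⟩
    rw [abs_of_neg (sub_neg.2 hθ.2), abs_of_neg (sub_neg.2 hxy)]
    linarith [hθ.1]

/-- The increment `h(v) - h(ṽ)` with `v = ṽ + f_ξ`. -/
def increment (h tv f : ℝ → ℝ) (ξ : ℝ) : ℝ := h (tv ξ + deriv f ξ) - h (tv ξ)

theorem increment_spec {h tv f : ℝ → ℝ} {N a b : ℝ} (hN : 1 ≤ N)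
    (hh : ∀ j ≤ 3, ∀ x ∈ Icc a b, HasDerivAt (iteratedDeriv j h) (iteratedDeriv (j + 1) h x) x)
    (bh : ∀ j ≤ 4, ∀ x ∈ Icc a b, |iteratedDeriv j h x| ≤ N)
    (htv : ∀ j ≤ 2, ∀ ξ, HasDerivAt (iteratedDeriv j tv) (iteratedDeriv (j + 1) tv ξ) ξ)
    (btv : ∀ j ≤ 3, ∀ ξ, |iteratedDeriv j tv ξ| ≤ N)
    (hf : ∀ j ≤ 3, ∀ ξ, HasDerivAt (iteratedDeriv j f) (iteratedDeriv (j + 1) f ξ) ξ)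
    (bf : ∀ ξ, |iteratedDeriv 2 f ξ| ≤ 1) (mtv : ∀ ξ, tv ξ ∈ Icc a b)
    (mv : ∀ ξ, tv ξ + deriv f ξ ∈ Icc a b) :
    (∀ j ≤ 2, ∀ ξ, HasDerivAt (iteratedDeriv j (increment h tv f))
      (iteratedDeriv (j + 1) (increment h tv f) ξ) ξ) ∧
    (∀ ξ, iteratedDeriv 1 (increment h tv f) ξ
      = deriv h (tv ξ + deriv f ξ) * (deriv tv ξ + iteratedDeriv 2 f ξ)
        - deriv h (tv ξ) * deriv tv ξ) ∧
    (∀ j ≤ 2, ∀ ξ, |iteratedDeriv (j + 1) (increment h tv f) ξ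
        - deriv h (tv ξ + deriv f ξ) * iteratedDeriv (j + 2) f ξ|
      ≤ 10 * N ^ 4 * ∑ i ∈ Finset.Icc 1 (j + 1), |iteratedDeriv i f ξ|) ∧
    ∀ ξ, ∃ θ ∈ Icc a b, |θ - tv ξ| ≤ |iteratedDeriv 1 f ξ| ∧
      iteratedDeriv 0 (increment h tv f) ξ = deriv h θ * iteratedDeriv 1 f ξ := by
  obtain ⟨h1, h2, h3⟩ := composition_commutator (H := fun j => iteratedDeriv j h)
    (V := fun j => iteratedDeriv j tv) (F := fun j => iteratedDeriv j f) hN hh bh htv btv hf bf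
    (by simpa only [iteratedDeriv_zero] using mtv)
    (by simpa only [iteratedDeriv_zero, iteratedDeriv_one] using mv)
  simp only [iteratedDeriv_zero (f := h), iteratedDeriv_zero (f := tv), iteratedDeriv_one (f := h),
    iteratedDeriv_one (f := f), iteratedDeriv_one (f := tv)] at h1 h2 h3
  refine ⟨h1, h2, h3, fun ξ => ?_⟩
  have hh0 : ∀ z ∈ Icc a b, HasDerivAt h (deriv h z) z := by
    simpa only [iteratedDeriv_zero, iteratedDeriv_one, zero_add] using hh 0 (by omega)
  obtain ⟨θ, hθ, e1, e2⟩ := exists_sub_eq_deriv_mul hh0 (mtv ξ) (mv ξ)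
  rw [add_sub_cancel_left] at e1 e2
  rw [iteratedDeriv_one, iteratedDeriv_zero]
  exact ⟨θ, hθ, e1, e2⟩

theorem energyFrame_of_isClassicalSolution {p g tv : ℝ → ℝ} {s T a b c M N δ : ℝ}
    {Φ Ψ : ℝ → ℝ → ℝ} (hsol : IsClassicalSolution p g tv s T Φ Ψ) (hc : 0 < c) (hN : 1 ≤ N)
    (hNM : 10 * N ^ 4 ≤ M)
    (hp : ∀ j ≤ 3, ∀ x ∈ Icc a b, HasDerivAt (iteratedDeriv j p) (iteratedDeriv (j + 1) p x) x)
    (hg : ∀ j ≤ 3, ∀ x ∈ Icc a b, HasDerivAt (iteratedDeriv j g) (iteratedDeriv (j + 1) g x) x)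
    (bp : ∀ j ≤ 4, ∀ x ∈ Icc a b, |iteratedDeriv j p x| ≤ N)
    (bg : ∀ j ≤ 4, ∀ x ∈ Icc a b, |iteratedDeriv j g x| ≤ N)
    (cp : ContinuousOn (iteratedDeriv 2 p) (Icc a b))
    (htv : ∀ j ≤ 2, ∀ ξ, HasDerivAt (iteratedDeriv j tv) (iteratedDeriv (j + 1) tv ξ) ξ)
    (btv : ∀ j ≤ 3, ∀ ξ, |iteratedDeriv j tv ξ| ≤ N) (mtv : ∀ ξ, tv ξ ∈ Icc a b)
    (hγ : ∀ x ∈ Icc a b, c ≤ deriv g x) (hp' : ∀ x ∈ Icc a b, deriv p x < 0)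
    (hw : ∀ x ∈ Icc a b, -(deriv p x)⁻¹ ∈ Icc c M)
    (hw' : ∀ ξ, |iteratedDeriv 2 p (tv ξ) * deriv tv ξ / deriv p (tv ξ) ^ 2| ≤ M)
    (hsw' : ∀ ξ, 0 ≤ s * (iteratedDeriv 2 p (tv ξ) * deriv tv ξ / deriv p (tv ξ) ^ 2))
    (hδ : M ^ 2 * δ ≤ c / (64 * M ^ 2))
    (mv : ∀ τ ∈ Ioo 0 T, ∀ ξ, tv ξ + deriv (Φ τ) ξ ∈ Icc a b)
    (bφ : ∀ τ ∈ Ioo 0 T, ∀ ξ, |iteratedDeriv 1 (Φ τ) ξ| ≤ δ)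
    (bφ₂ : ∀ τ ∈ Ioo 0 T, ∀ ξ, |iteratedDeriv 2 (Φ τ) ξ| ≤ 1)
    (bψ : ∀ τ ∈ Ioo 0 T, ∀ ξ, |iteratedDeriv 0 (Ψ τ) ξ| ≤ δ) :
    EnergyFrame (fun j τ => iteratedDeriv j (Φ τ)) (fun j τ => iteratedDeriv j (Ψ τ))
      (fun j τ ξ => deriv (fun τ => iteratedDeriv j (Φ τ) ξ) τ)
      (fun j τ ξ => deriv (fun τ => iteratedDeriv j (Ψ τ) ξ) τ)
      (fun j τ => iteratedDeriv j (increment g tv (Φ τ)))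
      (fun j τ => iteratedDeriv j (increment p tv (Φ τ)))
      (fun τ ξ => deriv g (tv ξ + deriv (Φ τ) ξ)) (fun τ ξ => deriv p (tv ξ + deriv (Φ τ) ξ))
      (fun ξ => -(deriv p (tv ξ))⁻¹)
      (fun ξ => iteratedDeriv 2 p (tv ξ) * deriv tv ξ / deriv p (tv ξ) ^ 2) s c M T := by
  have hN4 : N ≤ N ^ 4 := by simpa using pow_le_pow_right₀ hN (show 1 ≤ 4 by norm_num)
  have hNM' : N ≤ M := by linarith
  have hM : 1 ≤ M := by linarith
  have dΦ : ∀ j ≤ 3, ∀ τ ∈ Icc 0 T, ∀ ξ,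
      HasDerivAt (iteratedDeriv j (Φ τ)) (iteratedDeriv (j + 1) (Φ τ) ξ) ξ := fun j hj τ hτ ξ => by
    rw [iteratedDeriv_succ]
    exact ((hsol.regΦ τ hτ).differentiable_iteratedDeriv j
      (by exact_mod_cast (by omega : j < 4)) ξ).hasDerivAt
  have dΨ : ∀ j ≤ 3, ∀ τ ∈ Icc 0 T, ∀ ξ,
      HasDerivAt (iteratedDeriv j (Ψ τ)) (iteratedDeriv (j + 1) (Ψ τ) ξ) ξ := fun j hj τ hτ ξ => by
    rw [iteratedDeriv_succ]
    exact ((hsol.regΨ τ hτ).differentiable_iteratedDeriv j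
      (by exact_mod_cast (by omega : j < 4)) ξ).hasDerivAt
  have dtΦ : ∀ j ≤ 3, ∀ τ ∈ Icc 0 T, ∀ ξ, HasDerivAt (fun τ => iteratedDeriv j (Φ τ) ξ)
      (deriv (fun τ => iteratedDeriv j (Φ τ) ξ) τ) τ :=
    fun j hj τ hτ ξ => (hsol.tdiffΦ j hj τ hτ ξ).hasDerivAt
  have dtΨ : ∀ j ≤ 3, ∀ τ ∈ Icc 0 T, ∀ ξ, HasDerivAt (fun τ => iteratedDeriv j (Ψ τ) ξ)
      (deriv (fun τ => iteratedDeriv j (Ψ τ) ξ) τ) τ :=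
    fun j hj τ hτ ξ => (hsol.tdiffΨ j hj τ hτ ξ).hasDerivAt
  have I : ∀ {τ}, τ ∈ Ioo 0 T → τ ∈ Icc 0 T := fun h => Ioo_subset_Icc_self h
  have dxΦt : ∀ j ≤ 2, ∀ τ ∈ Ioo 0 T, ∀ ξ,
      HasDerivAt (fun ξ => deriv (fun τ => iteratedDeriv j (Φ τ) ξ) τ)
        (deriv (fun τ => iteratedDeriv (j + 1) (Φ τ) ξ) τ) ξ := fun j hj τ hτ ξ =>
    hasDerivAt_mixed (u := fun τ => iteratedDeriv j (Φ τ))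
      (u₁ := fun τ => iteratedDeriv (j + 1) (Φ τ))
      (ut := fun τ ξ => deriv (fun τ => iteratedDeriv j (Φ τ) ξ) τ)
      (u₁t := fun τ ξ => deriv (fun τ => iteratedDeriv (j + 1) (Φ τ) ξ) τ)
      (fun τ hτ => dΦ j (by omega) τ (I hτ)) (fun τ hτ => dtΦ j (by omega) τ (I hτ))
      (fun τ hτ => dtΦ (j + 1) (by omega) τ (I hτ)) (hsol.spContΦ (j + 1) (by omega))
      (hsol.mixContΦ (j + 1) (by omega)) hτ ξ
  have dxΨt : ∀ j ≤ 2, ∀ τ ∈ Ioo 0 T, ∀ ξ,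
      HasDerivAt (fun ξ => deriv (fun τ => iteratedDeriv j (Ψ τ) ξ) τ)
        (deriv (fun τ => iteratedDeriv (j + 1) (Ψ τ) ξ) τ) ξ := fun j hj τ hτ ξ =>
    hasDerivAt_mixed (u := fun τ => iteratedDeriv j (Ψ τ))
      (u₁ := fun τ => iteratedDeriv (j + 1) (Ψ τ))
      (ut := fun τ ξ => deriv (fun τ => iteratedDeriv j (Ψ τ) ξ) τ)
      (u₁t := fun τ ξ => deriv (fun τ => iteratedDeriv (j + 1) (Ψ τ) ξ) τ)
      (fun τ hτ => dΨ j (by omega) τ (I hτ)) (fun τ hτ => dtΨ j (by omega) τ (I hτ))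
      (fun τ hτ => dtΨ (j + 1) (by omega) τ (I hτ)) (hsol.spContΨ (j + 1) (by omega))
      (hsol.mixContΨ (j + 1) (by omega)) hτ ξ
  have specQ := fun τ (hτ : τ ∈ Ioo 0 T) => increment_spec (f := Φ τ) hN hg bg htv btv
    (fun j hj => dΦ j hj τ (I hτ)) (bφ₂ τ hτ) mtv (mv τ hτ)
  have specP := fun τ (hτ : τ ∈ Ioo 0 T) => increment_spec (f := Φ τ) hN hp bp htv btv
    (fun j hj => dΦ j hj τ (I hτ)) (bφ₂ τ hτ) mtv (mv τ hτ)
  have bg1 : ∀ x ∈ Icc a b, |deriv g x| ≤ M := fun x hx => by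
    rw [← iteratedDeriv_one]; exact (bg 1 (by omega) x hx).trans hNM'
  have bp1 : ∀ x ∈ Icc a b, |deriv p x| ≤ M := fun x hx => by
    rw [← iteratedDeriv_one]; exact (bp 1 (by omega) x hx).trans hNM'
  have lip : ∀ x ∈ Icc a b, ∀ y ∈ Icc a b, |deriv p y - deriv p x| ≤ M * |y - x| :=
    fun x hx y hy => by
      have hd : ∀ z ∈ Icc a b, HasDerivAt (deriv p) (iteratedDeriv 2 p z) z := by
        simpa only [iteratedDeriv_one] using hp 1 (by omega)
      obtain ⟨θ, hθ, -, e⟩ := exists_sub_eq_deriv_mul hd hx hy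
      rw [e, abs_mul]
      exact mul_le_mul_of_nonneg_right ((bp 2 (by omega) θ hθ).trans hNM') (abs_nonneg _)
  have hw1 : ∀ ξ, -(deriv p (tv ξ))⁻¹ * deriv p (tv ξ) = -1 := fun ξ => by
    rw [neg_mul, inv_mul_cancel₀ (hp' _ (mtv ξ)).ne]
  have hwabs : ∀ ξ, |-(deriv p (tv ξ))⁻¹| ≤ M := fun ξ => by
    rw [abs_of_nonneg (hc.le.trans (hw _ (mtv ξ)).1)]
    exact (hw _ (mtv ξ)).2
  have hwlip : ∀ ξ, ∀ x ∈ Icc a b,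
      |-(deriv p (tv ξ))⁻¹ * (deriv p x - deriv p (tv ξ))| ≤ M ^ 2 * |x - tv ξ| := fun ξ x hx => by
    rw [abs_mul, sq, mul_assoc]
    exact mul_le_mul (hwabs ξ) (lip _ (mtv ξ) x hx) (abs_nonneg _) (by linarith)
  have eqφ0 : ∀ τ ∈ Ioo 0 T, ∀ ξ, deriv (fun τ => iteratedDeriv 0 (Φ τ) ξ) τ
      = s * iteratedDeriv 1 (Φ τ) ξ + iteratedDeriv 1 (Ψ τ) ξ
        + iteratedDeriv 1 (increment g tv (Φ τ)) ξ := fun τ hτ ξ => by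
    have e := hsol.eq1 τ (I hτ) ξ
    rw [(specQ τ hτ).2.1 ξ]
    simp only [iteratedDeriv_zero, iteratedDeriv_one]
    rw [Gterm] at e
    linarith
  have eqψ0 : ∀ τ ∈ Ioo 0 T, ∀ ξ, deriv (fun τ => iteratedDeriv 0 (Ψ τ) ξ) τ
      = s * iteratedDeriv 1 (Ψ τ) ξ - iteratedDeriv 0 (increment p tv (Φ τ)) ξ := fun τ hτ ξ => by
    have e := hsol.eq2 τ (I hτ) ξ
    simp only [iteratedDeriv_zero, iteratedDeriv_one, increment]
    rw [prel] at e
    linarith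
  have eqφs : ∀ j ≤ 1, (∀ τ ∈ Ioo 0 T, ∀ ξ, deriv (fun τ => iteratedDeriv j (Φ τ) ξ) τ
      = s * iteratedDeriv (j + 1) (Φ τ) ξ + iteratedDeriv (j + 1) (Ψ τ) ξ
        + iteratedDeriv (j + 1) (increment g tv (Φ τ)) ξ) →
      ∀ τ ∈ Ioo 0 T, ∀ ξ, deriv (fun τ => iteratedDeriv (j + 1) (Φ τ) ξ) τ
      = s * iteratedDeriv (j + 1 + 1) (Φ τ) ξ + iteratedDeriv (j + 1 + 1) (Ψ τ) ξ
        + iteratedDeriv (j + 1 + 1) (increment g tv (Φ τ)) ξ := fun j hj e τ hτ ξ => by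
    have d := dxΦt j (by omega) τ hτ ξ
    rw [funext (e τ hτ)] at d
    exact d.unique ((((dΦ (j + 1) (by omega) τ (I hτ) ξ).const_mul s).fun_add
      (dΨ (j + 1) (by omega) τ (I hτ) ξ)).fun_add ((specQ τ hτ).1 (j + 1) (by omega) ξ))
  have eqψs : ∀ j ≤ 2, (∀ τ ∈ Ioo 0 T, ∀ ξ, deriv (fun τ => iteratedDeriv j (Ψ τ) ξ) τ
      = s * iteratedDeriv (j + 1) (Ψ τ) ξ - iteratedDeriv j (increment p tv (Φ τ)) ξ) →
      ∀ τ ∈ Ioo 0 T, ∀ ξ, deriv (fun τ => iteratedDeriv (j + 1) (Ψ τ) ξ) τ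
      = s * iteratedDeriv (j + 1 + 1) (Ψ τ) ξ
        - iteratedDeriv (j + 1) (increment p tv (Φ τ)) ξ := fun j hj e τ hτ ξ => by
    have d := dxΨt j hj τ hτ ξ
    rw [funext (e τ hτ)] at d
    exact d.unique (((dΨ (j + 1) (by omega) τ (I hτ) ξ).const_mul s).fun_sub
      ((specP τ hτ).1 j hj ξ))
  have hwd : ∀ ξ, HasDerivAt (fun ξ => -(deriv p (tv ξ))⁻¹)
      (iteratedDeriv 2 p (tv ξ) * deriv tv ξ / deriv p (tv ξ) ^ 2) ξ := fun ξ => by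
    have h1 := hp 1 (by omega) _ (mtv ξ)
    have h2 := htv 0 (by omega) ξ
    rw [iteratedDeriv_one] at h1
    rw [zero_add, iteratedDeriv_one, iteratedDeriv_zero] at h2
    exact ((h1.comp ξ h2).fun_inv (hp' _ (mtv ξ)).ne).fun_neg.congr_deriv
      (by rw [Function.comp_apply, neg_div, neg_neg])
  have ctv : Continuous tv := by
    have := htv 0 (by omega)
    rw [iteratedDeriv_zero] at this
    exact continuous_iff_continuousAt.2 fun ξ => (this ξ).continuousAt
  have ctv' : Continuous (deriv tv) := by
    have := htv 1 (by omega)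
    rw [iteratedDeriv_one] at this
    exact continuous_iff_continuousAt.2 fun ξ => (this ξ).continuousAt
  have cp' : ContinuousOn (deriv p) (Icc a b) := fun x hx => by
    have := hp 1 (by omega) x hx
    rw [iteratedDeriv_one] at this
    exact this.continuousAt.continuousWithinAt
  exact
  { dxφ := fun j hj τ hτ => dΦ j hj τ (I hτ)
    dxψ := fun j hj τ hτ => dΨ j hj τ (I hτ)
    dxφt := dxΦt
    dxψt := dxΨt
    dtφ := dtΦ
    dtψ := dtΨ
    cφ := hsol.spContΦ
    cψ := hsol.spContΨ
    cφt := hsol.mixContΦ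
    cψt := hsol.mixContΨ
    iφ := hsol.sqIntΦ
    iψ := hsol.sqIntΨ
    lφ := hsol.l2ContΦ
    lψ := hsol.l2ContΨ
    eqφ := fun j hj => by
      interval_cases j
      · exact eqφ0
      · exact eqφs 0 (by omega) eqφ0
      · exact eqφs 1 (by omega) (eqφs 0 (by omega) eqφ0)
    eqψ := fun j hj => by
      interval_cases j
      · exact eqψ0
      · exact eqψs 0 (by omega) eqψ0
      · exact eqψs 1 (by omega) (eqψs 0 (by omega) eqψ0)
      · exact eqψs 2 (by omega) (eqψs 1 (by omega) (eqψs 0 (by omega) eqψ0))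
    dxQ := fun τ hτ => (specQ τ hτ).1 0 (by omega)
    Q_zero_abs := fun τ hτ ξ => by
      obtain ⟨θ, hθ, -, e⟩ := (specQ τ hτ).2.2.2 ξ
      rw [e, abs_mul]
      exact mul_le_mul_of_nonneg_right (bg1 θ hθ) (abs_nonneg _)
    Q_zero_mul := fun τ hτ ξ => by
      obtain ⟨θ, hθ, -, e⟩ := (specQ τ hτ).2.2.2 ξ
      rw [e]
      nlinarith [mul_le_mul_of_nonneg_right (hγ θ hθ) (sq_nonneg (iteratedDeriv 1 (Φ τ) ξ))]
    P_zero_abs := fun τ hτ ξ => by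
      obtain ⟨θ, hθ, -, e⟩ := (specP τ hτ).2.2.2 ξ
      rw [e, abs_mul]
      exact mul_le_mul_of_nonneg_right (bp1 θ hθ) (abs_nonneg _)
    P_zero_mul := fun τ hτ ξ => by
      obtain ⟨θ, hθ, hle, e⟩ := (specP τ hτ).2.2.2 ξ
      have hb := (hwlip ξ θ hθ).trans
        (mul_le_mul_of_nonneg_left hle (sq_nonneg M))
      have e2 : iteratedDeriv 1 (Φ τ) ξ * iteratedDeriv 0 (Ψ τ) ξ + -(deriv p (tv ξ))⁻¹
          * iteratedDeriv 0 (Ψ τ) ξ * iteratedDeriv 0 (increment p tv (Φ τ)) ξ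
          = iteratedDeriv 0 (Ψ τ) ξ * iteratedDeriv 1 (Φ τ) ξ
            * (-(deriv p (tv ξ))⁻¹ * (deriv p θ - deriv p (tv ξ))) := by
        rw [e]
        linear_combination iteratedDeriv 0 (Ψ τ) ξ * iteratedDeriv 1 (Φ τ) ξ * hw1 ξ
      rw [e2, abs_mul, abs_mul, ← sq_abs (iteratedDeriv 1 (Φ τ) ξ)]
      have h1 := mul_le_mul_of_nonneg_left hb
        (mul_nonneg (abs_nonneg (iteratedDeriv 0 (Ψ τ) ξ)) (abs_nonneg (iteratedDeriv 1 (Φ τ) ξ)))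
      have h2 := mul_le_mul_of_nonneg_right (bψ τ hτ ξ)
        (by positivity : 0 ≤ M ^ 2 * |iteratedDeriv 1 (Φ τ) ξ| ^ 2)
      have h3 : M ^ 2 * δ ≤ c / 2 :=
        hδ.trans (div_le_div_of_nonneg_left hc.le (by norm_num) (by nlinarith))
      have h4 := mul_le_mul_of_nonneg_right h3 (sq_nonneg |iteratedDeriv 1 (Φ τ) ξ|)
      nlinarith
    Q_succ := fun j hj τ hτ ξ => ((specQ τ hτ).2.2.1 j hj ξ).trans
      (mul_le_mul_of_nonneg_right hNM (Finset.sum_nonneg fun _ _ => abs_nonneg _))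
    P_succ := fun j hj τ hτ ξ => ((specP τ hτ).2.2.1 j hj ξ).trans
      (mul_le_mul_of_nonneg_right hNM (Finset.sum_nonneg fun _ _ => abs_nonneg _))
    γ_mem := fun τ hτ ξ => ⟨hγ _ (mv τ hτ ξ), (le_abs_self _).trans (bg1 _ (mv τ hτ ξ))⟩
    π_abs := fun τ hτ ξ => bp1 _ (mv τ hτ ξ)
    wπ := fun τ hτ ξ => by
      have hb := bφ τ hτ ξ
      rw [iteratedDeriv_one] at hb
      have hx : |tv ξ + deriv (Φ τ) ξ - tv ξ| ≤ δ := by rwa [add_sub_cancel_left]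
      have e : 1 + -(deriv p (tv ξ))⁻¹ * deriv p (tv ξ + deriv (Φ τ) ξ)
          = -(deriv p (tv ξ))⁻¹ * (deriv p (tv ξ + deriv (Φ τ) ξ) - deriv p (tv ξ)) := by
        linear_combination hw1 ξ
      rw [e]
      exact (hwlip ξ _ (mv τ hτ ξ)).trans
        ((mul_le_mul_of_nonneg_left hx (sq_nonneg M)).trans hδ)
    dw := hwd
    cw' := ((cp.comp_continuous ctv mtv).mul ctv').div₀ ((cp'.comp_continuous ctv mtv).pow 2)
      fun ξ => pow_ne_zero 2 (hp' _ (mtv ξ)).ne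
    w_mem := fun ξ => hw _ (mtv ξ)
    w'_abs := hw'
    sw' := hsw' }

theorem contDiffOn_iteratedDeriv {h : ℝ → ℝ} {U : Set ℝ} (hU : IsOpen U)
    (hh : ContDiffOn ℝ (⊤ : ℕ∞) h U) (j : ℕ) : ContDiffOn ℝ (⊤ : ℕ∞) (iteratedDeriv j h) U := by
  induction j with
  | zero => rwa [iteratedDeriv_zero]
  | succ j ih =>
    rw [iteratedDeriv_succ]
    exact ((contDiffOn_infty_iff_deriv_of_isOpen hU).1 ih).2

theorem hasDerivAt_iteratedDeriv {h : ℝ → ℝ} {U : Set ℝ} (hU : IsOpen U)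
    (hh : ContDiffOn ℝ (⊤ : ℕ∞) h U) (j : ℕ) {x : ℝ} (hx : x ∈ U) :
    HasDerivAt (iteratedDeriv j h) (iteratedDeriv (j + 1) h x) x := by
  rw [iteratedDeriv_succ]
  exact (((contDiffOn_infty_iff_deriv_of_isOpen hU).1
    (contDiffOn_iteratedDeriv hU hh j)).1.differentiableAt (hU.mem_nhds hx)).hasDerivAt

theorem exists_uniform_bound {f : ℕ → ℝ → ℝ} {S : Set ℝ} (n : ℕ)
    (h : ∀ j, ∃ N, ∀ x ∈ S, |f j x| ≤ N) : ∃ N ≥ 0, ∀ j ≤ n, ∀ x ∈ S, |f j x| ≤ N := by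
  choose B hB using h
  refine ⟨∑ i ∈ Finset.range (n + 1), |B i|, Finset.sum_nonneg fun _ _ => abs_nonneg _,
    fun j hj x hx => (hB j x hx).trans ((le_abs_self _).trans ?_)⟩
  exact Finset.single_le_sum (f := fun i => |B i|) (fun i _ => abs_nonneg _)
    (Finset.mem_range.2 (by omega))

theorem exists_bound_iteratedDeriv {h : ℝ → ℝ} {U : Set ℝ} (hU : IsOpen U)
    (hh : ContDiffOn ℝ (⊤ : ℕ∞) h U) {a b : ℝ} (hab : Icc a b ⊆ U) (n : ℕ) :
    ∃ N ≥ 0, ∀ j ≤ n, ∀ x ∈ Icc a b, |iteratedDeriv j h x| ≤ N :=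
  exists_uniform_bound n fun j => isCompact_Icc.exists_bound_of_continuousOn
    ((contDiffOn_iteratedDeriv hU hh j).continuousOn.mono hab)

theorem exists_pos_le {f : ℝ → ℝ} {a b : ℝ} (hab : a ≤ b) (hf : ContinuousOn f (Icc a b))
    (hpos : ∀ x ∈ Icc a b, 0 < f x) : ∃ c > 0, ∀ x ∈ Icc a b, c ≤ f x := by
  obtain ⟨x, hx, h⟩ := isCompact_Icc.exists_isMinOn (nonempty_Icc.2 hab) hf
  exact ⟨f x, hpos x hx, fun y hy => h hy⟩

theorem HkSq_nonneg (k : ℕ) (f : ℝ → ℝ) : 0 ≤ HkSq k f :=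
  Finset.sum_nonneg fun _ _ => integral_nonneg fun _ => sq_nonneg _

theorem abs_iteratedDeriv_le {f : ℝ → ℝ} (hf : ContDiff ℝ 4 f)
    (hi : ∀ j ≤ 4, Integrable fun ξ => iteratedDeriv j f ξ ^ 2) {δ : ℝ} (hδ : 0 ≤ δ)
    (h : HkSq 3 f ≤ δ ^ 2) {j : ℕ} (hj : j ≤ 2) (ξ : ℝ) : |iteratedDeriv j f ξ| ≤ δ := by
  refine abs_le_of_sq_le_sq ((sq_le_integral_sq_add (f := iteratedDeriv j f)
    (f' := iteratedDeriv (j + 1) f) (fun x => ?_)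
    (hf.continuous_iteratedDeriv (j + 1) (by exact_mod_cast (by omega : j + 1 ≤ 4)))
    (hi j (by omega)) (hi (j + 1) (by omega)) ξ).trans (le_trans ?_ h)) hδ
  · rw [iteratedDeriv_succ]
    exact (hf.differentiable_iteratedDeriv j
      (by exact_mod_cast (by omega : j < 4)) x).hasDerivAt
  · have nn : ∀ i, 0 ≤ ∫ ξ, iteratedDeriv i f ξ ^ 2 := fun i => integral_nonneg fun _ => sq_nonneg _
    have n0 := nn 0
    have n1 := nn 1
    have n2 := nn 2
    have n3 := nn 3
    simp only [HkSq, L2sq, Finset.sum_range_succ, Finset.sum_range_zero]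
    interval_cases j <;> simp only [zero_add, Nat.reduceAdd] <;> linarith

theorem a_priori_estimate
    (p : ℝ → ℝ)
    (hp_smooth : ContDiffOn ℝ (⊤ : ℕ∞) p (Set.Ioi 0))
    (hpd : ∀ v ∈ Set.Ioi (0:ℝ), deriv p v < 0)
    (hpdd : ∀ v ∈ Set.Ioi (0:ℝ), 0 ≤ deriv (deriv p) v)
    (hpdd_ne : ∀ a b : ℝ, 0 < a → a < b → ∃ v ∈ Set.Ioo a b, deriv (deriv p) v ≠ 0)
    (μ : ℝ → ℝ)
    (hmu_smooth : ContDiffOn ℝ (⊤ : ℕ∞) μ (Set.Ioi 0))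
    (hmu_pos : ∀ v ∈ Set.Ioi (0:ℝ), 0 < μ v)
    (vp vm s : ℝ)
    (hvp : 0 < vp) (hvpvm : vp < vm)
    (hs : s = -Real.sqrt (-((p vp - p vm) / (vp - vm))))
    (hsneg : s < 0)
    (g : ℝ → ℝ)
    (hg : ∀ z ∈ Set.Ioi (0:ℝ), HasDerivAt g (μ z / z) z)
    (tv : ℝ → ℝ)
    (htv_smooth : ContDiff ℝ (⊤ : ℕ∞) tv)
    (htv_ode : ∀ ξ : ℝ, deriv tv ξ
        = tv ξ / (-s * μ (tv ξ)) * (s ^ 2 * (tv ξ - vm) + p (tv ξ) - p vm))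
    (htv_mem : ∀ ξ : ℝ, tv ξ ∈ Set.Ioo vp vm)
    (htv_dec : ∀ ξ : ℝ, deriv tv ξ < 0)
    (htv_bot : Filter.Tendsto tv Filter.atBot (nhds vm))
    (htv_top : Filter.Tendsto tv Filter.atTop (nhds vp))
    (htv_bdd : ∀ k : ℕ, ∃ M : ℝ, ∀ ξ : ℝ, |iteratedDeriv k tv ξ| ≤ M)
 :
    ∃ δ₀ > (0:ℝ), ∃ C₀ > (1:ℝ), ∀ T > (0:ℝ), ∀ δ ≤ δ₀, ∀ Φ Ψ : ℝ → ℝ → ℝ,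
      IsClassicalSolution p g tv s T Φ Ψ →
      (∀ t ∈ Set.Icc (0:ℝ) T, Real.sqrt (pairHkSq 3 (Φ t) (Ψ t)) ≤ δ) →
      ∀ t ∈ Set.Icc (0:ℝ) T,
        pairHkSq 3 (Φ t) (Ψ t)
            + (∫ τ in (0:ℝ)..t, (HkSq 3 (deriv (Φ τ)) + HkSq 2 (deriv (Ψ τ))))
          ≤ C₀ * pairHkSq 3 (Φ 0) (Ψ 0) := by
  have hpos : Icc (vp / 2) (vm + 1) ⊆ Ioi 0 := fun x hx => (half_pos hvp).trans_le hx.1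
  have hab : vp / 2 ≤ vm + 1 := by linarith
  have hg_smooth : ContDiffOn ℝ (⊤ : ℕ∞) g (Ioi 0) :=
    (contDiffOn_infty_iff_deriv_of_isOpen isOpen_Ioi).2
      ⟨fun z hz => (hg z hz).differentiableAt.differentiableWithinAt,
        (hmu_smooth.div contDiffOn_id fun z hz => (mem_Ioi.1 hz).ne').congr
          fun z hz => (hg z hz).deriv⟩
  have mtv : ∀ ξ, tv ξ ∈ Icc (vp / 2) (vm + 1) := fun ξ =>
    ⟨by linarith [(htv_mem ξ).1], by linarith [(htv_mem ξ).2]⟩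
  have cdp : ∀ j, ContinuousOn (iteratedDeriv j p) (Icc (vp / 2) (vm + 1)) := fun j =>
    (contDiffOn_iteratedDeriv isOpen_Ioi hp_smooth j).continuousOn.mono hpos
  have cdg : ∀ j, ContinuousOn (iteratedDeriv j g) (Icc (vp / 2) (vm + 1)) := fun j =>
    (contDiffOn_iteratedDeriv isOpen_Ioi hg_smooth j).continuousOn.mono hpos
  obtain ⟨Np, hNp, bp⟩ := exists_bound_iteratedDeriv isOpen_Ioi hp_smooth hpos 4
  obtain ⟨Ng, hNg, bg⟩ := exists_bound_iteratedDeriv isOpen_Ioi hg_smooth hpos 4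
  obtain ⟨Nv, hNv, bv⟩ := exists_uniform_bound (f := fun j => iteratedDeriv j tv) (S := univ) 3
    fun j => (htv_bdd j).imp fun N hN x _ => hN x
  obtain ⟨N, hN⟩ : ∃ N, N = 1 + Np + Ng + Nv := ⟨_, rfl⟩
  have hN1 : 1 ≤ N := by linarith
  replace bp : ∀ j ≤ 4, ∀ x ∈ Icc (vp / 2) (vm + 1), |iteratedDeriv j p x| ≤ N :=
    fun j hj x hx => (bp j hj x hx).trans (by linarith)
  replace bg : ∀ j ≤ 4, ∀ x ∈ Icc (vp / 2) (vm + 1), |iteratedDeriv j g x| ≤ N :=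
    fun j hj x hx => (bg j hj x hx).trans (by linarith)
  replace bv : ∀ j ≤ 3, ∀ ξ, |iteratedDeriv j tv ξ| ≤ N :=
    fun j hj ξ => (bv j hj ξ trivial).trans (by linarith)
  obtain ⟨c₁, hc₁, hγ⟩ := exists_pos_le hab (iteratedDeriv_one (f := g) ▸ cdg 1) fun x hx => by
    rw [(hg x (hpos hx)).deriv]
    exact div_pos (hmu_pos x (hpos hx)) (hpos hx)
  obtain ⟨c₂, hc₂, hp'⟩ := exists_pos_le hab (iteratedDeriv_one (f := p) ▸ cdp 1).neg
    fun x hx => neg_pos.2 (hpd x (hpos hx))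
  obtain ⟨c, hc⟩ : ∃ c, c = min c₁ (1 / N) := ⟨_, rfl⟩
  have hc0 : 0 < c := by rw [hc]; exact lt_min hc₁ (by positivity)
  obtain ⟨M, hM⟩ : ∃ M, M = 10 * N ^ 4 + 1 / c₂ + N ^ 2 / c₂ ^ 2 := ⟨_, rfl⟩
  have hNM : 10 * N ^ 4 ≤ M := by
    rw [hM, add_assoc]
    exact le_add_of_nonneg_right (by positivity)
  have hM1 : 1 ≤ M := by linarith [one_le_pow₀ (n := 4) hN1]
  have hw : ∀ x ∈ Icc (vp / 2) (vm + 1), -(deriv p x)⁻¹ ∈ Icc c M := fun x hx => by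
    have h1 := hp' x hx
    have h2 : -deriv p x ≤ N := by
      have := bp 1 (by omega) x hx
      rw [iteratedDeriv_one] at this
      exact (neg_le_abs _).trans this
    rw [← inv_neg, ← one_div]
    refine ⟨(hc ▸ min_le_right _ _ : c ≤ 1 / N).trans
      (one_div_le_one_div_of_le (hc₂.trans_le h1) h2), ?_⟩
    refine (one_div_le_one_div_of_le hc₂ h1).trans ?_
    have e1 : 0 ≤ 10 * N ^ 4 := by positivity
    have e2 : 0 ≤ N ^ 2 / c₂ ^ 2 := by positivity
    linarith
  have hw' : ∀ ξ, |iteratedDeriv 2 p (tv ξ) * deriv tv ξ / deriv p (tv ξ) ^ 2| ≤ M := fun ξ => by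
    have h1 : c₂ ^ 2 ≤ deriv p (tv ξ) ^ 2 := by
      rw [← neg_sq (deriv p (tv ξ))]
      exact pow_le_pow_left₀ hc₂.le (hp' _ (mtv ξ)) 2
    have h2 := bp 2 (by omega) _ (mtv ξ)
    have h3 := bv 1 (by omega) ξ
    rw [iteratedDeriv_one] at h3
    rw [abs_div, abs_mul, abs_of_nonneg (sq_nonneg (deriv p (tv ξ)))]
    have h4 : |iteratedDeriv 2 p (tv ξ)| * |deriv tv ξ| ≤ N ^ 2 := by
      rw [sq]
      exact mul_le_mul h2 h3 (abs_nonneg _) (by linarith)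
    refine (div_le_div₀ (by positivity) h4 (by positivity) h1).trans ?_
    have e1 : 0 ≤ 10 * N ^ 4 := by positivity
    have e2 : 0 ≤ 1 / c₂ := by positivity
    linarith
  have hsw' : ∀ ξ, 0 ≤ s * (iteratedDeriv 2 p (tv ξ) * deriv tv ξ / deriv p (tv ξ) ^ 2) :=
    fun ξ => by
      have h1 : 0 ≤ iteratedDeriv 2 p (tv ξ) := by
        rw [iteratedDeriv_succ, iteratedDeriv_one]
        exact hpdd _ (hpos (mtv ξ))
      exact mul_nonneg_of_nonpos_of_nonpos hsneg.le (div_nonpos_of_nonpos_of_nonneg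
        (mul_nonpos_of_nonneg_of_nonpos h1 (htv_dec ξ).le) (sq_nonneg _))
  obtain ⟨K, hK, henergy⟩ := EnergyFrame.energy_le (s := s) hc0 hM1
  refine ⟨min (min 1 (vp / 2)) (c / (64 * M ^ 4)), by positivity, K + 2, by linarith,
    fun T hT δ hδ Φ Ψ hsol hsmall t ht => ?_⟩
  have hδ1 : δ ≤ 1 := hδ.trans ((min_le_left _ _).trans (min_le_left _ _))
  have hδ2 : δ ≤ vp / 2 := hδ.trans ((min_le_left _ _).trans (min_le_right _ _))
  have hδ3 : M ^ 2 * δ ≤ c / (64 * M ^ 2) := by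
    refine (mul_le_mul_of_nonneg_left (hδ.trans (min_le_right _ _)) (sq_nonneg M)).trans_eq ?_
    field_simp
  have hsq : ∀ τ ∈ Icc 0 T, 0 ≤ δ ∧ HkSq 3 (Φ τ) + HkSq 3 (Ψ τ) ≤ δ ^ 2 := fun τ hτ =>
    Real.sqrt_le_iff.1 (hsmall τ hτ)
  have bφ : ∀ j ≤ 2, ∀ τ ∈ Ioo 0 T, ∀ ξ, |iteratedDeriv j (Φ τ) ξ| ≤ δ := fun j hj τ hτ ξ => by
    have hτ' := Ioo_subset_Icc_self hτ
    exact abs_iteratedDeriv_le (hsol.regΦ τ hτ') (fun j hj => hsol.sqIntΦ j hj τ hτ')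
      (hsq τ hτ').1 (by linarith [(hsq τ hτ').2, HkSq_nonneg 3 (Ψ τ)]) hj ξ
  have bψ : ∀ τ ∈ Ioo 0 T, ∀ ξ, |iteratedDeriv 0 (Ψ τ) ξ| ≤ δ := fun τ hτ ξ => by
    have hτ' := Ioo_subset_Icc_self hτ
    exact abs_iteratedDeriv_le (hsol.regΨ τ hτ') (fun j hj => hsol.sqIntΨ j hj τ hτ')
      (hsq τ hτ').1 (by linarith [(hsq τ hτ').2, HkSq_nonneg 3 (Φ τ)]) (by omega) ξ
  have mv : ∀ τ ∈ Ioo 0 T, ∀ ξ, tv ξ + deriv (Φ τ) ξ ∈ Icc (vp / 2) (vm + 1) := fun τ hτ ξ => by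
    have h1 := bφ 1 (by omega) τ hτ ξ
    rw [iteratedDeriv_one] at h1
    have h2 := abs_le.1 h1
    exact ⟨by linarith [(htv_mem ξ).1], by linarith [(htv_mem ξ).2]⟩
  have hframe := energyFrame_of_isClassicalSolution hsol hc0 hN1 hNM
    (fun j _ x hx => hasDerivAt_iteratedDeriv isOpen_Ioi hp_smooth j (hpos hx))
    (fun j _ x hx => hasDerivAt_iteratedDeriv isOpen_Ioi hg_smooth j (hpos hx)) bp bg (cdp 2)
    (fun j _ ξ => hasDerivAt_iteratedDeriv isOpen_univ htv_smooth.contDiffOn j (mem_univ ξ)) bv mtv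
    (fun x hx => (hc ▸ min_le_left _ _ : c ≤ c₁).trans (hγ x hx)) (fun x hx => hpd x (hpos hx))
    hw hw' hsw' hδ3 mv (bφ 1 (by omega)) (fun τ hτ ξ => (bφ 2 le_rfl τ hτ ξ).trans hδ1) bψ
  have hres := henergy hframe t ht
  have hmono := hframe.mono ht.2
  have hint : ∫ τ in (0 : ℝ)..t, (HkSq 3 (deriv (Φ τ)) + HkSq 2 (deriv (Ψ τ)))
      = (∑ j ∈ Finset.range 4, ∫ τ in Ioo 0 t, ∫ ξ, iteratedDeriv (j + 1) (Φ τ) ξ ^ 2)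
        + ∑ j ∈ Finset.range 3, ∫ τ in Ioo 0 t, ∫ ξ, iteratedDeriv (j + 1) (Ψ τ) ξ ^ 2 := by
    have iΦ : ∀ j ∈ Finset.range 4, Integrable
        (fun τ => ∫ ξ, iteratedDeriv (j + 1) (Φ τ) ξ ^ 2) (volume.restrict (Ioo 0 t)) :=
      fun j hj => hmono.time_φ (by rw [Finset.mem_range] at hj; omega)
    have iΨ : ∀ j ∈ Finset.range 3, Integrable
        (fun τ => ∫ ξ, iteratedDeriv (j + 1) (Ψ τ) ξ ^ 2) (volume.restrict (Ioo 0 t)) :=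
      fun j hj => hmono.time_ψ (by rw [Finset.mem_range] at hj; omega)
    rw [intervalIntegral_eq_Ioo ht.1, ← integral_finsetSum _ iΦ, ← integral_finsetSum _ iΨ,
      ← integral_add (integrable_finsetSum _ iΦ) (integrable_finsetSum _ iΨ)]
    simp only [HkSq, L2sq, ← iteratedDeriv_succ', Nat.reduceAdd]
  rw [hint]
  have hinit : 0 ≤ pairHkSq 3 (Φ 0) (Ψ 0) := add_nonneg (HkSq_nonneg _ _) (HkSq_nonneg _ _)
  have hres' : pairHkSq 3 (Φ t) (Ψ t) + ((∑ j ∈ Finset.range 4,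
      ∫ τ in Ioo 0 t, ∫ ξ, iteratedDeriv (j + 1) (Φ τ) ξ ^ 2)
        + ∑ j ∈ Finset.range 3, ∫ τ in Ioo 0 t, ∫ ξ, iteratedDeriv (j + 1) (Ψ τ) ξ ^ 2)
      ≤ K * pairHkSq 3 (Φ 0) (Ψ 0) := hres
  linarith
end
end

section
/- Let T > 0 and let (v,u) : ℝ × (0,T) → ℝ² be twice continuously differentiable with v(x,t) > 0 for all (x,t), satisfying pointwise the isentropic Navier–Stokes equations v_t − u_x = 0 and u_t + p(v)_x = (μ(v)u_x/v)_x. Define the effective velocity h := u − ∂_x(g(v)) = u − g'(v)v_x. Then (v,h) satisfies pointwise v_t − h_x = (g'(v)v_x)_x and h_t + p(v)_x = 0. -/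
open MeasureTheory Filter Topology Set

noncomputable section

theorem hasDerivAt_fst_slice {F : ℝ → ℝ → ℝ} {x t : ℝ}
    (h : DifferentiableAt ℝ (fun q : ℝ × ℝ => F q.1 q.2) (x, t)) :
    HasDerivAt (fun y => F y t) (fderiv ℝ (fun q : ℝ × ℝ => F q.1 q.2) (x, t) (1, 0)) x :=
  h.hasFDerivAt.comp_hasDerivAt (f := fun y => (y, t)) x
    ((hasDerivAt_id x).prodMk (hasDerivAt_const x t))

theorem hasDerivAt_snd_slice {F : ℝ → ℝ → ℝ} {x t : ℝ}
    (h : DifferentiableAt ℝ (fun q : ℝ × ℝ => F q.1 q.2) (x, t)) :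
    HasDerivAt (fun τ => F x τ) (fderiv ℝ (fun q : ℝ × ℝ => F q.1 q.2) (x, t) (0, 1)) t :=
  h.hasFDerivAt.comp_hasDerivAt (f := fun τ => (x, τ)) t
    ((hasDerivAt_const t x).prodMk (hasDerivAt_id t))

theorem ContDiffAt.eventually_differentiableAt_of_two {f : ℝ × ℝ → ℝ} {q : ℝ × ℝ}
    (h : ContDiffAt ℝ 2 f q) : ∀ᶠ r in 𝓝 q, DifferentiableAt ℝ f r :=
  (h.eventually (by simp)).mono fun _ hr => hr.differentiableAt (by simp)

theorem ContDiffAt.differentiableAt_fderiv_apply {f : ℝ × ℝ → ℝ} {q : ℝ × ℝ}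
    (h : ContDiffAt ℝ 2 f q) (w : ℝ × ℝ) :
    DifferentiableAt ℝ (fun r => fderiv ℝ f r w) q :=
  ((h.fderiv_right (m := 1) (by norm_num)).differentiableAt (by simp)).clm_apply
    (differentiableAt_const w)

theorem ContDiffAt.differentiableAt_deriv_fst {F : ℝ → ℝ → ℝ} {x t : ℝ}
    (h : ContDiffAt ℝ 2 (fun q : ℝ × ℝ => F q.1 q.2) (x, t)) :
    DifferentiableAt ℝ (fun q : ℝ × ℝ => deriv (fun z => F z q.2) q.1) (x, t) :=
  (h.differentiableAt_fderiv_apply (1, 0)).congr_of_eventuallyEq <|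
    h.eventually_differentiableAt_of_two.mono fun _ hr => (hasDerivAt_fst_slice hr).deriv

/-- Symmetry of mixed partial derivatives, in terms of one-variable derivatives. -/
theorem ContDiffAt.deriv_deriv_comm {F : ℝ → ℝ → ℝ} {x t : ℝ}
    (h : ContDiffAt ℝ 2 (fun q : ℝ × ℝ => F q.1 q.2) (x, t)) :
    deriv (fun τ => deriv (fun z => F z τ) x) t =
      deriv (fun y => deriv (fun τ => F y τ) t) x := by
  set f : ℝ × ℝ → ℝ := fun q => F q.1 q.2
  have hd := h.eventually_differentiableAt_of_two
  have ht : (fun τ => deriv (fun z => F z τ) x) =ᶠ[𝓝 t] fun τ => fderiv ℝ f (x, τ) (1, 0) :=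
    ((Continuous.prodMk_right x).tendsto t).eventually hd |>.mono
      fun _ hr => (hasDerivAt_fst_slice hr).deriv
  have hx : (fun y => deriv (fun τ => F y τ) t) =ᶠ[𝓝 x] fun y => fderiv ℝ f (y, t) (0, 1) :=
    ((Continuous.prodMk_left t).tendsto x).eventually hd |>.mono
      fun _ hr => (hasDerivAt_snd_slice hr).deriv
  have hfd : DifferentiableAt ℝ (fderiv ℝ f) (x, t) :=
    (h.fderiv_right (m := 1) (by norm_num)).differentiableAt (by simp)
  have hsnd (w : ℝ × ℝ) (r : ℝ × ℝ) :
      fderiv ℝ (fun q => fderiv ℝ f q w) (x, t) r = fderiv ℝ (fderiv ℝ f) (x, t) r w := by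
    rw [fderiv_clm_apply hfd (differentiableAt_const w)]
    simp
  rw [ht.deriv_eq, hx.deriv_eq,
    (hasDerivAt_snd_slice (F := fun y τ => fderiv ℝ f (y, τ) (1, 0))
      (h.differentiableAt_fderiv_apply (1, 0))).deriv,
    (hasDerivAt_fst_slice (F := fun y τ => fderiv ℝ f (y, τ) (0, 1))
      (h.differentiableAt_fderiv_apply (0, 1))).deriv]
  exact (hsnd _ _).trans <|
    ((h.isSymmSndFDerivAt (by simp)) (0, 1) (1, 0)).trans (hsnd _ _).symm

theorem contDiffOn_two_of_hasDerivAt {g g' : ℝ → ℝ} {s : Set ℝ} (hs : IsOpen s)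
    (hg : ∀ z ∈ s, HasDerivAt g (g' z) z) (hg' : ContDiffOn ℝ 1 g' s) :
    ContDiffOn ℝ 2 g s := by
  rw [show (2 : WithTop ℕ∞) = 1 + 1 by norm_num, contDiffOn_succ_iff_deriv_of_isOpen hs]
  exact ⟨fun z hz => (hg z hz).differentiableAt.differentiableWithinAt, by simp,
    hg'.congr fun z hz => (hg z hz).deriv⟩

theorem effective_velocity_system
    (p : ℝ → ℝ)
    (hp_smooth : ContDiffOn ℝ (⊤ : ℕ∞) p (Set.Ioi 0))
    (hpd : ∀ v ∈ Set.Ioi (0:ℝ), deriv p v < 0)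
    (hpdd : ∀ v ∈ Set.Ioi (0:ℝ), 0 ≤ deriv (deriv p) v)
    (μ : ℝ → ℝ)
    (hmu_smooth : ContDiffOn ℝ (⊤ : ℕ∞) μ (Set.Ioi 0))
    (hmu_pos : ∀ v ∈ Set.Ioi (0:ℝ), 0 < μ v)
    (g : ℝ → ℝ)
    (hg : ∀ z ∈ Set.Ioi (0:ℝ), HasDerivAt g (μ z / z) z)
    (T : ℝ) (hT : 0 < T)
    (V U : ℝ → ℝ → ℝ)
    (hVreg : ContDiffOn ℝ 2 (fun q : ℝ × ℝ => V q.1 q.2)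
      ((Set.univ : Set ℝ) ×ˢ Set.Ioo (0:ℝ) T))
    (hUreg : ContDiffOn ℝ 2 (fun q : ℝ × ℝ => U q.1 q.2)
      ((Set.univ : Set ℝ) ×ˢ Set.Ioo (0:ℝ) T))
    (hpos : ∀ x : ℝ, ∀ t ∈ Set.Ioo (0:ℝ) T, 0 < V x t)
    (heq1 : ∀ x : ℝ, ∀ t ∈ Set.Ioo (0:ℝ) T,
      deriv (fun τ => V x τ) t - deriv (fun y => U y t) x = 0)
    (heq2 : ∀ x : ℝ, ∀ t ∈ Set.Ioo (0:ℝ) T,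
      deriv (fun τ => U x τ) t + deriv (fun y => p (V y t)) x
        = deriv (fun y => μ (V y t) / V y t * deriv (fun z => U z t) y) x) :
    ∀ x : ℝ, ∀ t ∈ Set.Ioo (0:ℝ) T,
      (deriv (fun τ => V x τ) t
          - deriv (fun y => U y t - deriv (fun z => g (V z t)) y) x
        = deriv (fun y => deriv g (V y t) * deriv (fun z => V z t) y) x) ∧
      (deriv (fun τ => U x τ - deriv (fun z => g (V z τ)) x) t
          + deriv (fun y => p (V y t)) x = 0) := by
  have hopen : IsOpen ((Set.univ : Set ℝ) ×ˢ Set.Ioo (0:ℝ) T) := isOpen_univ.prod isOpen_Ioo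
  have hmu_div : ContDiffOn ℝ 1 (fun z => μ z / z) (Set.Ioi 0) :=
    (hmu_smooth.of_le (by exact_mod_cast le_top)).div contDiffOn_id fun _ hz => ne_of_gt hz
  have hg2 := contDiffOn_two_of_hasDerivAt isOpen_Ioi hg hmu_div
  intro x t ht
  have hV (y : ℝ) : ContDiffAt ℝ 2 (fun q : ℝ × ℝ => V q.1 q.2) (y, t) :=
    hVreg.contDiffAt (hopen.mem_nhds ⟨Set.mem_univ y, ht⟩)
  have hU (y : ℝ) : ContDiffAt ℝ 2 (fun q : ℝ × ℝ => U q.1 q.2) (y, t) :=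
    hUreg.contDiffAt (hopen.mem_nhds ⟨Set.mem_univ y, ht⟩)
  have hG : ContDiffAt ℝ 2 (fun q : ℝ × ℝ => g (V q.1 q.2)) (x, t) :=
    (hg2.contDiffAt (isOpen_Ioi.mem_nhds (hpos x t ht))).comp (x, t) (hV x)
  have hVd (y : ℝ) := (hV y).differentiableAt (by simp)
  have hUd (y : ℝ) := (hU y).differentiableAt (by simp)
  have hGx := hG.differentiableAt_deriv_fst (F := fun y τ => g (V y τ))
  constructor
  · have hchain (y : ℝ) : deriv (fun z => g (V z t)) y =
        deriv g (V y t) * deriv (fun z => V z t) y :=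
      deriv_comp (h₂ := g) (h := fun z => V z t) y (hg _ (hpos y t ht)).differentiableAt
        (hasDerivAt_fst_slice (hVd y)).differentiableAt
    have hGxx := (hasDerivAt_fst_slice
      (F := fun y τ => deriv (fun z => g (V z τ)) y) hGx).differentiableAt
    rw [deriv_fun_sub (hasDerivAt_fst_slice (hUd x)).differentiableAt hGxx]
    simp_rw [← hchain]
    linarith [heq1 x t ht]
  · have hchain (y : ℝ) : deriv (fun τ => g (V y τ)) t =
        μ (V y t) / V y t * deriv (fun z => U z t) y := by
      rw [← sub_eq_zero.mp (heq1 y t ht)]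
      exact ((hg _ (hpos y t ht)).comp t
        (hasDerivAt_snd_slice (hVd y)).differentiableAt.hasDerivAt).deriv
    have hGxt := (hasDerivAt_snd_slice
      (F := fun y τ => deriv (fun z => g (V z τ)) y) hGx).differentiableAt
    rw [deriv_fun_sub (hasDerivAt_snd_slice (hUd x)).differentiableAt hGxt,
      hG.deriv_deriv_comm (F := fun y τ => g (V y τ))]
    simp_rw [hchain]
    linarith [heq2 x t ht]
end
end

section
/- There exists a constant C > 0, depending only on μ, the profile ṽ and v_±, such that for every function Φ(·,t) that is three times continuously differentiable in ξ and satisfies |Φ_ξ(ξ,t)| ≤ v_+/2 for all ξ, the following pointwise bounds hold with v := ṽ + Φ_ξ: |G| ≤ C(|Φ_ξ||Φ_ξξ| + |ṽ_ξ| Φ_ξ²) and |∂_ξ G| ≤ C(Φ_ξξ² + |Φ_ξ||Φ_ξξ|² + |Φ_ξ||Φ_ξξξ| + Φ_ξ²). -/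
open MeasureTheory Filter Topology Set

noncomputable section

/-- Lipschitz bound on a convex set on which the derivative is bounded. -/
lemma abs_sub_le_of_hasDerivAt {f f' : ℝ → ℝ} {K : Set ℝ} {M x y : ℝ} (hK : Convex ℝ K)
    (hf : ∀ z ∈ K, HasDerivAt f (f' z) z) (hM : ∀ z ∈ K, |f' z| ≤ M)
    (hx : x ∈ K) (hy : y ∈ K) : |f y - f x| ≤ M * |y - x| := by
  simpa [Real.norm_eq_abs] using
    hK.norm_image_sub_le_of_norm_hasDerivWithin_le (f := f) (f' := f')
      (fun z hz => (hf z hz).hasDerivWithinAt) hM hx hy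

/-- Second-order Taylor bound, with a non-sharp constant. -/
lemma abs_taylor_le_of_hasDerivAt {f f' f'' : ℝ → ℝ} {K : Set ℝ} {M x y : ℝ} (hK : Convex ℝ K)
    (hf : ∀ z ∈ K, HasDerivAt f (f' z) z) (hf' : ∀ z ∈ K, HasDerivAt f' (f'' z) z)
    (hM : ∀ z ∈ K, |f'' z| ≤ M) (hx : x ∈ K) (hy : y ∈ K) :
    |f y - f x - f' x * (y - x)| ≤ M * (y - x) ^ 2 := by
  have hM0 : 0 ≤ M := (abs_nonneg _).trans (hM x hx)
  have hsub : Set.uIcc x y ⊆ K := by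
    rw [← segment_eq_uIcc]
    exact hK.segment_subset hx hy
  have h := abs_sub_le_of_hasDerivAt (f := fun z => f z - f' x * z) (f' := fun z => f' z - f' x)
    (K := Set.uIcc x y) (M := M * |y - x|) (convex_uIcc x y)
    (fun z hz => by
      simpa using (hf z (hsub hz)).fun_sub ((hasDerivAt_id z).const_mul (f' x)))
    (fun z hz => (abs_sub_le_of_hasDerivAt hK hf' hM hx (hsub hz)).trans
      (mul_le_mul_of_nonneg_left (Set.abs_sub_left_of_mem_uIcc hz) hM0))
    Set.left_mem_uIcc Set.right_mem_uIcc
  calc |f y - f x - f' x * (y - x)| = |f y - f' x * y - (f x - f' x * x)| := by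
        congr 1; ring
    _ ≤ M * |y - x| * |y - x| := h
    _ = M * (y - x) ^ 2 := by rw [mul_assoc, abs_mul_abs_self, sq]

/-- The pointwise estimate of `Gterm` at the level of numbers. -/
lemma abs_remainder_le {M a b w w₁ t₁ : ℝ} (hM : 1 ≤ M) (ha : |a| ≤ M * |w|)
    (hb : |b| ≤ M * w ^ 2) :
    |a * w₁ + b * t₁| ≤ 5 * M ^ 3 * (|w| * |w₁| + |t₁| * w ^ 2) := by
  have hM3 : M ≤ 5 * M ^ 3 := by
    nlinarith [mul_self_nonneg M, mul_nonneg (sub_nonneg.2 hM) (sub_nonneg.2 hM),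
      pow_le_pow_right₀ hM (show 1 ≤ 3 by norm_num)]
  have h1 : |a| * |w₁| ≤ M * |w| * |w₁| := by gcongr
  have h2 : |b| * |t₁| ≤ M * w ^ 2 * |t₁| := by gcongr
  calc |a * w₁ + b * t₁| ≤ |a| * |w₁| + |b| * |t₁| := by
        simpa [abs_mul] using abs_add_le (a * w₁) (b * t₁)
    _ ≤ M * (|w| * |w₁| + |t₁| * w ^ 2) := by linarith
    _ ≤ 5 * M ^ 3 * (|w| * |w₁| + |t₁| * w ^ 2) := by gcongr

/-- The pointwise estimate of the derivative of `Gterm` at the level of numbers. -/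
lemma abs_remainder_deriv_le {M a b c d e w w₁ w₂ t₁ t₂ : ℝ} (hM : 1 ≤ M)
    (ha : |a| ≤ M * |w|) (hb : |b| ≤ M * w ^ 2) (hc : |c| ≤ M * |w|) (hd : |d| ≤ M * w ^ 2)
    (he : |e| ≤ M) (ht₁ : |t₁| ≤ M) (ht₂ : |t₂| ≤ M) :
    |(c * t₁ + e * w₁) * w₁ + a * w₂ + ((d * t₁ + c * w₁) * t₁ + b * t₂)|
      ≤ 5 * M ^ 3 * (w₁ ^ 2 + |w| * |w₁| ^ 2 + |w| * |w₂| + w ^ 2) := by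
  have hM0 : 0 ≤ M := by linarith
  have hM12 : M ≤ M ^ 2 := by nlinarith
  have hM23 : M ^ 2 ≤ M ^ 3 := pow_le_pow_right₀ hM (by norm_num)
  have h1 : |c * t₁ * w₁| ≤ M * |w| * M * |w₁| := by
    rw [abs_mul, abs_mul]; gcongr
  have h2 : |e * w₁ ^ 2| ≤ M * w₁ ^ 2 := by
    rw [abs_mul, abs_of_nonneg (sq_nonneg w₁)]; gcongr
  have h3 : |a * w₂| ≤ M * |w| * |w₂| := by
    rw [abs_mul]; gcongr
  have h4 : |d * t₁ * t₁| ≤ M * w ^ 2 * M * M := by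
    rw [abs_mul, abs_mul]; gcongr
  have h5 : |b * t₂| ≤ M * w ^ 2 * M := by
    rw [abs_mul]; gcongr
  have hyoung : 2 * (|w| * |w₁|) ≤ w ^ 2 + w₁ ^ 2 := by
    nlinarith [sq_nonneg (|w| - |w₁|), sq_abs w, sq_abs w₁]
  have hsplit : (c * t₁ + e * w₁) * w₁ + a * w₂ + ((d * t₁ + c * w₁) * t₁ + b * t₂)
      = c * t₁ * w₁ + e * w₁ ^ 2 + a * w₂ + d * t₁ * t₁ + c * t₁ * w₁ + b * t₂ := by ring
  rw [hsplit]
  calc |c * t₁ * w₁ + e * w₁ ^ 2 + a * w₂ + d * t₁ * t₁ + c * t₁ * w₁ + b * t₂|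
      ≤ |c * t₁ * w₁| + |e * w₁ ^ 2| + |a * w₂| + |d * t₁ * t₁| + |c * t₁ * w₁| + |b * t₂| := by
        refine (abs_add_le _ _).trans (add_le_add_left ?_ _)
        refine (abs_add_le _ _).trans (add_le_add_left ?_ _)
        refine (abs_add_le _ _).trans (add_le_add_left ?_ _)
        exact abs_add_three _ _ _
    _ ≤ M ^ 2 * (2 * (|w| * |w₁|)) + M * w₁ ^ 2 + M * (|w| * |w₂|) + M ^ 3 * w ^ 2
          + M ^ 2 * w ^ 2 := by linarith
    _ ≤ M ^ 3 * (w ^ 2 + w₁ ^ 2) + M ^ 3 * w₁ ^ 2 + M ^ 3 * (|w| * |w₂|) + M ^ 3 * w ^ 2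
          + M ^ 3 * w ^ 2 := by
        have hM13 := hM12.trans hM23
        gcongr
    _ ≤ 5 * M ^ 3 * (w₁ ^ 2 + |w| * |w₁| ^ 2 + |w| * |w₂| + w ^ 2) := by
        have e1 : 0 ≤ M ^ 3 * w ^ 2 := by positivity
        have e2 : 0 ≤ M ^ 3 * w₁ ^ 2 := by positivity
        have e3 : 0 ≤ M ^ 3 * (|w| * |w₁| ^ 2) := by positivity
        have e4 : 0 ≤ M ^ 3 * (|w| * |w₂|) := by positivity
        linarith

/-- The derivative of `Gterm`, arranged into increments and Taylor remainders. -/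
lemma hasDerivAt_Gterm {g h h₁ h₂ tv φ : ℝ → ℝ} {ξ : ℝ}
    (hgh : ∀ z ∈ Set.Ioi (0 : ℝ), deriv g z = h z)
    (hh : ∀ z ∈ Set.Ioi (0 : ℝ), HasDerivAt h (h₁ z) z)
    (hh₁ : ∀ z ∈ Set.Ioi (0 : ℝ), HasDerivAt h₁ (h₂ z) z)
    (htv : ContDiff ℝ 2 tv) (hφ : ContDiff ℝ 3 φ)
    (hpos : ∀ y, 0 < tv y) (hpos' : ∀ y, 0 < tv y + deriv φ y) :
    HasDerivAt (Gterm g tv φ)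
      (((h₁ (tv ξ + deriv φ ξ) - h₁ (tv ξ)) * deriv tv ξ
            + h₁ (tv ξ + deriv φ ξ) * iteratedDeriv 2 φ ξ) * iteratedDeriv 2 φ ξ
          + (h (tv ξ + deriv φ ξ) - h (tv ξ)) * iteratedDeriv 3 φ ξ
        + (((h₁ (tv ξ + deriv φ ξ) - h₁ (tv ξ) - h₂ (tv ξ) * deriv φ ξ) * deriv tv ξ
            + (h₁ (tv ξ + deriv φ ξ) - h₁ (tv ξ)) * iteratedDeriv 2 φ ξ) * deriv tv ξ
          + (h (tv ξ + deriv φ ξ) - h (tv ξ) - h₁ (tv ξ) * deriv φ ξ)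
            * iteratedDeriv 2 tv ξ)) ξ := by
  have hiter : ∀ {f : ℝ → ℝ} {n : ℕ}, ContDiff ℝ (n + 1 : ℕ) f →
      HasDerivAt (iteratedDeriv n f) (iteratedDeriv (n + 1) f ξ) ξ := fun {f n} hf => by
    rw [iteratedDeriv_succ]
    exact (hf.differentiable_iteratedDeriv n (by exact_mod_cast n.lt_succ_self) ξ).hasDerivAt
  have hT : HasDerivAt tv (deriv tv ξ) ξ :=
    (htv.differentiable (by norm_num) ξ).hasDerivAt
  have hT1 : HasDerivAt (deriv tv) (iteratedDeriv 2 tv ξ) ξ := by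
    simpa only [iteratedDeriv_one] using hiter (n := 1) (f := tv) htv
  have hw : HasDerivAt (deriv φ) (iteratedDeriv 2 φ ξ) ξ := by
    simpa only [iteratedDeriv_one] using
      hiter (n := 1) (f := φ) (hφ.of_le (by norm_num))
  have hw1 : HasDerivAt (iteratedDeriv 2 φ) (iteratedDeriv 3 φ ξ) ξ :=
    hiter (n := 2) (f := φ) hφ
  have hgg : ∀ z ∈ Set.Ioi (0 : ℝ), deriv (deriv g) z = h₁ z := fun z hz => by
    have he : deriv g =ᶠ[𝓝 z] h := by
      filter_upwards [isOpen_Ioi.mem_nhds hz] with y hy using hgh y hy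
    rw [he.deriv_eq, (hh z hz).deriv]
  have hG : Gterm g tv φ = fun y =>
      (h (tv y + deriv φ y) - h (tv y)) * iteratedDeriv 2 φ y +
        (h (tv y + deriv φ y) - h (tv y) - h₁ (tv y) * deriv φ y) * deriv tv y := by
    funext y
    simp only [Gterm, hgh _ (hpos y), hgh _ (hpos' y), hgg _ (hpos y)]
  have hA := (hh _ (hpos' ξ)).comp ξ (hT.add hw)
  have hB := (hh _ (hpos ξ)).comp ξ hT
  have hC := (hh₁ _ (hpos ξ)).comp ξ hT
  rw [hG]
  refine (((hA.sub hB).mul hw1).add (((hA.sub hB).sub (hC.mul hw)).mul hT1)).congr_deriv ?_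
  simp only [Function.comp_apply, Pi.add_apply, Pi.sub_apply, Pi.mul_apply]
  ring

/-- A function smooth on an open set has a derivative that is smooth there. -/
lemma ContDiffOn.hasDerivAt_and_contDiffOn_deriv {f : ℝ → ℝ} {U : Set ℝ}
    (hf : ContDiffOn ℝ (⊤ : ℕ∞) f U) (hU : IsOpen U) :
    (∀ z ∈ U, HasDerivAt f (deriv f z) z) ∧ ContDiffOn ℝ (⊤ : ℕ∞) (deriv f) U :=
  ⟨fun z hz => ((hf.contDiffAt (hU.mem_nhds hz)).differentiableAt (by simp)).hasDerivAt,
    hf.deriv_of_isOpen hU (by simp)⟩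

theorem G_term_bounds
    (p : ℝ → ℝ)
    (hp_smooth : ContDiffOn ℝ (⊤ : ℕ∞) p (Set.Ioi 0))
    (hpd : ∀ v ∈ Set.Ioi (0:ℝ), deriv p v < 0)
    (hpdd : ∀ v ∈ Set.Ioi (0:ℝ), 0 ≤ deriv (deriv p) v)
    (hpdd_ne : ∀ a b : ℝ, 0 < a → a < b → ∃ v ∈ Set.Ioo a b, deriv (deriv p) v ≠ 0)
    (μ : ℝ → ℝ)
    (hmu_smooth : ContDiffOn ℝ (⊤ : ℕ∞) μ (Set.Ioi 0))
    (hmu_pos : ∀ v ∈ Set.Ioi (0:ℝ), 0 < μ v)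
    (vp vm s : ℝ)
    (hvp : 0 < vp) (hvpvm : vp < vm)
    (hs : s = -Real.sqrt (-((p vp - p vm) / (vp - vm))))
    (hsneg : s < 0)
    (g : ℝ → ℝ)
    (hg : ∀ z ∈ Set.Ioi (0:ℝ), HasDerivAt g (μ z / z) z)
    (tv : ℝ → ℝ)
    (htv_smooth : ContDiff ℝ (⊤ : ℕ∞) tv)
    (htv_ode : ∀ ξ : ℝ, deriv tv ξ
        = tv ξ / (-s * μ (tv ξ)) * (s ^ 2 * (tv ξ - vm) + p (tv ξ) - p vm))
    (htv_mem : ∀ ξ : ℝ, tv ξ ∈ Set.Ioo vp vm)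
    (htv_dec : ∀ ξ : ℝ, deriv tv ξ < 0)
    (htv_bot : Filter.Tendsto tv Filter.atBot (nhds vm))
    (htv_top : Filter.Tendsto tv Filter.atTop (nhds vp))
    (htv_bdd : ∀ k : ℕ, ∃ M : ℝ, ∀ ξ : ℝ, |iteratedDeriv k tv ξ| ≤ M)
 :
    ∃ C > (0:ℝ), ∀ φ : ℝ → ℝ, ContDiff ℝ 3 φ →
      (∀ ξ : ℝ, |deriv φ ξ| ≤ vp / 2) →
      ∀ ξ : ℝ,
        |Gterm g tv φ ξ|
          ≤ C * (|deriv φ ξ| * |iteratedDeriv 2 φ ξ| + |deriv tv ξ| * (deriv φ ξ) ^ 2) ∧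
        |deriv (fun y => Gterm g tv φ y) ξ|
          ≤ C * ((iteratedDeriv 2 φ ξ) ^ 2 + |deriv φ ξ| * |iteratedDeriv 2 φ ξ| ^ 2
              + |deriv φ ξ| * |iteratedDeriv 3 φ ξ| + (deriv φ ξ) ^ 2) := by
  have hh : ContDiffOn ℝ (⊤ : ℕ∞) (fun z => μ z / z) (Set.Ioi 0) :=
    hmu_smooth.div contDiffOn_id fun z hz => ne_of_gt hz
  set h : ℝ → ℝ := fun z => μ z / z with h_def
  obtain ⟨hd0, hs1⟩ := hh.hasDerivAt_and_contDiffOn_deriv isOpen_Ioi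
  obtain ⟨hd1, hs2⟩ := hs1.hasDerivAt_and_contDiffOn_deriv isOpen_Ioi
  obtain ⟨hd2, hs3⟩ := hs2.hasDerivAt_and_contDiffOn_deriv isOpen_Ioi
  set K : Set ℝ := Set.Icc (vp / 2) (vm + vp / 2) with K_def
  have hKpos : K ⊆ Set.Ioi 0 := fun z hz => lt_of_lt_of_le (by positivity) hz.1
  have hKconv : Convex ℝ K := convex_Icc _ _
  have hbdd : ∀ f : ℝ → ℝ, ContDiffOn ℝ (⊤ : ℕ∞) f (Set.Ioi 0) →
      ∃ M : ℝ, ∀ z ∈ K, |f z| ≤ M := fun f hf =>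
    isCompact_Icc.exists_bound_of_continuousOn (hf.continuousOn.mono hKpos)
  obtain ⟨M1, hM1⟩ := hbdd _ hs1
  obtain ⟨M2, hM2⟩ := hbdd _ hs2
  obtain ⟨M3, hM3⟩ := hbdd _ hs3
  obtain ⟨N1, hN1⟩ := htv_bdd 1
  obtain ⟨N2, hN2⟩ := htv_bdd 2
  obtain ⟨M, hM⟩ : ∃ M : ℝ, 1 ≤ M ∧ M1 ≤ M ∧ M2 ≤ M ∧ M3 ≤ M ∧ N1 ≤ M ∧ N2 ≤ M :=
    ⟨max 1 (max M1 (max M2 (max M3 (max N1 N2)))), by simp⟩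
  obtain ⟨hM0, hMM1, hMM2, hMM3, hMN1, hMN2⟩ := hM
  refine ⟨5 * M ^ 3, by positivity, fun φ hφ hφb ξ => ?_⟩
  have hgh : ∀ z ∈ Set.Ioi (0 : ℝ), deriv g z = h z := fun z hz => (hg z hz).deriv
  have hTK : ∀ y, tv y ∈ K := fun y =>
    ⟨by linarith [(htv_mem y).1], by linarith [(htv_mem y).2]⟩
  have hvK : ∀ y, tv y + deriv φ y ∈ K := fun y => by
    have hb := abs_le.1 (hφb y)
    exact ⟨by linarith [(htv_mem y).1], by linarith [(htv_mem y).2]⟩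
  have hG := hasDerivAt_Gterm (ξ := ξ) hgh hd0 hd1 (contDiff_infty.1 htv_smooth 2) hφ
    (fun y => hKpos (hTK y)) (fun y => hKpos (hvK y))
  have b1 : |h (tv ξ + deriv φ ξ) - h (tv ξ)| ≤ M * |deriv φ ξ| := by
    simpa using abs_sub_le_of_hasDerivAt hKconv (fun z hz => hd0 z (hKpos hz))
      (fun z hz => (hM1 z hz).trans hMM1) (hTK ξ) (hvK ξ)
  have b2 : |deriv h (tv ξ + deriv φ ξ) - deriv h (tv ξ)| ≤ M * |deriv φ ξ| := by
    simpa using abs_sub_le_of_hasDerivAt hKconv (fun z hz => hd1 z (hKpos hz))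
      (fun z hz => (hM2 z hz).trans hMM2) (hTK ξ) (hvK ξ)
  have b3 : |h (tv ξ + deriv φ ξ) - h (tv ξ) - deriv h (tv ξ) * deriv φ ξ|
      ≤ M * deriv φ ξ ^ 2 := by
    simpa using abs_taylor_le_of_hasDerivAt hKconv (fun z hz => hd0 z (hKpos hz))
      (fun z hz => hd1 z (hKpos hz)) (fun z hz => (hM2 z hz).trans hMM2) (hTK ξ) (hvK ξ)
  have b4 : |deriv h (tv ξ + deriv φ ξ) - deriv h (tv ξ) - deriv (deriv h) (tv ξ) * deriv φ ξ|
      ≤ M * deriv φ ξ ^ 2 := by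
    simpa using abs_taylor_le_of_hasDerivAt hKconv (fun z hz => hd1 z (hKpos hz))
      (fun z hz => hd2 z (hKpos hz)) (fun z hz => (hM3 z hz).trans hMM3) (hTK ξ) (hvK ξ)
  constructor
  · have hgg : deriv (deriv g) (tv ξ) = deriv h (tv ξ) := by
      refine Filter.EventuallyEq.deriv_eq ?_
      filter_upwards [isOpen_Ioi.mem_nhds (hKpos (hTK ξ))] with y hy using hgh y hy
    rw [Gterm, hgh _ (hKpos (hTK ξ)), hgh _ (hKpos (hvK ξ)), hgg]
    exact abs_remainder_le hM0 b1 b3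
  · rw [show deriv (fun y => Gterm g tv φ y) ξ = _ from hG.deriv]
    refine abs_remainder_deriv_le hM0 b1 b3 b2 b4 ((hM1 _ (hvK ξ)).trans hMM1) ?_
      ((hN2 ξ).trans hMN2)
    simpa only [iteratedDeriv_one] using (hN1 ξ).trans hMN1
end
end

section
/- Let (Φ,Ψ) be twice continuously differentiable in ξ and once in t (with continuous mixed derivatives), solving the integrated perturbation system pointwise on ℝ × (0,T), with v := ṽ + Φ_ξ > 0. Then the following pointwise identity holds: ∂_t(Φ²/2 − Ψ²/(2p'(ṽ))) + ∂_ξ(−(s/2)Φ² − ΦΨ − g'(ṽ)ΦΦ_ξ + (s/(2p'(ṽ)))Ψ²) + g'(ṽ)Φ_ξ² − (s/2)·∂_ξ(1/p'(ṽ))·Ψ² = GΦ + (p(v|ṽ)/p'(ṽ))Ψ. -/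
open MeasureTheory Filter Topology Set

noncomputable section

/-- The derivative of a function that is smooth on the positive half-line is differentiable there. -/
theorem differentiableAt_deriv_of_contDiffOn_Ioi {p : ℝ → ℝ}
    (hp : ContDiffOn ℝ (⊤ : ℕ∞) p (Set.Ioi 0)) {z : ℝ} (hz : 0 < z) :
    DifferentiableAt ℝ (deriv p) z := by
  have h : ContDiffOn ℝ 1 (deriv p) (Set.Ioi 0) :=
    ContDiffOn.deriv_of_isOpen (n := (⊤ : ℕ∞)) hp isOpen_Ioi
      (WithTop.coe_le_coe.2 (le_top : (1 + 1 : ℕ∞) ≤ ⊤))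
  exact (h.differentiableOn one_ne_zero).differentiableAt (Ioi_mem_nhds hz)

/-- If `g' = μ / z` on the positive half-line with `μ` smooth there, then `g'` is differentiable
there. -/
theorem differentiableAt_deriv_of_hasDerivAt_div {g μ : ℝ → ℝ}
    (hμ : ContDiffOn ℝ (⊤ : ℕ∞) μ (Set.Ioi 0))
    (hg : ∀ z ∈ Set.Ioi (0:ℝ), HasDerivAt g (μ z / z) z) {z : ℝ} (hz : 0 < z) :
    DifferentiableAt ℝ (deriv g) z := by
  have hμz : DifferentiableAt ℝ μ z :=
    (hμ.differentiableOn (by simp)).differentiableAt (Ioi_mem_nhds hz)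
  have heq : deriv g =ᶠ[𝓝 z] fun y => μ y / y := by
    filter_upwards [Ioi_mem_nhds hz] with y hy using (hg y hy).deriv
  exact (hμz.div differentiableAt_id hz.ne').congr_of_eventuallyEq heq

theorem pointwise_energy_identity
    (p : ℝ → ℝ)
    (hp_smooth : ContDiffOn ℝ (⊤ : ℕ∞) p (Set.Ioi 0))
    (hpd : ∀ v ∈ Set.Ioi (0:ℝ), deriv p v < 0)
    (hpdd : ∀ v ∈ Set.Ioi (0:ℝ), 0 ≤ deriv (deriv p) v)
    (hpdd_ne : ∀ a b : ℝ, 0 < a → a < b → ∃ v ∈ Set.Ioo a b, deriv (deriv p) v ≠ 0)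
    (μ : ℝ → ℝ)
    (hmu_smooth : ContDiffOn ℝ (⊤ : ℕ∞) μ (Set.Ioi 0))
    (hmu_pos : ∀ v ∈ Set.Ioi (0:ℝ), 0 < μ v)
    (vp vm s : ℝ)
    (hvp : 0 < vp) (hvpvm : vp < vm)
    (hs : s = -Real.sqrt (-((p vp - p vm) / (vp - vm))))
    (hsneg : s < 0)
    (g : ℝ → ℝ)
    (hg : ∀ z ∈ Set.Ioi (0:ℝ), HasDerivAt g (μ z / z) z)
    (tv : ℝ → ℝ)
    (htv_smooth : ContDiff ℝ (⊤ : ℕ∞) tv)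
    (htv_ode : ∀ ξ : ℝ, deriv tv ξ
        = tv ξ / (-s * μ (tv ξ)) * (s ^ 2 * (tv ξ - vm) + p (tv ξ) - p vm))
    (htv_mem : ∀ ξ : ℝ, tv ξ ∈ Set.Ioo vp vm)
    (htv_dec : ∀ ξ : ℝ, deriv tv ξ < 0)
    (htv_bot : Filter.Tendsto tv Filter.atBot (nhds vm))
    (htv_top : Filter.Tendsto tv Filter.atTop (nhds vp))
    (htv_bdd : ∀ k : ℕ, ∃ M : ℝ, ∀ ξ : ℝ, |iteratedDeriv k tv ξ| ≤ M)
    (T : ℝ) (hT : 0 < T)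
    (Φ Ψ : ℝ → ℝ → ℝ)
    (hregΦ : ∀ t ∈ Set.Ioo (0:ℝ) T, ContDiff ℝ 2 (Φ t))
    (hregΨ : ∀ t ∈ Set.Ioo (0:ℝ) T, ContDiff ℝ 2 (Ψ t))
    (htΦ : ∀ t ∈ Set.Ioo (0:ℝ) T, ∀ ξ : ℝ, DifferentiableAt ℝ (fun τ => Φ τ ξ) t)
    (htΨ : ∀ t ∈ Set.Ioo (0:ℝ) T, ∀ ξ : ℝ, DifferentiableAt ℝ (fun τ => Ψ τ ξ) t)
    (hmixΦ : ContinuousOn (fun q : ℝ × ℝ => deriv (fun τ => Φ τ q.2) q.1)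
      (Set.Ioo (0:ℝ) T ×ˢ (Set.univ : Set ℝ)))
    (hmixΨ : ContinuousOn (fun q : ℝ × ℝ => deriv (fun τ => Ψ τ q.2) q.1)
      (Set.Ioo (0:ℝ) T ×ˢ (Set.univ : Set ℝ)))
    (hpos : ∀ t ∈ Set.Ioo (0:ℝ) T, ∀ ξ : ℝ, 0 < tv ξ + deriv (Φ t) ξ)
    (heq1 : ∀ t ∈ Set.Ioo (0:ℝ) T, ∀ ξ : ℝ,
      deriv (fun τ => Φ τ ξ) t - s * deriv (Φ t) ξ - deriv (Ψ t) ξ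
          - deriv g (tv ξ) * iteratedDeriv 2 (Φ t) ξ
          - deriv (deriv g) (tv ξ) * deriv tv ξ * deriv (Φ t) ξ
        = Gterm g tv (Φ t) ξ)
    (heq2 : ∀ t ∈ Set.Ioo (0:ℝ) T, ∀ ξ : ℝ,
      deriv (fun τ => Ψ τ ξ) t - s * deriv (Ψ t) ξ + deriv p (tv ξ) * deriv (Φ t) ξ
        = -prel p tv (Φ t) ξ) :
    ∀ t ∈ Set.Ioo (0:ℝ) T, ∀ ξ : ℝ,
      deriv (fun τ => (Φ τ ξ) ^ 2 / 2 - (Ψ τ ξ) ^ 2 / (2 * deriv p (tv ξ))) t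
        + deriv (fun y => -(s / 2) * (Φ t y) ^ 2 - Φ t y * Ψ t y
            - deriv g (tv y) * Φ t y * deriv (Φ t) y
            + s / (2 * deriv p (tv y)) * (Ψ t y) ^ 2) ξ
        + deriv g (tv ξ) * (deriv (Φ t) ξ) ^ 2
        - s / 2 * deriv (fun y => 1 / deriv p (tv y)) ξ * (Ψ t ξ) ^ 2
      = Gterm g tv (Φ t) ξ * Φ t ξ
        + prel p tv (Φ t) ξ / deriv p (tv ξ) * Ψ t ξ := by
  intro t ht ξ
  have hpos_tv : 0 < tv ξ := hvp.trans (htv_mem ξ).1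
  have hp_ne : deriv p (tv ξ) ≠ 0 := (hpd _ hpos_tv).ne
  have htv : HasDerivAt tv (deriv tv ξ) ξ :=
    (htv_smooth.differentiable (by simp) ξ).hasDerivAt
  have hg' : HasDerivAt (fun y => deriv g (tv y)) (deriv (deriv g) (tv ξ) * deriv tv ξ) ξ :=
    (differentiableAt_deriv_of_hasDerivAt_div hmu_smooth hg hpos_tv).hasDerivAt.comp ξ htv
  have hp' : HasDerivAt (fun y => 1 / deriv p (tv y))
      (deriv (fun y => 1 / deriv p (tv y)) ξ) ξ :=
    ((differentiableAt_const (1 : ℝ)).div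
      ((differentiableAt_deriv_of_contDiffOn_Ioi hp_smooth hpos_tv).comp ξ
        htv.differentiableAt) hp_ne).hasDerivAt
  have hΦ : HasDerivAt (Φ t) (deriv (Φ t) ξ) ξ :=
    ((hregΦ t ht).differentiable two_ne_zero ξ).hasDerivAt
  have hΨ : HasDerivAt (Ψ t) (deriv (Ψ t) ξ) ξ :=
    ((hregΨ t ht).differentiable two_ne_zero ξ).hasDerivAt
  have hΦ' : HasDerivAt (deriv (Φ t)) (iteratedDeriv 2 (Φ t) ξ) ξ := by
    have h : DifferentiableAt ℝ (iteratedDeriv 1 (Φ t)) ξ :=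
      (hregΦ t ht).differentiable_iteratedDeriv 1 (by norm_num) ξ
    rw [iteratedDeriv_succ]
    simpa only [iteratedDeriv_one] using h.hasDerivAt
  have hdt : deriv (fun τ => (Φ τ ξ) ^ 2 / 2 - (Ψ τ ξ) ^ 2 / (2 * deriv p (tv ξ))) t
      = Φ t ξ * deriv (fun τ => Φ τ ξ) t
        - Ψ t ξ * deriv (fun τ => Ψ τ ξ) t / deriv p (tv ξ) := by
    refine (((((htΦ t ht ξ).hasDerivAt.fun_pow 2).div_const 2).fun_sub
      (((htΨ t ht ξ).hasDerivAt.fun_pow 2).div_const (2 * deriv p (tv ξ)))).congr_deriv ?_).deriv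
    field_simp
    ring
  have hdξ : deriv (fun y => -(s / 2) * (Φ t y) ^ 2 - Φ t y * Ψ t y
        - deriv g (tv y) * Φ t y * deriv (Φ t) y
        + s / (2 * deriv p (tv y)) * (Ψ t y) ^ 2) ξ
      = -s * Φ t ξ * deriv (Φ t) ξ - (deriv (Φ t) ξ * Ψ t ξ + Φ t ξ * deriv (Ψ t) ξ)
        - (deriv (deriv g) (tv ξ) * deriv tv ξ * Φ t ξ * deriv (Φ t) ξ
          + deriv g (tv ξ) * (deriv (Φ t) ξ) ^ 2
          + deriv g (tv ξ) * Φ t ξ * iteratedDeriv 2 (Φ t) ξ)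
        + (s / 2 * deriv (fun y => 1 / deriv p (tv y)) ξ * (Ψ t ξ) ^ 2
          + s * Ψ t ξ * deriv (Ψ t) ξ / deriv p (tv ξ)) := by
    have hcoef : (fun y => s / (2 * deriv p (tv y)))
        = fun y => s / 2 * (1 / deriv p (tv y)) := by
      funext y
      rw [div_mul_div_comm, mul_one]
    have hcoef' : HasDerivAt (fun y => s / (2 * deriv p (tv y)))
        (s / 2 * deriv (fun y => 1 / deriv p (tv y)) ξ) ξ := by
      rw [hcoef]
      exact hp'.const_mul (s / 2)
    refine ((((((hΦ.fun_pow 2).const_mul (-(s / 2))).fun_sub (hΦ.fun_mul hΨ)).fun_sub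
      ((hg'.fun_mul hΦ).fun_mul hΦ')).fun_add
        (hcoef'.fun_mul (hΨ.fun_pow 2))).congr_deriv ?_).deriv
    generalize deriv (fun y => 1 / deriv p (tv y)) ξ = D
    field_simp
    ring
  have hprel : prel p tv (Φ t) ξ = -(deriv (fun τ => Ψ τ ξ) t - s * deriv (Ψ t) ξ
      + deriv p (tv ξ) * deriv (Φ t) ξ) := by
    rw [heq2 t ht ξ, neg_neg]
  rw [hdt, hdξ, ← heq1 t ht ξ, hprel]
  generalize deriv (fun y => 1 / deriv p (tv y)) ξ = D
  field_simp
  ring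
end
end
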